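/- arXiv:1711.05991 — 4 statements merged into one kernel-verified Lean document; each statement's English description precedes it below -/
import Mathlib

section
/- Let n ≥ 5, q ≥ 1 and k ≥ 1 be integers. The k-th term of the lower central series of the congruence subgroup SL_n(qℤ) (indexed so that Γ_1 = SL_n(qℤ) and Γ_{i+1} = ⁅SL_n(qℤ), Γ_i⁆), viewed as a subgroup of SL_n(ℤ), is equal to the congruence subgroup SL_n(q^kℤ). -/
/-- The congruence subgroup `SL_n(mℤ)`: kernel of the reduction map
`SL_n(ℤ) → SL_n(ℤ/mℤ)`. -/
def SLCongruence (n m : ℕ) : Subgroup (Matrix.SpecialLinearGroup (Fin n) ℤ) :=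
  (Matrix.SpecialLinearGroup.map (Int.castRingHom (ZMod m))).ker


/-- Admissible pairs for Mennicke symbols of level `m`. -/
def MValid (m a b : ℤ) : Prop := m ∣ a - 1 ∧ m ∣ b ∧ IsCoprime a b

/-- Dirichlet's theorem in the form needed below. -/
theorem dirichlet_aux (x y c : ℤ) (L B : ℕ) (hL : L ≠ 0) (hy : y ≠ 0) (hxy : IsCoprime x y)
    (e : ℤ) (he : x + e * y ≡ c [ZMOD L]) (hc : IsCoprime c L) :
    ∃ p : ℕ, B < p ∧ p.Prime ∧ (∃ t : ℤ, (p : ℤ) = x + t * y) ∧ (p : ℤ) ≡ c [ZMOD L] := by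
  have h1 : IsCoprime (x + e * y) y := by
    simpa using hxy.add_mul_right_left e
  have h2 : IsCoprime (x + e * y) L := by
    obtain ⟨k, hk⟩ := he.symm.dvd
    have : x + e * y = c + L * k := by linarith
    rw [this]
    exact hc.add_mul_left_left k
  have h3 : IsCoprime (x + e * y) ((y.natAbs * L : ℕ) : ℤ) := by
    push_cast
    refine IsCoprime.mul_right ?_ h2
    rcases abs_choice y with h | h <;> rw [h]
    · exact h1
    · exact h1.neg_right
  obtain ⟨p, hp, hpp, hmod⟩ := Nat.forall_exists_prime_gt_and_zmodEq B
    (q := y.natAbs * L) (by simp [hy, hL]) h3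
  refine ⟨p, hp, hpp, ?_, ?_⟩
  · have : y ∣ (x + e * y) - p := by
      refine dvd_trans ?_ hmod.dvd
      push_cast
      exact Dvd.dvd.mul_right (self_dvd_abs y) _
    obtain ⟨k, hk⟩ := this
    exact ⟨e - k, by linarith⟩
  · refine Int.ModEq.trans ?_ he
    refine hmod.of_dvd ?_
    push_cast
    exact dvd_mul_left _ _

/-- An element which has, for every prime `l`, order prime to `l`, is trivial. -/
theorem eq_one_of_forall_prime {Q : Type*} [Group Q] (g : Q)
    (h : ∀ l : ℕ, l.Prime → ∃ k : ℕ, ¬ l ∣ k ∧ g ^ k = 1) : g = 1 := by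
  rw [← orderOf_eq_one_iff]
  by_contra hne
  obtain ⟨l, hl, hdvd⟩ := Nat.exists_prime_and_dvd hne
  obtain ⟨k, hk, hgk⟩ := h l hl
  exact hk (hdvd.trans (orderOf_dvd_of_pow_eq_one hgk))

theorem exists_mul_modEq (l : ℕ) (hl : l.Prime) (x y c : ℤ) (hy : ¬ (l : ℤ) ∣ y) :
    ∃ e : ℤ, x + e * y ≡ c [ZMOD l] := by
  have hco : IsCoprime y (l : ℤ) :=
    ((Nat.prime_iff_prime_int.mp hl).coprime_iff_not_dvd.mpr hy).symm
  obtain ⟨u, v, huv⟩ := hco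
  refine ⟨u * (c - x), ?_⟩
  apply Int.ModEq.symm
  rw [Int.modEq_iff_dvd]
  exact ⟨-(v * (c - x)), by linear_combination (c - x) * huv⟩

section
variable {Q : Type*} [Group Q] (m : ℤ) (S : ℤ → ℤ → Q)

theorem mennicke_pow_right 
    (F1 : ∀ a b t, MValid m a b → S a (b + t * m * a) = S a b)
    (F2 : ∀ a b t, MValid m a b → S (a + t * b) b = S a b)
    (F3 : ∀ a b c, MValid m a b → MValid m a c → S a (b * c) = S a b * S a c)
    (F5 : ∀ b, m ∣ b → S 1 b = 1)
    (a b : ℤ) (hV : MValid m a b) (k : ℕ) (hk : k ≠ 0)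
    (h : a ∣ b ^ k - 1 ∨ a ∣ b ^ k + 1) : S a b ^ k = 1 := by
  obtain ⟨ha, hb, hab⟩ := hV
  have hpow : ∀ j : ℕ, MValid m a (b ^ (j + 1)) ∧ S a b ^ (j + 1) = S a (b ^ (j + 1)) := by
    intro j
    induction j with
    | zero => simpa using ⟨ha, hb, hab⟩
    | succ j ih =>
      refine ⟨⟨ha, dvd_pow hb (by omega), hab.pow_right⟩, ?_⟩
      rw [pow_succ, ih.2, pow_succ b (j + 1), F3 a _ _ ih.1 ⟨ha, hb, hab⟩]
  obtain ⟨j, rfl⟩ := Nat.exists_eq_succ_of_ne_zero hk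
  obtain ⟨hv, he⟩ := hpow j
  rw [Nat.succ_eq_add_one, he]
  have ham : IsCoprime m a := by
    obtain ⟨u, hu⟩ := ha
    exact ⟨-u, 1, by linear_combination hu⟩
  have hone : ∀ s : ℤ, s = 1 ∨ s = -1 → a ∣ b ^ (j + 1) - s → S a (b ^ (j + 1)) = 1 := by
    intro s hs hd
    obtain ⟨u, hu⟩ := hd
    have hbm := hv.2.1
    have hmu : m ∣ u + s := by
      apply ham.dvd_of_dvd_mul_left
      have : a * (u + s) = b ^ (j + 1) + s * (a - 1) := by linear_combination -hu
      rw [this]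
      exact dvd_add hbm (Dvd.dvd.mul_left ha _)
    obtain ⟨w, hw⟩ := hmu
    have h1 : b ^ (j + 1) = s * (1 - a) + w * m * a := by
      linear_combination hu + a * hw
    have hV2 : MValid m a (s * (1 - a)) := by
      refine ⟨ha, Dvd.dvd.mul_left ((dvd_sub_comm).mp ha) _, ?_⟩
      rcases hs with rfl | rfl
      · exact ⟨1, 1, by ring⟩
      · exact ⟨1, -1, by ring⟩
    have hs2 : s * s = 1 := by rcases hs with rfl | rfl <;> norm_num
    rw [h1, F1 _ _ _ hV2, ← F2 _ _ s hV2]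
    have : a + s * (s * (1 - a)) = 1 := by linear_combination (1 - a) * hs2
    rw [this]
    exact F5 _ hV2.2.1
  rcases h with h | h
  · exact hone 1 (Or.inl rfl) h
  · exact hone (-1) (Or.inr rfl) (by simpa using h)

theorem mennicke_pow_left 
    (F2 : ∀ a b t, MValid m a b → S (a + t * b) b = S a b)
    (F4 : ∀ a c b, MValid m a b → MValid m c b → S (a * c) b = S a b * S c b)
    (F5 : ∀ b, m ∣ b → S 1 b = 1)
    (a b : ℤ) (hV : MValid m a b) (k : ℕ) 
    (h : b ∣ a ^ k - 1) : S a b ^ k = 1 := by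
  obtain ⟨ha, hb, hab⟩ := hV
  have hpow : ∀ j : ℕ, MValid m (a ^ j) b ∧ S a b ^ j = S (a ^ j) b := by
    intro j
    induction j with
    | zero => simpa [MValid, F5 b hb, isCoprime_one_left] using hb
    | succ j ih =>
      refine ⟨⟨?_, hb, hab.pow_left⟩, ?_⟩
      · have : a ^ (j + 1) - 1 = a * (a ^ j - 1) + (a - 1) := by ring
        rw [this]
        exact dvd_add (Dvd.dvd.mul_left ih.1.1 _) ha
      · rw [pow_succ, ih.2, pow_succ a, F4 _ _ _ ih.1 ⟨ha, hb, hab⟩]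
  obtain ⟨hv, he⟩ := hpow k
  obtain ⟨u, hu⟩ := h
  rw [he, ← F2 _ _ (-u) hv]
  have : a ^ k + -u * b = 1 := by linear_combination hu
  rw [this, F5 b hb]

theorem mennicke_trivial (hm : 0 < m)
    (F1 : ∀ a b t, MValid m a b → S a (b + t * m * a) = S a b)
    (F2 : ∀ a b t, MValid m a b → S (a + t * b) b = S a b)
    (F3 : ∀ a b c, MValid m a b → MValid m a c → S a (b * c) = S a b * S a c)
    (F4 : ∀ a c b, MValid m a b → MValid m c b → S (a * c) b = S a b * S c b)
    (F5 : ∀ b, m ∣ b → S 1 b = 1)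
    (a b : ℤ) (hV : MValid m a b) : S a b = 1 := by
  have V1 : ∀ a b t, MValid m a b → MValid m a (b + t * m * a) := by
    rintro a b t ⟨h1, h2, h3⟩
    refine ⟨h1, dvd_add h2 ⟨t * a, by ring⟩, ?_⟩
    exact h3.add_mul_right_right (t * m)
  have V2 : ∀ a b t, MValid m a b → MValid m (a + t * b) b := by
    rintro a b t ⟨h1, h2, h3⟩
    refine ⟨?_, h2, h3.add_mul_right_left t⟩
    have : a + t * b - 1 = (a - 1) + t * b := by ring
    rw [this]
    exact dvd_add h1 (Dvd.dvd.mul_left h2 _)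
  apply eq_one_of_forall_prime
  intro l hl
  have hlI := Nat.prime_iff_prime_int.mp hl
  have ham : IsCoprime m a := by
    obtain ⟨u, hu⟩ := hV.1
    exact ⟨-u, 1, by linear_combination hu⟩
  by_cases hl2 : l = 2
  · subst hl2
    -- reduce to the case where `b ≠ 0` and `4 ∤ b` or `4 ∣ m`
    obtain ⟨b', hV', hS, hb0, hb4⟩ : ∃ b', MValid m a b' ∧ S a b' = S a b ∧ b' ≠ 0 ∧
        (¬ (4 : ℤ) ∣ b' ∨ (4 : ℤ) ∣ m) := by
      by_cases h4 : ¬ (4 : ℤ) ∣ b ∨ ((4 : ℤ) ∣ m ∧ b ≠ 0)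
      · refine ⟨b, hV, rfl, ?_, ?_⟩
        · rcases h4 with h | h
          · rintro rfl; simp at h
          · exact h.2
        · exact h4.imp id And.left
      · push Not at h4
        have hao : ¬ (2 : ℤ) ∣ a := by
          intro h2
          have := hV.2.2.isUnit_of_dvd' h2 (dvd_trans (by norm_num) h4.1)
          exact absurd this (by decide)
        have ha0 : a ≠ 0 := by rintro rfl; simp at hao
        refine ⟨b + 1 * m * a, V1 _ _ _ hV, F1 _ _ _ hV, ?_, ?_⟩
        · by_cases hm4 : (4 : ℤ) ∣ m
          · rw [h4.2 hm4]; simp [ha0, hm.ne']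
          · intro h0
            apply hm4
            have : (4 : ℤ) ∣ m * a := by
              have : m * a = -b := by linarith
              rw [this]; exact (dvd_neg).mpr h4.1
            have hco : IsCoprime (4 : ℤ) a := by
              have : IsCoprime (2 : ℤ) a := (Int.prime_two.coprime_iff_not_dvd).mpr hao
              simpa using this.pow_left (m := 2)
            exact hco.dvd_of_dvd_mul_right this
        · by_cases hm4 : (4 : ℤ) ∣ m
          · exact Or.inr hm4
          · left
            intro h0
            apply hm4
            have : (4 : ℤ) ∣ m * a := by
              have : m * a = (b + 1 * m * a) - b := by ring
              rw [this]; exact dvd_sub h0 h4.1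
            have hco : IsCoprime (4 : ℤ) a := by
              have : IsCoprime (2 : ℤ) a := (Int.prime_two.coprime_iff_not_dvd).mpr hao
              simpa using this.pow_left (m := 2)
            exact hco.dvd_of_dvd_mul_right this
    rw [← hS]
    obtain ⟨e, he⟩ : ∃ e : ℤ, -a + e * b' ≡ 3 [ZMOD (4 : ℕ)] := by
      have h1 : (¬ (4 : ℤ) ∣ b') ∨ a % 4 = 1 := by
        rcases hb4 with h | h
        · exact Or.inl h
        · right
          have := h.trans hV'.1
          omega
      have h2 : ¬ ((2 : ℤ) ∣ a ∧ (2 : ℤ) ∣ b') := by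
        rintro ⟨h2, h3⟩
        exact absurd (hV'.2.2.isUnit_of_dvd' h2 h3) (by decide)
      simp only [Int.ModEq]
      push_cast
      by_contra! hcon
      have c0 := hcon 0
      have c1 := hcon 1
      have c2 := hcon 2
      have c3 := hcon 3
      have ha4 : a % 4 = 0 ∨ a % 4 = 1 ∨ a % 4 = 2 ∨ a % 4 = 3 := by omega
      have hb4 : b' % 4 = 0 ∨ b' % 4 = 1 ∨ b' % 4 = 2 ∨ b' % 4 = 3 := by omega
      rcases ha4 with ha4 | ha4 | ha4 | ha4 <;> rcases hb4 with hb4 | hb4 | hb4 | hb4 <;> omega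
    obtain ⟨p, -, hp, ⟨t, ht⟩, hp3⟩ := dirichlet_aux (-a) b' 3 4 0 (by norm_num) hb0
      hV'.2.2.neg_left e he ⟨-1, 1, by norm_num⟩
    have hp3' : p % 4 = 3 := by
      have := hp3
      simp only [Int.ModEq] at this
      push_cast at this
      omega
    refine ⟨(p - 1) / 2, by omega, ?_⟩
    have hV'' := V2 _ _ (-t) hV'
    rw [← F2 _ _ (-t) hV']
    have hpe : a + -t * b' = -(p : ℤ) := by rw [ht]; ring
    rw [hpe] at hV'' ⊢
    apply mennicke_pow_right m S F1 F2 F3 F5 _ _ hV'' _ (by omega)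
    have hd : (p : ℤ) ∣ (b' ^ ((p - 1) / 2) - 1) * (b' ^ ((p - 1) / 2) + 1) := by
      have hfl := Int.ModEq.pow_card_sub_one_eq_one hp (n := b') (by
        have := hV''.2.2
        rw [IsCoprime.neg_left_iff] at this
        exact this.symm)
      have : (b' ^ ((p - 1) / 2) - 1) * (b' ^ ((p - 1) / 2) + 1) = b' ^ (p - 1) - 1 := by
        have h2 : p - 1 = (p - 1) / 2 * 2 := by omega
        conv_rhs => rw [h2, pow_mul]
        ring
      rw [this]
      exact hfl.symm.dvd
    rcases (Nat.prime_iff_prime_int.mp hp).dvd_or_dvd hd with h | h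
    · exact Or.inl ((neg_dvd).mpr h)
    · exact Or.inr ((neg_dvd).mpr h)
  · have hl3 : 3 ≤ l := by
      have := hl.two_le
      omega
    have hc2 : IsCoprime (2 : ℤ) (l : ℤ) := by
      have : Nat.Coprime 2 l := (Nat.coprime_primes Nat.prime_two hl).mpr (Ne.symm hl2)
      exact_mod_cast (Nat.isCoprime_iff_coprime (m := 2) (n := l)).mpr this
    have hsub : ∀ r : ℕ, 1 ≤ r → (r : ℤ) ≡ 2 [ZMOD l] → ¬ l ∣ r - 1 := by
      intro r hr h2 hd
      have h3 : (l : ℤ) ∣ (r : ℤ) - 1 := by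
        have := Int.natCast_dvd_natCast.mpr hd
        rwa [Nat.cast_sub hr, Nat.cast_one] at this
      have h4 : (l : ℤ) ∣ 1 := by
        have := dvd_add h3 h2.dvd
        simpa using this
      have := Int.le_of_dvd one_pos h4
      omega
    by_cases hlm : (l : ℤ) ∣ m
    · -- change `b` into `m * r`
      obtain ⟨b', hb'⟩ := hV.2.1
      have hla : ¬ (l : ℤ) ∣ a := fun h =>
        hlI.not_isUnit (ham.isUnit_of_dvd' hlm h)
      have ha0 : a ≠ 0 := by rintro rfl; simp at hla
      obtain ⟨e, he⟩ := exists_mul_modEq l hl b' a 2 hla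
      have hco : IsCoprime b' a := by
        have := hV.2.2
        rw [hb'] at this
        exact (IsCoprime.of_mul_right_right this).symm
      obtain ⟨r, hrm, hr, ⟨t, ht⟩, hr2⟩ := dirichlet_aux b' a 2 l m.natAbs hl.ne_zero ha0 hco e he hc2
      refine ⟨r - 1, hsub r hr.one_le hr2, ?_⟩
      have hV' := V1 _ _ t hV
      rw [← F1 _ _ t hV]
      have hbe : b + t * m * a = m * r := by rw [hb', ht]; ring
      rw [hbe] at hV' ⊢
      apply mennicke_pow_left m S F2 F4 F5 _ _ hV'
      have hmr : IsCoprime m (r : ℤ) := by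
        apply IsCoprime.symm
        rw [(Nat.prime_iff_prime_int.mp hr).coprime_iff_not_dvd]
        intro h
        have := Int.le_of_dvd hm h
        omega
      apply hmr.mul_dvd
      · exact hV'.1.trans (sub_one_dvd_pow_sub_one a _)
      · have hfl := Int.ModEq.pow_card_sub_one_eq_one hr (n := a)
          (IsCoprime.of_mul_right_right hV'.2.2)
        exact hfl.symm.dvd
    · obtain ⟨b', hV', hS, hlb⟩ : ∃ b', MValid m a b' ∧ S a b' = S a b ∧ ¬ (l : ℤ) ∣ b' := by
        by_cases hlb : (l : ℤ) ∣ b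
        · refine ⟨b + 1 * m * a, V1 _ _ _ hV, F1 _ _ _ hV, ?_⟩
          intro h
          have h1 : (l : ℤ) ∣ m * a := by
            have : m * a = (b + 1 * m * a) - b := by ring
            rw [this]; exact dvd_sub h hlb
          rcases hlI.dvd_or_dvd h1 with h2 | h2
          · exact hlm h2
          · exact hlI.not_isUnit (hV.2.2.isUnit_of_dvd' h2 hlb)
        · exact ⟨b, hV, rfl, hlb⟩
      rw [← hS]
      have hb0 : b' ≠ 0 := by rintro rfl; simp at hlb
      obtain ⟨e, he⟩ := exists_mul_modEq l hl a b' 2 hlb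
      obtain ⟨p, -, hp, ⟨t, ht⟩, hp2⟩ := dirichlet_aux a b' 2 l 0 hl.ne_zero hb0 hV'.2.2 e he hc2
      refine ⟨p - 1, hsub p hp.one_le hp2, ?_⟩
      have hV'' := V2 _ _ t hV'
      rw [← F2 _ _ t hV']
      rw [← ht] at hV'' ⊢
      apply mennicke_pow_right m S F1 F2 F3 F5 _ _ hV'' _ (by have := hp.two_le; omega)
      left
      exact (Int.ModEq.pow_card_sub_one_eq_one hp hV''.2.2.symm).symm.dvd
end

namespace SLThree

open Matrix

/-- `SL_3(ℤ)` -/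
abbrev G3 := Matrix.SpecialLinearGroup (Fin 3) ℤ

def e01 (t : ℤ) : G3 := ⟨!![1, t, 0; 0, 1, 0; 0, 0, 1], by simp [det_fin_three]⟩
def e02 (t : ℤ) : G3 := ⟨!![1, 0, t; 0, 1, 0; 0, 0, 1], by simp [det_fin_three]⟩
def e10 (t : ℤ) : G3 := ⟨!![1, 0, 0; t, 1, 0; 0, 0, 1], by simp [det_fin_three]⟩
def e12 (t : ℤ) : G3 := ⟨!![1, 0, 0; 0, 1, t; 0, 0, 1], by simp [det_fin_three]⟩
def e20 (t : ℤ) : G3 := ⟨!![1, 0, 0; 0, 1, 0; t, 0, 1], by simp [det_fin_three]⟩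
def e21 (t : ℤ) : G3 := ⟨!![1, 0, 0; 0, 1, 0; 0, t, 1], by simp [det_fin_three]⟩

/-- 2x2 blocks in the three positions. -/
def b01 (a b c d : ℤ) (h : a * d - b * c = 1) : G3 :=
  ⟨!![a, b, 0; c, d, 0; 0, 0, 1], by simp [det_fin_three]; linarith⟩
def b02 (a b c d : ℤ) (h : a * d - b * c = 1) : G3 :=
  ⟨!![a, 0, b; 0, 1, 0; c, 0, d], by simp [det_fin_three]; linarith⟩
def b12 (a b c d : ℤ) (h : a * d - b * c = 1) : G3 :=
  ⟨!![1, 0, 0; 0, a, b; 0, c, d], by simp [det_fin_three]; linarith⟩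

theorem e01_coe (t : ℤ) : (e01 t : Matrix (Fin 3) (Fin 3) ℤ) = !![1, t, 0; 0, 1, 0; 0, 0, 1] := rfl
theorem e02_coe (t : ℤ) : (e02 t : Matrix (Fin 3) (Fin 3) ℤ) = !![1, 0, t; 0, 1, 0; 0, 0, 1] := rfl
theorem e10_coe (t : ℤ) : (e10 t : Matrix (Fin 3) (Fin 3) ℤ) = !![1, 0, 0; t, 1, 0; 0, 0, 1] := rfl
theorem e12_coe (t : ℤ) : (e12 t : Matrix (Fin 3) (Fin 3) ℤ) = !![1, 0, 0; 0, 1, t; 0, 0, 1] := rfl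
theorem e20_coe (t : ℤ) : (e20 t : Matrix (Fin 3) (Fin 3) ℤ) = !![1, 0, 0; 0, 1, 0; t, 0, 1] := rfl
theorem e21_coe (t : ℤ) : (e21 t : Matrix (Fin 3) (Fin 3) ℤ) = !![1, 0, 0; 0, 1, 0; 0, t, 1] := rfl
theorem b01_coe (a b c d : ℤ) (h : a * d - b * c = 1) :
    (b01 a b c d h : Matrix (Fin 3) (Fin 3) ℤ) = !![a, b, 0; c, d, 0; 0, 0, 1] := rfl
theorem b02_coe (a b c d : ℤ) (h : a * d - b * c = 1) :
    (b02 a b c d h : Matrix (Fin 3) (Fin 3) ℤ) = !![a, 0, b; 0, 1, 0; c, 0, d] := rfl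
theorem b12_coe (a b c d : ℤ) (h : a * d - b * c = 1) :
    (b12 a b c d h : Matrix (Fin 3) (Fin 3) ℤ) = !![1, 0, 0; 0, a, b; 0, c, d] := rfl

theorem ext3 (A B : G3) (h00 : A 0 0 = B 0 0) (h01 : A 0 1 = B 0 1) (h02 : A 0 2 = B 0 2)
    (h10 : A 1 0 = B 1 0) (h11 : A 1 1 = B 1 1) (h12 : A 1 2 = B 1 2)
    (h20 : A 2 0 = B 2 0) (h21 : A 2 1 = B 2 1) (h22 : A 2 2 = B 2 2) : A = B := by
  ext i j
  fin_cases i <;> fin_cases j <;> assumption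

section
variable (N : Subgroup G3) [N.Normal] (m : ℤ)

/-- all elementary matrices of level `m` lie in `N` -/
structure Lev : Prop where
  h01 : ∀ t, m ∣ t → e01 t ∈ N
  h02 : ∀ t, m ∣ t → e02 t ∈ N
  h10 : ∀ t, m ∣ t → e10 t ∈ N
  h12 : ∀ t, m ∣ t → e12 t ∈ N
  h20 : ∀ t, m ∣ t → e20 t ∈ N
  h21 : ∀ t, m ∣ t → e21 t ∈ N

variable {N m}

local notation "π" => QuotientGroup.mk' N

theorem e01_add (s t : ℤ) : e01 (s + t) = e01 s * e01 t := by
  apply ext3 <;> simp [e01_coe, Matrix.mul_apply, Fin.sum_univ_three, add_comm]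
theorem e02_add (s t : ℤ) : e02 (s + t) = e02 s * e02 t := by
  apply ext3 <;> simp [e02_coe, Matrix.mul_apply, Fin.sum_univ_three, add_comm]
theorem e10_add (s t : ℤ) : e10 (s + t) = e10 s * e10 t := by
  apply ext3 <;> simp [e10_coe, Matrix.mul_apply, Fin.sum_univ_three, add_comm]
theorem e12_add (s t : ℤ) : e12 (s + t) = e12 s * e12 t := by
  apply ext3 <;> simp [e12_coe, Matrix.mul_apply, Fin.sum_univ_three, add_comm]
theorem e20_add (s t : ℤ) : e20 (s + t) = e20 s * e20 t := by
  apply ext3 <;> simp [e20_coe, Matrix.mul_apply, Fin.sum_univ_three, add_comm]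
theorem e21_add (s t : ℤ) : e21 (s + t) = e21 s * e21 t := by
  apply ext3 <;> simp [e21_coe, Matrix.mul_apply, Fin.sum_univ_three, add_comm]

theorem pi_one {x : G3} (h : x ∈ N) : π x = 1 := (QuotientGroup.eq_one_iff x).mpr h

theorem Lev.p01 (L : Lev N m) (s t : ℤ) (h : m ∣ s - t) : π (e01 s) = π (e01 t) := by
  have : e01 s = e01 (s - t) * e01 t := by rw [← e01_add]; simp
  rw [this, map_mul, pi_one (L.h01 _ h), one_mul]
theorem Lev.p02 (L : Lev N m) (s t : ℤ) (h : m ∣ s - t) : π (e02 s) = π (e02 t) := by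
  have : e02 s = e02 (s - t) * e02 t := by rw [← e02_add]; simp
  rw [this, map_mul, pi_one (L.h02 _ h), one_mul]
theorem Lev.p10 (L : Lev N m) (s t : ℤ) (h : m ∣ s - t) : π (e10 s) = π (e10 t) := by
  have : e10 s = e10 (s - t) * e10 t := by rw [← e10_add]; simp
  rw [this, map_mul, pi_one (L.h10 _ h), one_mul]
theorem Lev.p12 (L : Lev N m) (s t : ℤ) (h : m ∣ s - t) : π (e12 s) = π (e12 t) := by
  have : e12 s = e12 (s - t) * e12 t := by rw [← e12_add]; simp
  rw [this, map_mul, pi_one (L.h12 _ h), one_mul]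
theorem Lev.p20 (L : Lev N m) (s t : ℤ) (h : m ∣ s - t) : π (e20 s) = π (e20 t) := by
  have : e20 s = e20 (s - t) * e20 t := by rw [← e20_add]; simp
  rw [this, map_mul, pi_one (L.h20 _ h), one_mul]
theorem Lev.p21 (L : Lev N m) (s t : ℤ) (h : m ∣ s - t) : π (e21 s) = π (e21 t) := by
  have : e21 s = e21 (s - t) * e21 t := by rw [← e21_add]; simp
  rw [this, map_mul, pi_one (L.h21 _ h), one_mul]

/-- `π (b01 ..)` commutes with the images of the elementary matrices. -/
theorem Lev.comm (L : Lev N m) (a b c d : ℤ) (h : a * d - b * c = 1)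
    (ha : m ∣ a - 1) (hb : m ∣ b) (hc : m ∣ c) (hd : m ∣ d - 1) :
    (∀ t, Commute (π (b01 a b c d h)) (π (e01 t))) ∧
    (∀ t, Commute (π (b01 a b c d h)) (π (e10 t))) ∧
    (∀ t, Commute (π (b01 a b c d h)) (π (e12 t))) ∧
    (∀ t, Commute (π (b01 a b c d h)) (π (e21 t))) := by
  have k02 : ∀ t, Commute (π (b01 a b c d h)) (π (e02 t)) := by
    intro t
    have e : b01 a b c d h * e02 t = e02 (a * t) * e12 (c * t) * b01 a b c d h := by
      apply ext3 <;> simp [b01_coe, e02_coe, e12_coe, Matrix.mul_apply, Fin.sum_univ_three]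
    have e' := congrArg (π) e
    simp only [map_mul] at e'
    rw [pi_one (L.h12 _ (Dvd.dvd.mul_right hc t)), mul_one,
      L.p02 (a * t) t (by simpa [sub_mul] using Dvd.dvd.mul_right ha t)] at e'
    exact e'
  have k12 : ∀ t, Commute (π (b01 a b c d h)) (π (e12 t)) := by
    intro t
    have e : b01 a b c d h * e12 t = e02 (b * t) * e12 (d * t) * b01 a b c d h := by
      apply ext3 <;> simp [b01_coe, e02_coe, e12_coe, Matrix.mul_apply, Fin.sum_univ_three]
    have e' := congrArg (π) e
    simp only [map_mul] at e'
    rw [pi_one (L.h02 _ (Dvd.dvd.mul_right hb t)), one_mul,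
      L.p12 (d * t) t (by simpa [sub_mul] using Dvd.dvd.mul_right hd t)] at e'
    exact e'
  have k20 : ∀ t, Commute (π (b01 a b c d h)) (π (e20 t)) := by
    intro t
    have e : e20 t * b01 a b c d h = b01 a b c d h * (e20 (a * t) * e21 (b * t)) := by
      apply ext3 <;> simp [b01_coe, e20_coe, e21_coe, Matrix.mul_apply, Fin.sum_univ_three, mul_comm]
    have e' := congrArg (π) e
    simp only [map_mul] at e'
    rw [pi_one (L.h21 _ (Dvd.dvd.mul_right hb t)), mul_one,
      L.p20 (a * t) t (by simpa [sub_mul] using Dvd.dvd.mul_right ha t)] at e'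
    exact e'.symm
  have k21 : ∀ t, Commute (π (b01 a b c d h)) (π (e21 t)) := by
    intro t
    have e : e21 t * b01 a b c d h = b01 a b c d h * (e20 (c * t) * e21 (d * t)) := by
      apply ext3 <;> simp [b01_coe, e20_coe, e21_coe, Matrix.mul_apply, Fin.sum_univ_three, mul_comm]
    have e' := congrArg (π) e
    simp only [map_mul] at e'
    rw [pi_one (L.h20 _ (Dvd.dvd.mul_right hc t)), one_mul,
      L.p21 (d * t) t (by simpa [sub_mul] using Dvd.dvd.mul_right hd t)] at e'
    exact e'.symm
  refine ⟨?_, ?_, k12, k21⟩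
  · intro t
    have e : e01 t = e02 t * e21 1 * e02 (-t) * e21 (-1) := by
      apply ext3 <;> simp [e01_coe, e02_coe, e21_coe, Matrix.mul_apply, Fin.sum_univ_three]
    rw [e]
    simp only [map_mul]
    exact (((k02 _).mul_right (k21 _)).mul_right (k02 _)).mul_right (k21 _)
  · intro t
    have e : e10 t = e12 t * e20 1 * e12 (-t) * e20 (-1) := by
      apply ext3 <;> simp [e10_coe, e12_coe, e20_coe, Matrix.mul_apply, Fin.sum_univ_three]
    rw [e]
    simp only [map_mul]
    exact (((k12 _).mul_right (k20 _)).mul_right (k12 _)).mul_right (k20 _)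

def w01 : G3 := e01 1 * e10 (-1) * e01 1
def w12 : G3 := e12 1 * e21 (-1) * e12 1

theorem Lev.comm_w (L : Lev N m) (a b c d : ℤ) (h : a * d - b * c = 1)
    (ha : m ∣ a - 1) (hb : m ∣ b) (hc : m ∣ c) (hd : m ∣ d - 1) :
    Commute (π (b01 a b c d h)) (π w01) ∧ Commute (π (b01 a b c d h)) (π w12) := by
  obtain ⟨k01, k10, k12, k21⟩ := L.comm a b c d h ha hb hc hd
  constructor
  · simp only [w01, map_mul]
    exact ((k01 _).mul_right (k10 _)).mul_right (k01 _)
  · simp only [w12, map_mul]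
    exact ((k12 _).mul_right (k21 _)).mul_right (k12 _)

theorem Lev.b12_eq (L : Lev N m) (a b c d : ℤ) (h : a * d - b * c = 1)
    (ha : m ∣ a - 1) (hb : m ∣ b) (hc : m ∣ c) (hd : m ∣ d - 1) :
    π (b12 a b c d h) = π (b01 a b c d h) := by
  obtain ⟨k1, k2⟩ := L.comm_w a b c d h ha hb hc hd
  have e : b12 a b c d h * (w01 * w12) = (w01 * w12) * b01 a b c d h := by
    apply ext3 <;> simp [b01_coe, b12_coe, w01, w12, e01_coe, e12_coe, e10_coe, e21_coe, Matrix.mul_apply, Fin.sum_univ_three]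
  have e' := congrArg (π) e
  rw [map_mul, map_mul _ _ (b01 a b c d h)] at e'
  have k3 : Commute (π (b01 a b c d h)) (π (w01 * w12)) := by
    rw [map_mul]; exact k1.mul_right k2
  rw [← k3.eq] at e'
  exact mul_right_cancel e'

theorem Lev.b02_eq (L : Lev N m) (a b c d : ℤ) (h : a * d - b * c = 1)
    (ha : m ∣ a - 1) (hb : m ∣ b) (hc : m ∣ c) (hd : m ∣ d - 1) :
    π (b02 a b c d h) = π (b01 a b c d h) := by
  obtain ⟨k1, k2⟩ := L.comm_w a b c d h ha hb hc hd
  have e : b02 a b c d h * (w01 * w01 * w12) = (w01 * w01 * w12) * b01 a b c d h := by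
    apply ext3 <;> simp [b01_coe, b02_coe, w01, w12, e01_coe, e12_coe, e10_coe, e21_coe, Matrix.mul_apply, Fin.sum_univ_three]
  have e' := congrArg (π) e
  rw [map_mul, map_mul _ _ (b01 a b c d h)] at e'
  have k3 : Commute (π (b01 a b c d h)) (π (w01 * w01 * w12)) := by
    rw [map_mul, map_mul]; exact (k1.mul_right k1).mul_right k2
  rw [← k3.eq] at e'
  exact mul_right_cancel e'

open Classical in
/-- The Mennicke symbol -/
noncomputable def sym (N : Subgroup G3) [N.Normal] (m a b : ℤ) : G3 ⧸ N :=
  if h : ∃ cd : ℤ × ℤ, a * cd.2 - b * cd.1 = 1 ∧ m ∣ cd.1 then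
    QuotientGroup.mk' N (b01 a b h.choose.1 h.choose.2 h.choose_spec.1) else 1

theorem Lev.sym_eq (L : Lev N m) (a b c d : ℤ) (h : a * d - b * c = 1) (hc : m ∣ c) :
    sym N m a b = π (b01 a b c d h) := by
  have hex : ∃ cd : ℤ × ℤ, a * cd.2 - b * cd.1 = 1 ∧ m ∣ cd.1 := ⟨(c, d), h, hc⟩
  rw [sym, dif_pos hex]
  generalize_proofs p
  obtain ⟨h', hc'⟩ := hex.choose_spec
  revert p
  generalize hex.choose.1 = c' at *
  generalize hex.choose.2 = d' at *
  intro p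
  have e : b01 a b c' d' p = e10 (c' * d - d' * c) * b01 a b c d h := by
    apply ext3 <;> simp [b01_coe, e10_coe, Matrix.mul_apply, Fin.sum_univ_three]
    · linear_combination (-c') * h + c * p
    · linear_combination (-d') * h + d * p
  rw [e, map_mul, pi_one (L.h10 _ (dvd_sub (Dvd.dvd.mul_right hc' _) (Dvd.dvd.mul_left hc _))),
    one_mul]

theorem dvd_d {a b c d : ℤ} (h : a * d - b * c = 1) (ha : m ∣ a - 1) (hb : m ∣ b) :
    m ∣ d - 1 := by
  have : d - 1 = b * c - (a - 1) * d := by linear_combination h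
  rw [this]
  exact dvd_sub (Dvd.dvd.mul_right hb _) (Dvd.dvd.mul_right ha _)

theorem valid_exists {a b : ℤ} (h : MValid m a b) :
    ∃ c d, a * d - b * c = 1 ∧ m ∣ c ∧ m ∣ d - 1 := by
  obtain ⟨ha, hb, hab⟩ := h
  have ham : IsCoprime a m := by
    obtain ⟨u, hu⟩ := ha
    exact ⟨1, -u, by linear_combination hu⟩
  obtain ⟨u, v, huv⟩ := hab.mul_right ham
  have h : a * u - b * (-(v * m)) = 1 := by linear_combination huv
  exact ⟨-(v * m), u, h, (dvd_neg).mpr (dvd_mul_left _ _), dvd_d h ha hb⟩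

theorem Lev.F1 (L : Lev N m) (a b t : ℤ) (hV : MValid m a b) :
    sym N m a (b + t * m * a) = sym N m a b := by
  obtain ⟨c, d, h, hc, hd⟩ := valid_exists hV
  rw [L.sym_eq a b c d h hc, L.sym_eq a (b + t * m * a) c (d + t * m * c)
    (by linear_combination h) hc]
  have e : b01 a (b + t * m * a) c (d + t * m * c) (by linear_combination h)
      = b01 a b c d h * e01 (t * m) := by
    apply ext3 <;> simp [b01_coe, e01_coe, Matrix.mul_apply, Fin.sum_univ_three] <;> ring
  rw [e, map_mul, pi_one (L.h01 _ (dvd_mul_left _ _)), mul_one]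

theorem Lev.F2 (L : Lev N m) (a b t : ℤ) (hV : MValid m a b) :
    sym N m (a + t * b) b = sym N m a b := by
  obtain ⟨c, d, h, hc, hd⟩ := valid_exists hV
  have h' : (a + t * b) * (d - t * b) - b * (c + t * d - t * a - t * t * b) = 1 := by
    linear_combination h
  have hc' : m ∣ c + t * d - t * a - t * t * b := by
    have : c + t * d - t * a - t * t * b = c + t * (d - 1) - t * (a - 1) - t * t * b := by ring
    rw [this]
    exact dvd_sub (dvd_sub (dvd_add hc (Dvd.dvd.mul_left hd _)) (Dvd.dvd.mul_left hV.1 _))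
      (Dvd.dvd.mul_left hV.2.1 _)
  rw [L.sym_eq a b c d h hc, L.sym_eq _ _ _ _ h' hc']
  have e : e10 t * b01 (a + t * b) b (c + t * d - t * a - t * t * b) (d - t * b) h'
      = b01 a b c d h * e10 t := by
    apply ext3 <;> simp [b01_coe, e10_coe, Matrix.mul_apply, Fin.sum_univ_three] <;> ring
  have e' := congrArg (π) e
  rw [map_mul, map_mul, ((L.comm a b c d h hV.1 hV.2.1 hc hd).2.1 t).eq] at e'
  exact mul_left_cancel e'

theorem Lev.F3 (L : Lev N m) (a x y : ℤ) (hx : MValid m a x) (hy : MValid m a y) :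
    sym N m a (x * y) = sym N m a x * sym N m a y := by
  have hV : MValid m a (x * y) := ⟨hx.1, Dvd.dvd.mul_right hx.2.1 _, hx.2.2.mul_right hy.2.2⟩
  obtain ⟨z, d, h, hz, hd⟩ := valid_exists hV
  have h1 : a * d - x * (y * z) = 1 := by linear_combination h
  have h2 : a * d - y * (z * x) = 1 := by linear_combination h
  have h3 : a * (d - d * x * y * z) - (x * y) * (-(x * y * z * z)) = 1 := by
    linear_combination (1 - x * y * z) * h
  have hc3 : m ∣ -(x * y * z * z) := (dvd_neg).mpr (Dvd.dvd.mul_left hz _)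
  rw [L.sym_eq a x _ _ h1 (Dvd.dvd.mul_left hz _), L.sym_eq a y _ _ h2 (Dvd.dvd.mul_right hz _),
    L.sym_eq a (x * y) _ _ h3 hc3, ← L.b12_eq a y _ _ h2 hx.1 hy.2.1 (Dvd.dvd.mul_right hz _) hd,
    ← L.b02_eq a (x * y) _ _ h3 hx.1 hV.2.1 hc3 (dvd_d h3 hx.1 hV.2.1)]
  have e : b02 a (x * y) _ _ h3 = e21 (-(z * x)) * (b01 a x _ _ h1 * b12 a y _ _ h2 * e01 (-x)
      * e10 (-(y * z)) * e12 (-(d * y))) := by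
    apply ext3 <;> simp [b01_coe, b02_coe, b12_coe, e10_coe, e01_coe, e12_coe, e21_coe, Matrix.mul_apply, Fin.sum_univ_three]
    all_goals grind
  rw [e]
  simp only [map_mul]
  rw [pi_one (L.h21 _ ((dvd_neg).mpr (Dvd.dvd.mul_right hz _))),
    pi_one (L.h01 _ ((dvd_neg).mpr hx.2.1)),
    pi_one (L.h10 _ ((dvd_neg).mpr (Dvd.dvd.mul_left hz _))),
    pi_one (L.h12 _ ((dvd_neg).mpr (Dvd.dvd.mul_left hy.2.1 _)))]
  simp

theorem w_rel : e12 (-1) * w12 * e12 (-1) * e21 1 = 1 := by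
  apply ext3 <;> simp [w12, e12_coe, e21_coe, Matrix.mul_apply, Fin.sum_univ_three]

theorem Lev.F4_aux (L : Lev N m) (a a' b : ℤ) (hx : MValid m a b) (hy : MValid m a' b) :
    sym N m (a * a') b = sym N m a' b * sym N m a b := by
  have hV : MValid m (a * a') b := by
    refine ⟨?_, hx.2.1, hx.2.2.mul_left hy.2.2⟩
    have : a * a' - 1 = a * (a' - 1) + (a - 1) := by ring
    rw [this]
    exact dvd_add (Dvd.dvd.mul_left hy.1 _) hx.1
  obtain ⟨c, d, h, hc, hd⟩ := valid_exists hV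
  have h1 : a * (a' * d) - b * c = 1 := by linear_combination h
  have h2 : a' * (a * d) - b * c = 1 := by linear_combination h
  have h3 : (a * a') * (a * a' * d * d) - b * (c + a * a' * c * d) = 1 := by
    linear_combination (1 + a * a' * d) * h
  have hc3 : m ∣ c + a * a' * c * d := by
    have : c + a * a' * c * d = c * (1 + a * a' * d) := by ring
    rw [this]
    exact Dvd.dvd.mul_right hc _
  have hd1 := dvd_d h1 hx.1 hx.2.1
  have hd2 := dvd_d h2 hy.1 hx.2.1
  have hd3 := dvd_d h3 hV.1 hx.2.1
  rw [L.sym_eq a b _ _ h1 hc, L.sym_eq a' b _ _ h2 hc, L.sym_eq (a * a') b _ _ h3 hc3,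
    ← L.b02_eq a' b _ _ h2 hy.1 hx.2.1 hc hd2]
  obtain ⟨-, -, k12, k21⟩ := L.comm _ _ _ _ h3 hV.1 hx.2.1 hc3 hd3
  have e : b02 a' b _ _ h2 * b01 a b _ _ h1 = e12 (-(a' * d)) * b01 (a * a') b _ _ h3 *
      w12 * e12 (-(a * d)) * e10 (-(c * a)) * e21 a' := by
    apply ext3 <;> simp [w12, b01_coe, b02_coe, e10_coe, e12_coe, e21_coe, Matrix.mul_apply,
      Fin.sum_univ_three]
    all_goals grind
  have e' := congrArg (π) e
  have q1 : π (e12 (-(a' * d))) = π (e12 (-1)) := L.p12 _ _ (by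
    have : -(a' * d) - -1 = -(a' * d - 1) := by ring
    rw [this]; exact (dvd_neg).mpr hd1)
  have q2 : π (e12 (-(a * d))) = π (e12 (-1)) := L.p12 _ _ (by
    have : -(a * d) - -1 = -(a * d - 1) := by ring
    rw [this]; exact (dvd_neg).mpr hd2)
  have q3 : π (e10 (-(c * a))) = 1 := pi_one (L.h10 _ ((dvd_neg).mpr (Dvd.dvd.mul_right hc _)))
  have q4 : π (e21 a') = π (e21 1) := L.p21 _ _ hy.1
  have r := congrArg (π) (w_rel)
  simp only [map_mul, map_one] at e' r
  rw [e', q1, q2, q3, q4, ← (k12 (-1)).eq, mul_one]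
  simp only [mul_assoc] at r ⊢
  rw [r, mul_one]

theorem Lev.F4 (L : Lev N m) (a a' b : ℤ) (hx : MValid m a b) (hy : MValid m a' b) :
    sym N m (a * a') b = sym N m a b * sym N m a' b := by
  rw [mul_comm a a', L.F4_aux a' a b hy hx]

theorem Lev.F5 (L : Lev N m) (b : ℤ) (hb : m ∣ b) : sym N m 1 b = 1 := by
  rw [L.sym_eq 1 b 0 1 (by ring) (dvd_zero _)]
  exact pi_one (L.h01 b hb)

theorem Lev.b01_mem (L : Lev N m) (hm : 0 < m) (a b c d : ℤ) (h : a * d - b * c = 1)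
    (ha : m ∣ a - 1) (hb : m ∣ b) (hc : m ∣ c) : b01 a b c d h ∈ N := by
  rw [← QuotientGroup.eq_one_iff]
  have := mennicke_trivial m (sym N m) hm L.F1 L.F2 L.F3 L.F4 L.F5 a b
    ⟨ha, hb, ⟨d, -c, by linear_combination h⟩⟩
  rw [L.sym_eq a b c d h hc] at this
  exact this
end
end SLThree

namespace SLRed

open Matrix
open scoped commutatorElement

theorem exists_coprime_add (a b g : ℤ) (ha : a ≠ 0)
    (h : ∀ p : ℕ, p.Prime → (p : ℤ) ∣ a → (p : ℤ) ∣ b → (p : ℤ) ∣ g → False) :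
    ∃ t : ℤ, IsCoprime a (b + t * g) := by
  classical
  set s : Finset ℕ := a.natAbs.primeFactors.filter (fun p => ¬ (p : ℤ) ∣ b) with hs
  refine ⟨((∏ p ∈ s, p : ℕ) : ℤ), ?_⟩
  rw [Int.isCoprime_iff_gcd_eq_one, Nat.eq_one_iff_not_exists_prime_dvd]
  intro p hp hpd
  have h1 : (p : ℤ) ∣ a := (Int.natCast_dvd_natCast.mpr hpd).trans (Int.gcd_dvd_left _ _)
  have h2 : (p : ℤ) ∣ b + ((∏ p ∈ s, p : ℕ) : ℤ) * g :=
    (Int.natCast_dvd_natCast.mpr hpd).trans (Int.gcd_dvd_right _ _)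
  by_cases hb : (p : ℤ) ∣ b
  · have h3 := (dvd_add_right hb).mp h2
    rcases (Nat.prime_iff_prime_int.mp hp).dvd_or_dvd h3 with h4 | h4
    · have h5 : p ∣ ∏ p ∈ s, p := Int.natCast_dvd_natCast.mp h4
      obtain ⟨r, hr, hpr⟩ := (Prime.dvd_finsetProd_iff hp.prime _).mp h5
      rw [hs, Finset.mem_filter] at hr
      have : p = r := (Nat.prime_dvd_prime_iff_eq hp (Nat.prime_of_mem_primeFactors hr.1)).mp hpr
      exact hr.2 (this ▸ hb)
    · exact h p hp h1 hb h4
  · apply hb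
    have hps : p ∈ s := by
      rw [hs, Finset.mem_filter]
      exact ⟨Nat.mem_primeFactors.mpr ⟨hp, Int.natCast_dvd.mp h1, by simpa using ha⟩, hb⟩
    have : (p : ℤ) ∣ ((∏ p ∈ s, p : ℕ) : ℤ) :=
      Int.natCast_dvd_natCast.mpr (Finset.dvd_prod_of_mem (fun p => p) hps)
    exact (dvd_add_left (Dvd.dvd.mul_right this g)).mp h2

theorem mem_SLC (n m : ℕ) (A : Matrix.SpecialLinearGroup (Fin n) ℤ) :
    A ∈ SLCongruence n m ↔ ∀ i j, (m : ℤ) ∣ A i j - (1 : Matrix (Fin n) (Fin n) ℤ) i j := by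
  rw [SLCongruence, MonoidHom.mem_ker, Matrix.SpecialLinearGroup.ext_iff]
  refine forall₂_congr fun i j => ?_
  rw [← ZMod.intCast_eq_intCast_iff_dvd_sub, eq_comm]
  have : (((1 : Matrix (Fin n) (Fin n) ℤ) i j : ℤ) : ZMod m) = (1 : Matrix (Fin n) (Fin n) (ZMod m)) i j := by
    by_cases h : i = j <;> simp [h, Matrix.one_apply]
  rw [this]
  simp [Matrix.SpecialLinearGroup.coe_one]

instance (n m : ℕ) : (SLCongruence n m).Normal := by
  unfold SLCongruence; infer_instance

abbrev tv {n : ℕ} {i j : Fin n} (h : i ≠ j) (t : ℤ) : Matrix.SpecialLinearGroup (Fin n) ℤ :=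
  Matrix.SpecialLinearGroup.transvection h t

theorem tv_coe {n : ℕ} {i j : Fin n} (h : i ≠ j) (t : ℤ) :
    (tv h t : Matrix (Fin n) (Fin n) ℤ) = Matrix.transvection i j t := rfl

theorem tv_mem {n m : ℕ} {i j : Fin n} (h : i ≠ j) (t : ℤ) (ht : (m : ℤ) ∣ t) :
    tv h t ∈ SLCongruence n m := by
  rw [mem_SLC]
  intro a b
  rw [tv_coe, Matrix.transvection, Matrix.add_apply, add_sub_cancel_left, Matrix.single_apply]
  split_ifs
  · exact ht
  · exact dvd_zero _

/-- all transvections of level `m` are in `N` -/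
def LevN {n : ℕ} (m : ℕ) (N : Subgroup (Matrix.SpecialLinearGroup (Fin n) ℤ)) : Prop :=
  ∀ (i j : Fin n) (h : i ≠ j) (t : ℤ), (m : ℤ) ∣ t → tv h t ∈ N

/-- `B` is a reduction of `A` -/
def Red {n : ℕ} (m : ℕ) (N : Subgroup (Matrix.SpecialLinearGroup (Fin n) ℤ))
    (A B : Matrix.SpecialLinearGroup (Fin n) ℤ) : Prop :=
  (A ∈ SLCongruence n m → B ∈ SLCongruence n m) ∧ (B ∈ N → A ∈ N)

section
variable {n m : ℕ} {N : Subgroup (Matrix.SpecialLinearGroup (Fin n) ℤ)}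

theorem Red.refl (A : Matrix.SpecialLinearGroup (Fin n) ℤ) : Red m N A A := ⟨id, id⟩

theorem Red.trans {A B C : Matrix.SpecialLinearGroup (Fin n) ℤ} (h : Red m N A B) (h' : Red m N B C) :
    Red m N A C := ⟨h'.1 ∘ h.1, h.2 ∘ h'.2⟩

theorem Red.left {A g : Matrix.SpecialLinearGroup (Fin n) ℤ} (hg : g ∈ N) (hg' : g ∈ SLCongruence n m) :
    Red m N A (g * A) :=
  ⟨fun h => mul_mem hg' h, fun h => (Subgroup.mul_mem_cancel_left N hg).mp h⟩

theorem Red.right {A g : Matrix.SpecialLinearGroup (Fin n) ℤ} (hg : g ∈ N) (hg' : g ∈ SLCongruence n m) :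
    Red m N A (A * g) :=
  ⟨fun h => mul_mem h hg', fun h => (Subgroup.mul_mem_cancel_right N hg).mp h⟩

theorem Red.conj [hN : N.Normal] {A g : Matrix.SpecialLinearGroup (Fin n) ℤ} :
    Red m N A (g * A * g⁻¹) :=
  ⟨fun h => (inferInstance : (SLCongruence n m).Normal).conj_mem A h g, fun h => by
    have := hN.conj_mem _ h g⁻¹
    simpa [mul_assoc] using this⟩

theorem red_rows (hN : LevN m N) (A : Matrix.SpecialLinearGroup (Fin n) ℤ) (p i : Fin n) (c : Fin n → ℤ)
    (hc : ∀ j, (m : ℤ) ∣ c j) (S : Finset (Fin n)) (hS : i ∉ S) :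
    ∃ B, Red m N A B ∧ ∀ a, B a p = A a p + if a = i then ∑ j ∈ S, c j * A j p else 0 := by
  classical
  induction S using Finset.induction_on with
  | empty => exact ⟨A, Red.refl A, by simp⟩
  | insert j S hj ih =>
    obtain ⟨B, hB, hBe⟩ := ih (fun h => hS (Finset.mem_insert_of_mem h))
    have hij : i ≠ j := fun h => hS (h ▸ Finset.mem_insert_self _ _)
    refine ⟨tv hij (c j) * B, hB.trans (Red.left (hN _ _ _ _ (hc j)) (tv_mem _ _ (hc j))), ?_⟩
    intro a
    rw [Matrix.SpecialLinearGroup.coe_mul, tv_coe]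
    by_cases ha : a = i
    · subst ha
      rw [Matrix.transvection_mul_apply_same, hBe, hBe, if_pos rfl, if_pos rfl, if_neg hij.symm,
        Finset.sum_insert hj]
      ring
    · rw [Matrix.transvection_mul_apply_of_ne _ _ _ _ ha, hBe, if_neg ha, if_neg ha]
end

section
variable {n m : ℕ} {N : Subgroup (Matrix.SpecialLinearGroup (Fin (n + 3)) ℤ)}

theorem exists_unimod (A : Matrix.SpecialLinearGroup (Fin n) ℤ) (p : Fin n) :
    ∃ u : Fin n → ℤ, ∑ j, u j * A j p = 1 := by
  refine ⟨fun j => A⁻¹ p j, ?_⟩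
  have : (A⁻¹ * A) p p = 1 := by simp
  rwa [Matrix.SpecialLinearGroup.coe_mul, Matrix.mul_apply] at this

/-- make the corner entry nonzero -/
theorem red_zero (hN : LevN m N) (A : Matrix.SpecialLinearGroup (Fin (n + 3)) ℤ)
    (hA : A ∈ SLCongruence _ m) : ∃ B, Red m N A B ∧ B 0 0 ≠ 0 := by
  by_cases h0 : A 0 0 = 0
  · have hm : (m : ℤ) ∣ 1 := by
      have := (mem_SLC _ _ A).mp hA 0 0
      rw [h0] at this
      simpa using this
    obtain ⟨u, hu⟩ := exists_unimod A 0
    have : ∃ j, A j 0 ≠ 0 := by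
      by_contra! hcon
      simp [hcon] at hu
    obtain ⟨j, hj⟩ := this
    have hj0 : 0 ≠ j := fun h => hj (h ▸ h0)
    obtain ⟨B, hB, hBe⟩ := red_rows hN A 0 0 (fun _ => 1) (fun _ => hm) {j} (by simpa using hj0)
    refine ⟨B, hB, ?_⟩
    rw [hBe]
    simpa [h0] using hj
  · exact ⟨A, Red.refl A, h0⟩

theorem red_coprime (hN : LevN m N) (A : Matrix.SpecialLinearGroup (Fin (n + 3)) ℤ)
    (hA : A ∈ SLCongruence _ m) (h0 : A 0 0 ≠ 0) :
    ∃ B, Red m N A B ∧ IsCoprime (B 0 0) (B 1 0) := by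
  obtain ⟨u, hu⟩ := exists_unimod A 0
  have h01 : (0 : Fin (n + 3)) ≠ 1 := by simp [Fin.ext_iff]
  set S : Finset (Fin (n + 3)) := {0, 1}ᶜ with hS
  have hsum : ∑ j ∈ S, u j * A j 0 = 1 - u 0 * A 0 0 - u 1 * A 1 0 := by
    rw [← Finset.sum_add_sum_compl {0, 1} (fun j => u j * A j 0), Finset.sum_pair h01] at hu
    linarith
  have hA00 : (m : ℤ) ∣ A 0 0 - 1 := by simpa using (mem_SLC _ _ A).mp hA 0 0
  obtain ⟨t, ht⟩ := exists_coprime_add (A 0 0) (A 1 0) (m * ∑ j ∈ S, u j * A j 0) h0 (by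
    intro p hp ha hb hg
    have hpm : (p : ℤ) ∣ m := by
      have : (m : ℤ) = m * ∑ j ∈ S, u j * A j 0 + m * u 0 * A 0 0 + m * u 1 * A 1 0 := by
        rw [hsum]; ring
      rw [this]
      exact dvd_add (dvd_add hg (Dvd.dvd.mul_left ha _)) (Dvd.dvd.mul_left hb _)
    have h1 : (p : ℤ) ∣ 1 := (dvd_sub_right ha).mp (hpm.trans hA00)
    exact (Nat.prime_iff_prime_int.mp hp).not_dvd_one h1)
  obtain ⟨B, hB, hBe⟩ := red_rows hN A 0 1 (fun j => m * (t * u j)) (fun _ => dvd_mul_right _ _)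
    S (by simp [hS])
  refine ⟨B, hB, ?_⟩
  rw [hBe, hBe, if_neg h01, if_pos rfl, add_zero]
  convert ht using 2
  rw [Finset.mul_sum, Finset.mul_sum]
  refine Finset.sum_congr rfl fun j _ => by ring

theorem red_one [N.Normal] (hN : LevN m N) (A : Matrix.SpecialLinearGroup (Fin (n + 3)) ℤ)
    (hA : A ∈ SLCongruence _ m) (h : IsCoprime (A 0 0) (A 1 0)) :
    ∃ B, Red m N A B ∧ B 0 0 = 1 := by
  have h01 : (0 : Fin (n + 3)) ≠ 1 := by simp [Fin.ext_iff]
  have h02 : (0 : Fin (n + 3)) ≠ 2 := by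
    simp [Fin.ext_iff, Nat.mod_eq_of_lt (show 2 < n + 3 by omega)]
  have h12 : (1 : Fin (n + 3)) ≠ 2 := by
    simp [Fin.ext_iff, Nat.mod_eq_of_lt (show 2 < n + 3 by omega)]
  obtain ⟨x, y, hxy⟩ := h
  have hA00 : (m : ℤ) ∣ A 0 0 - 1 := by simpa using (mem_SLC _ _ A).mp hA 0 0
  have hA20 : (m : ℤ) ∣ A 2 0 := by simpa [Matrix.one_apply, h02.symm] using (mem_SLC _ _ A).mp hA 2 0
  have hd : (m : ℤ) ∣ 1 - A 0 0 - A 2 0 := by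
    rw [← dvd_neg]
    have : -(1 - A 0 0 - A 2 0) = A 0 0 - 1 + A 2 0 := by ring
    rw [this]
    exact dvd_add hA00 hA20
  obtain ⟨B, hB, hBe⟩ := red_rows hN A 0 2
    (fun j => (1 - A 0 0 - A 2 0) * (if j = 0 then x else y)) (fun _ => Dvd.dvd.mul_right hd _)
    {0, 1} (by simp [h02.symm, h12.symm])
  refine ⟨tv h02 1 * B * (tv h02 1)⁻¹, hB.trans Red.conj, ?_⟩
  rw [Matrix.SpecialLinearGroup.transvection_inv, Matrix.SpecialLinearGroup.coe_mul, tv_coe,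
    Matrix.mul_transvection_apply_of_ne _ _ _ _ h02, Matrix.SpecialLinearGroup.coe_mul, tv_coe,
    Matrix.transvection_mul_apply_same, hBe, hBe, if_neg h02, if_pos rfl, Finset.sum_pair h01,
    if_pos rfl, if_neg h01.symm]
  linear_combination (1 - A 0 0 - A 2 0) * hxy
end

section
variable {n : ℕ}

/-- bordered matrix -/
def bord (r c : Fin n → ℤ) (A : Matrix (Fin n) (Fin n) ℤ) : Matrix (Fin (n + 1)) (Fin (n + 1)) ℤ :=
  Matrix.of (Fin.cons (Fin.cons 1 r) (fun i => Fin.cons (c i) (A i)))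

@[simp] theorem bord00 (r c : Fin n → ℤ) (A : Matrix (Fin n) (Fin n) ℤ) : bord r c A 0 0 = 1 := rfl
@[simp] theorem bord0s (r c : Fin n → ℤ) (A : Matrix (Fin n) (Fin n) ℤ) (j : Fin n) :
    bord r c A 0 j.succ = r j := rfl
@[simp] theorem bords0 (r c : Fin n → ℤ) (A : Matrix (Fin n) (Fin n) ℤ) (i : Fin n) :
    bord r c A i.succ 0 = c i := rfl
@[simp] theorem bordss (r c : Fin n → ℤ) (A : Matrix (Fin n) (Fin n) ℤ) (i j : Fin n) :
    bord r c A i.succ j.succ = A i j := rfl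

theorem ext_succ {A B : Matrix (Fin (n + 1)) (Fin (n + 1)) ℤ} (h00 : A 0 0 = B 0 0)
    (h0 : ∀ j : Fin n, A 0 j.succ = B 0 j.succ) (h1 : ∀ i : Fin n, A i.succ 0 = B i.succ 0)
    (h2 : ∀ i j : Fin n, A i.succ j.succ = B i.succ j.succ) : A = B := by
  ext i j
  refine Fin.cases ?_ (fun i => ?_) i <;> refine Fin.cases ?_ (fun j => ?_) j
  · exact h00
  · exact h0 j
  · exact h1 i
  · exact h2 i j

theorem det_bord_col (r : Fin n → ℤ) (A : Matrix (Fin n) (Fin n) ℤ) : (bord r 0 A).det = A.det := by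
  rw [Matrix.det_succ_column_zero, Fin.sum_univ_succ]
  simp
  congr 1

theorem det_bord_row (c : Fin n → ℤ) (A : Matrix (Fin n) (Fin n) ℤ) : (bord 0 c A).det = A.det := by
  rw [Matrix.det_succ_row_zero, Fin.sum_univ_succ]
  simp
  congr 1

/-- block embedding, as a function -/
def embFun (A : Matrix.SpecialLinearGroup (Fin n) ℤ) : Matrix.SpecialLinearGroup (Fin (n + 1)) ℤ :=
  ⟨bord 0 0 A, by rw [det_bord_col]; exact A.2⟩

theorem embFun_coe (A : Matrix.SpecialLinearGroup (Fin n) ℤ) :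
    (embFun A : Matrix (Fin (n + 1)) (Fin (n + 1)) ℤ) = bord 0 0 A := rfl

theorem embFun_one : embFun (1 : Matrix.SpecialLinearGroup (Fin n) ℤ) = 1 := by
  apply Subtype.ext
  rw [embFun_coe, Matrix.SpecialLinearGroup.coe_one, Matrix.SpecialLinearGroup.coe_one]
  apply ext_succ <;> simp [Matrix.one_apply, Fin.succ_ne_zero, (Fin.succ_ne_zero _).symm]

theorem embFun_mul (A B : Matrix.SpecialLinearGroup (Fin n) ℤ) :
    embFun (A * B) = embFun A * embFun B := by
  apply Subtype.ext
  rw [Matrix.SpecialLinearGroup.coe_mul, embFun_coe, embFun_coe, embFun_coe,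
    Matrix.SpecialLinearGroup.coe_mul]
  apply ext_succ <;> simp [Matrix.mul_apply, Fin.sum_univ_succ]

/-- block embedding -/
def emb : Matrix.SpecialLinearGroup (Fin n) ℤ →* Matrix.SpecialLinearGroup (Fin (n + 1)) ℤ where
  toFun := embFun
  map_one' := embFun_one
  map_mul' := embFun_mul

theorem emb_coe (A : Matrix.SpecialLinearGroup (Fin n) ℤ) :
    (emb A : Matrix (Fin (n + 1)) (Fin (n + 1)) ℤ) = bord 0 0 A := rfl

def rowm (r : Fin n → ℤ) : Matrix.SpecialLinearGroup (Fin (n + 1)) ℤ :=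
  ⟨bord r 0 1, by rw [det_bord_col, Matrix.det_one]⟩
def colm (c : Fin n → ℤ) : Matrix.SpecialLinearGroup (Fin (n + 1)) ℤ :=
  ⟨bord 0 c 1, by rw [det_bord_row, Matrix.det_one]⟩
theorem rowm_coe (r : Fin n → ℤ) : (rowm r : Matrix (Fin (n + 1)) (Fin (n + 1)) ℤ) = bord r 0 1 := rfl
theorem colm_coe (r : Fin n → ℤ) : (colm r : Matrix (Fin (n + 1)) (Fin (n + 1)) ℤ) = bord 0 r 1 := rfl

theorem rowm_add (r s : Fin n → ℤ) : rowm (r + s) = rowm r * rowm s := by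
  apply Subtype.ext
  rw [Matrix.SpecialLinearGroup.coe_mul, rowm_coe, rowm_coe, rowm_coe]
  apply ext_succ <;>
    simp [Matrix.mul_apply, Fin.sum_univ_succ, Matrix.one_apply, add_comm]

theorem colm_add (r s : Fin n → ℤ) : colm (r + s) = colm r * colm s := by
  apply Subtype.ext
  rw [Matrix.SpecialLinearGroup.coe_mul, colm_coe, colm_coe, colm_coe]
  apply ext_succ <;>
    simp [Matrix.mul_apply, Fin.sum_univ_succ, Matrix.one_apply, add_comm]

theorem rowm_single (j : Fin n) (t : ℤ) :
    rowm (Pi.single j t) = tv (Fin.succ_ne_zero j).symm t := by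
  apply Subtype.ext
  rw [rowm_coe, tv_coe, Matrix.transvection]
  apply ext_succ
  · simp [Matrix.single_apply]
  · intro k
    by_cases h : j = k <;>
    simp [Matrix.single_apply, Matrix.one_apply, Pi.single_apply, (Fin.succ_ne_zero _).symm, h, eq_comm]
  · simp [Matrix.single_apply, Matrix.one_apply, (Fin.succ_ne_zero _)]
  · simp [Matrix.single_apply, Matrix.one_apply, (Fin.succ_ne_zero _).symm]

theorem colm_single (j : Fin n) (t : ℤ) :
    colm (Pi.single j t) = tv (Fin.succ_ne_zero j) t := by
  apply Subtype.ext
  rw [colm_coe, tv_coe, Matrix.transvection]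
  apply ext_succ
  · simp [Matrix.single_apply]
  · simp [Matrix.single_apply, Matrix.one_apply, (Fin.succ_ne_zero _), (Fin.succ_ne_zero _).symm]
  · intro k
    by_cases h : j = k <;>
    simp [Matrix.single_apply, Matrix.one_apply, Pi.single_apply, (Fin.succ_ne_zero _), h, eq_comm]
  · simp [Matrix.single_apply, Matrix.one_apply, (Fin.succ_ne_zero _).symm]

theorem rowm_zero : rowm (0 : Fin n → ℤ) = 1 := by
  have := rowm_add (0 : Fin n → ℤ) 0
  rw [add_zero] at this
  exact left_eq_mul.mp this

theorem colm_zero : colm (0 : Fin n → ℤ) = 1 := by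
  have := colm_add (0 : Fin n → ℤ) 0
  rw [add_zero] at this
  exact left_eq_mul.mp this

theorem rowm_mem {m : ℕ} {N : Subgroup (Matrix.SpecialLinearGroup (Fin (n + 1)) ℤ)} (hN : LevN m N)
    (r : Fin n → ℤ) (hr : ∀ j, (m : ℤ) ∣ r j) : rowm r ∈ N := by
  have key : ∀ S : Finset (Fin n), rowm (∑ j ∈ S, Pi.single j (r j)) ∈ N := by
    classical
    intro S
    induction S using Finset.induction_on with
    | empty => rw [Finset.sum_empty, rowm_zero]; exact one_mem _
    | insert j S hj ih =>
      rw [Finset.sum_insert hj, rowm_add, rowm_single]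
      exact mul_mem (hN _ _ _ _ (hr j)) ih
  have := key Finset.univ
  rwa [Finset.univ_sum_single] at this

theorem colm_mem {m : ℕ} {N : Subgroup (Matrix.SpecialLinearGroup (Fin (n + 1)) ℤ)} (hN : LevN m N)
    (r : Fin n → ℤ) (hr : ∀ j, (m : ℤ) ∣ r j) : colm r ∈ N := by
  have key : ∀ S : Finset (Fin n), colm (∑ j ∈ S, Pi.single j (r j)) ∈ N := by
    classical
    intro S
    induction S using Finset.induction_on with
    | empty => rw [Finset.sum_empty, colm_zero]; exact one_mem _
    | insert j S hj ih =>
      rw [Finset.sum_insert hj, colm_add, colm_single]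
      exact mul_mem (hN _ _ _ _ (hr j)) ih
  have := key Finset.univ
  rwa [Finset.univ_sum_single] at this

theorem levN_SLC (m : ℕ) : LevN m (SLCongruence n m) := fun _ _ h t ht => tv_mem h t ht

/-- from corner entry one to a block matrix -/
theorem red_block {m : ℕ} {N : Subgroup (Matrix.SpecialLinearGroup (Fin (n + 1)) ℤ)} (hN : LevN m N)
    (A : Matrix.SpecialLinearGroup (Fin (n + 1)) ℤ) (hA : A ∈ SLCongruence _ m) (h0 : A 0 0 = 1) :
    ∃ A' : Matrix.SpecialLinearGroup (Fin n) ℤ, A' ∈ SLCongruence n m ∧ (emb A' ∈ N → A ∈ N) := by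
  set c : Fin n → ℤ := fun i => - A i.succ 0
  set r : Fin n → ℤ := fun j => - A 0 j.succ
  have hc : ∀ i, (m : ℤ) ∣ c i := fun i => by
    simpa [Matrix.one_apply, Fin.succ_ne_zero, c] using (mem_SLC _ _ A).mp hA i.succ 0
  have hr : ∀ i, (m : ℤ) ∣ r i := fun i => by
    simpa [Matrix.one_apply, (Fin.succ_ne_zero _).symm, r] using (mem_SLC _ _ A).mp hA 0 i.succ
  set B := colm c * A * rowm r with hB
  have hRed : Red m N A B := (Red.left (colm_mem hN c hc) (colm_mem (levN_SLC m) c hc)).trans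
    (Red.right (rowm_mem hN r hr) (rowm_mem (levN_SLC m) r hr))
  set D : Matrix (Fin n) (Fin n) ℤ := (B : Matrix _ _ ℤ).submatrix Fin.succ Fin.succ with hD
  have hBD : (B : Matrix _ _ ℤ) = bord 0 0 D := by
    apply ext_succ
    · simp [hB, Matrix.mul_apply, Fin.sum_univ_succ, rowm_coe, colm_coe, h0]
    · intro j
      simp [hB, Matrix.mul_apply, Fin.sum_univ_succ, rowm_coe, colm_coe, h0, Matrix.one_apply, r]
    · intro j
      simp [hB, Matrix.mul_apply, Fin.sum_univ_succ, rowm_coe, colm_coe, h0, Matrix.one_apply, c]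
    · intro i j
      rfl
  have hdet : D.det = 1 := by
    rw [← det_bord_col 0 D, ← hBD]; exact B.2
  obtain ⟨A', hA'⟩ : ∃ A' : Matrix.SpecialLinearGroup (Fin n) ℤ, (A' : Matrix _ _ ℤ) = D :=
    ⟨⟨D, hdet⟩, rfl⟩
  refine ⟨A', ?_, ?_⟩
  · rw [mem_SLC, hA']
    intro i j
    have := (mem_SLC _ _ B).mp (hRed.1 hA) i.succ j.succ
    simpa [Matrix.one_apply, hD] using this
  · intro h
    apply hRed.2
    have : emb A' = B := Subtype.ext (by rw [emb_coe, hA', hBD])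
    rwa [this] at h

theorem emb_tv {i j : Fin n} (h : i ≠ j) (t : ℤ) :
    emb (tv h t) = tv (fun h' => h (Fin.succ_injective _ h')) t := by
  apply Subtype.ext
  rw [emb_coe, tv_coe, tv_coe, Matrix.transvection, Matrix.transvection]
  apply ext_succ <;>
    simp [Matrix.single_apply, Matrix.one_apply, (Fin.succ_ne_zero _), (Fin.succ_ne_zero _).symm]

theorem reduction {m : ℕ} {N : Subgroup (Matrix.SpecialLinearGroup (Fin (n + 3)) ℤ)} [N.Normal]
    (hN : LevN m N) (A : Matrix.SpecialLinearGroup (Fin (n + 3)) ℤ) (hA : A ∈ SLCongruence _ m) :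
    ∃ A' : Matrix.SpecialLinearGroup (Fin (n + 2)) ℤ, A' ∈ SLCongruence _ m ∧ (emb A' ∈ N → A ∈ N) := by
  obtain ⟨B, hB, h0⟩ := red_zero hN A hA
  obtain ⟨C, hC, h1⟩ := red_coprime hN B (hB.1 hA) h0
  obtain ⟨D, hD, h2⟩ := red_one hN C (hC.1 (hB.1 hA)) h1
  have hR := (hB.trans hC).trans hD
  obtain ⟨A', hA', h⟩ := red_block hN D (hR.1 hA) h2
  exact ⟨A', hA', fun h' => hR.2 (h h')⟩
end

theorem key3 {m : ℕ} (hm : 0 < m) (N : Subgroup (Matrix.SpecialLinearGroup (Fin 3) ℤ)) [N.Normal]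
    (hN : LevN m N) : SLCongruence 3 m ≤ N := by
  have L : SLThree.Lev N (m : ℤ) := by
    constructor <;> intro t ht
    · convert hN 0 1 (by decide) t ht using 1
      apply SLThree.ext3 <;> simp [SLThree.e01_coe, Matrix.SpecialLinearGroup.transvection_coe]
    · convert hN 0 2 (by decide) t ht using 1
      apply SLThree.ext3 <;> simp [SLThree.e02_coe, Matrix.SpecialLinearGroup.transvection_coe]
    · convert hN 1 0 (by decide) t ht using 1
      apply SLThree.ext3 <;> simp [SLThree.e10_coe, Matrix.SpecialLinearGroup.transvection_coe]
    · convert hN 1 2 (by decide) t ht using 1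
      apply SLThree.ext3 <;> simp [SLThree.e12_coe, Matrix.SpecialLinearGroup.transvection_coe]
    · convert hN 2 0 (by decide) t ht using 1
      apply SLThree.ext3 <;> simp [SLThree.e20_coe, Matrix.SpecialLinearGroup.transvection_coe]
    · convert hN 2 1 (by decide) t ht using 1
      apply SLThree.ext3 <;> simp [SLThree.e21_coe, Matrix.SpecialLinearGroup.transvection_coe]
  intro A hA
  obtain ⟨A', hA', h⟩ := reduction (n := 0) hN A hA
  apply h
  have hdet : A' 0 0 * A' 1 1 - A' 0 1 * A' 1 0 = 1 := by
    have := A'.2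
    rwa [Matrix.det_fin_two] at this
  have h00 : (m : ℤ) ∣ A' 0 0 - 1 := by simpa using (mem_SLC _ _ A').mp hA' 0 0
  have h11 : (m : ℤ) ∣ A' 1 1 - 1 := by simpa using (mem_SLC _ _ A').mp hA' 1 1
  have h01 : (m : ℤ) ∣ A' 0 1 := by simpa using (mem_SLC _ _ A').mp hA' 0 1
  have h10 : (m : ℤ) ∣ A' 1 0 := by simpa using (mem_SLC _ _ A').mp hA' 1 0
  have hb := L.b01_mem (by exact_mod_cast hm) _ _ _ _ hdet h00 h01 h10
  have he : emb A' = SLThree.b12 _ _ _ _ hdet := by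
    apply SLThree.ext3 <;> rfl
  rw [he, ← QuotientGroup.eq_one_iff]
  have := L.b12_eq _ _ _ _ hdet h00 h01 h10 h11
  rw [← QuotientGroup.eq_one_iff] at hb
  exact this.trans hb

theorem key {m : ℕ} (hm : 0 < m) (n : ℕ) : ∀ (N : Subgroup (Matrix.SpecialLinearGroup (Fin (n + 3)) ℤ)),
    N.Normal → LevN m N → SLCongruence (n + 3) m ≤ N := by
  induction n with
  | zero => intro N h1 h2; exact key3 hm N h2
  | succ n ih =>
    intro N hn hN A hA
    obtain ⟨A', hA', h⟩ := reduction (n := n + 1) hN A hA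
    apply h
    have := ih (N.comap emb) (hn.comap emb) (by
      intro i j hij t ht
      rw [Subgroup.mem_comap, emb_tv]
      exact hN _ _ _ _ ht)
    exact this hA'

theorem comm_le (n a b : ℕ) : ⁅SLCongruence n a, SLCongruence n b⁆ ≤ SLCongruence n (a * b) := by
  rw [Subgroup.commutator_le]
  intro A hA B hB
  rw [mem_SLC] at hA hB
  have h1 : ∃ X : Matrix (Fin n) (Fin n) ℤ, (A : Matrix (Fin n) (Fin n) ℤ) = 1 + (a : ℤ) • X := by
    choose f hf using hA
    refine ⟨Matrix.of f, ?_⟩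
    ext i j
    have := hf i j
    simp only [Matrix.add_apply, Matrix.smul_apply, Matrix.of_apply, smul_eq_mul]
    linarith
  have h2 : ∃ X : Matrix (Fin n) (Fin n) ℤ, (B : Matrix (Fin n) (Fin n) ℤ) = 1 + (b : ℤ) • X := by
    choose f hf using hB
    refine ⟨Matrix.of f, ?_⟩
    ext i j
    have := hf i j
    simp only [Matrix.add_apply, Matrix.smul_apply, Matrix.of_apply, smul_eq_mul]
    linarith
  obtain ⟨X, hX⟩ := h1
  obtain ⟨Y, hY⟩ := h2
  have hAB : ((A * B : Matrix.SpecialLinearGroup (Fin n) ℤ) : Matrix (Fin n) (Fin n) ℤ)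
      = ((B * A : Matrix.SpecialLinearGroup (Fin n) ℤ) : Matrix (Fin n) (Fin n) ℤ)
        + ((a * b : ℕ) : ℤ) • (X * Y - Y * X) := by
    rw [Matrix.SpecialLinearGroup.coe_mul, Matrix.SpecialLinearGroup.coe_mul, hX, hY]
    simp only [add_mul, mul_add, one_mul, mul_one, smul_mul_smul_comm, smul_sub, Nat.cast_mul,
      mul_comm (b : ℤ) (a : ℤ)]
    abel
  have hc : ((⁅A, B⁆ : Matrix.SpecialLinearGroup (Fin n) ℤ) : Matrix (Fin n) (Fin n) ℤ)
      = 1 + ((a * b : ℕ) : ℤ) • ((X * Y - Y * X) *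
        (((B * A)⁻¹ : Matrix.SpecialLinearGroup (Fin n) ℤ) : Matrix (Fin n) (Fin n) ℤ)) := by
    have : ⁅A, B⁆ = A * B * (B * A)⁻¹ := by rw [commutatorElement_def]; group
    rw [this, Matrix.SpecialLinearGroup.coe_mul, hAB, add_mul, ← Matrix.SpecialLinearGroup.coe_mul,
      mul_inv_cancel, Matrix.SpecialLinearGroup.coe_one, smul_mul_assoc]
  rw [mem_SLC]
  intro i j
  rw [hc, Matrix.add_apply, add_sub_cancel_left, Matrix.smul_apply, smul_eq_mul]
  exact dvd_mul_right _ _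

theorem tv_comm {n : ℕ} {i j l : Fin n} (hij : i ≠ j) (hil : i ≠ l) (hlj : l ≠ j) (s t : ℤ) :
    tv hij (s * t) = ⁅tv hil s, tv hlj t⁆ := by
  rw [commutatorElement_def, Matrix.SpecialLinearGroup.transvection_inv,
    Matrix.SpecialLinearGroup.transvection_inv]
  apply Subtype.ext
  simp only [Matrix.SpecialLinearGroup.coe_mul, Matrix.SpecialLinearGroup.transvection_coe]
  have hneg : ∀ (a b : Fin n) (x : ℤ), Matrix.single a b (-x) = -Matrix.single a b x := by
    intro a b x
    ext c d
    simp only [Matrix.single_apply, Matrix.neg_apply]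
    split_ifs <;> simp
  simp [hneg, mul_add, add_mul, hij.symm, hil.symm, hlj.symm]
  abel

theorem comm_eq (n a b : ℕ) (ha : 0 < a) (hb : 0 < b) :
    ⁅SLCongruence (n + 3) a, SLCongruence (n + 3) b⁆ = SLCongruence (n + 3) (a * b) := by
  apply le_antisymm (comm_le _ _ _)
  apply key (Nat.mul_pos ha hb) n _ inferInstance
  intro i j hij t ht
  obtain ⟨s, rfl⟩ := ht
  have : ∃ l : Fin (n + 3), l ≠ i ∧ l ≠ j := by
    obtain ⟨l, hl⟩ := Finset.exists_mem_notMem_of_card_lt_card (s := ({i, j} : Finset (Fin (n + 3))))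
      (t := Finset.univ) (by
        rw [Finset.card_pair hij]; simp)
    exact ⟨l, by simpa using hl⟩
  obtain ⟨l, hli, hlj⟩ := this
  have e : ((a * b : ℕ) : ℤ) * s = a * (b * s) := by push_cast; ring
  rw [e, tv_comm hij hli.symm hlj]
  exact Subgroup.commutator_mem_commutator (tv_mem _ _ (dvd_refl _)) (tv_mem _ _ (dvd_mul_right _ _))

end SLRed

theorem lowerCentralSeries_SL_congruence (n q k : ℕ) (hn : 5 ≤ n) (hq : 1 ≤ q)
    (hk : 1 ≤ k) :
    Subgroup.map (SLCongruence n q).subtype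
      (Subgroup.lowerCentralSeries (⊤ : Subgroup (SLCongruence n q)) (k - 1)) = SLCongruence n (q ^ k) := by
  rw [Subgroup.top_subtype_lowerCentralSeries]
  obtain ⟨k, rfl⟩ : ∃ k', k = k' + 1 := ⟨k - 1, by omega⟩
  obtain ⟨n, rfl⟩ : ∃ n', n = n' + 3 := ⟨n - 3, by omega⟩
  rw [Nat.add_sub_cancel]
  clear hk
  induction k with
  | zero => simp
  | succ k ih =>
    rw [Subgroup.lowerCentralSeries_succ, ih, SLRed.comm_eq n _ _ (pow_pos hq _) hq, ← pow_succ]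
end

section
/- Let n ≥ 5, q ≥ 3 and k ≥ 1 be integers. Every matrix A in the k-th term Γ_k(SL_n(qℤ)) of the lower central series of SL_n(qℤ) can be written A = 1 + q^k·B with B an n×n integer matrix, and the assignment A ↦ (B mod q) induces a well-defined isomorphism of groups from the quotient Γ_k(SL_n(qℤ))/Γ_{k+1}(SL_n(qℤ)) onto the additive group of trace-zero n×n matrices with entries in ℤ/qℤ. -/
/-- The additive group of trace-zero `n×n` matrices over `ℤ/qℤ`. -/
def traceZeroMatrices (n q : ℕ) : AddSubgroup (Matrix (Fin n) (Fin n) (ZMod q)) where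
  carrier := {M | Matrix.trace M = 0}
  zero_mem' := by simp
  add_mem' := by
    intro a b ha hb
    simp only [Set.mem_setOf_eq] at *
    simp [Matrix.trace_add, ha, hb]
  neg_mem' := by
    intro a ha
    simp only [Set.mem_setOf_eq] at *
    simp [ha]

namespace CongrSL

abbrev G3 := Matrix.SpecialLinearGroup (Fin 3) ℤ

def e12 (t : ℤ) : G3 := ⟨!![1,t,0;0,1,0;0,0,1], by simp [Matrix.det_fin_three]⟩
def e13 (t : ℤ) : G3 := ⟨!![1,0,t;0,1,0;0,0,1], by simp [Matrix.det_fin_three]⟩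
def e23 (t : ℤ) : G3 := ⟨!![1,0,0;0,1,t;0,0,1], by simp [Matrix.det_fin_three]⟩
def e21 (t : ℤ) : G3 := ⟨!![1,0,0;t,1,0;0,0,1], by simp [Matrix.det_fin_three]⟩
def e31 (t : ℤ) : G3 := ⟨!![1,0,0;0,1,0;t,0,1], by simp [Matrix.det_fin_three]⟩
def e32 (t : ℤ) : G3 := ⟨!![1,0,0;0,1,0;0,t,1], by simp [Matrix.det_fin_three]⟩

def mat12 (a b c d : ℤ) (h : a * d - b * c = 1) : G3 :=
  ⟨!![a,b,0;c,d,0;0,0,1], by simp [Matrix.det_fin_three]; linarith⟩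
def mat13 (a b c d : ℤ) (h : a * d - b * c = 1) : G3 :=
  ⟨!![a,0,b;0,1,0;c,0,d], by simp [Matrix.det_fin_three]; linarith⟩
def mat23 (a b c d : ℤ) (h : a * d - b * c = 1) : G3 :=
  ⟨!![1,0,0;0,a,b;0,c,d], by simp [Matrix.det_fin_three]; linarith⟩

@[simp] theorem e12_coe (t : ℤ) : (e12 t).1 = !![1,t,0;0,1,0;0,0,1] := rfl
@[simp] theorem e13_coe (t : ℤ) : (e13 t).1 = !![1,0,t;0,1,0;0,0,1] := rfl
@[simp] theorem e23_coe (t : ℤ) : (e23 t).1 = !![1,0,0;0,1,t;0,0,1] := rfl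
@[simp] theorem e21_coe (t : ℤ) : (e21 t).1 = !![1,0,0;t,1,0;0,0,1] := rfl
@[simp] theorem e31_coe (t : ℤ) : (e31 t).1 = !![1,0,0;0,1,0;t,0,1] := rfl
@[simp] theorem e32_coe (t : ℤ) : (e32 t).1 = !![1,0,0;0,1,0;0,t,1] := rfl
@[simp] theorem mat12_coe (a b c d : ℤ) (h : a * d - b * c = 1) : (mat12 a b c d h).1 = !![a,b,0;c,d,0;0,0,1] := rfl
@[simp] theorem mat13_coe (a b c d : ℤ) (h : a * d - b * c = 1) : (mat13 a b c d h).1 = !![a,0,b;0,1,0;c,0,d] := rfl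
@[simp] theorem mat23_coe (a b c d : ℤ) (h : a * d - b * c = 1) : (mat23 a b c d h).1 = !![1,0,0;0,a,b;0,c,d] := rfl

/-- `H` contains all elementary matrices of level `m`. -/
structure Good (m : ℤ) (H : Subgroup G3) : Prop where
  h12 : ∀ t, m ∣ t → e12 t ∈ H
  h13 : ∀ t, m ∣ t → e13 t ∈ H
  h23 : ∀ t, m ∣ t → e23 t ∈ H
  h21 : ∀ t, m ∣ t → e21 t ∈ H
  h31 : ∀ t, m ∣ t → e31 t ∈ H
  h32 : ∀ t, m ∣ t → e32 t ∈ H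

theorem G3_ext {x y : G3} (h : x.1 = y.1) : x = y := Subtype.ext h

section Menn

variable {m : ℤ} {H : Subgroup G3} [H.Normal]

abbrev pr (H : Subgroup G3) [H.Normal] : G3 →* G3 ⧸ H := QuotientGroup.mk' H

theorem pr_one {x : G3} (hx : x ∈ H) : pr H x = 1 := (QuotientGroup.eq_one_iff x).2 hx

theorem comm13 (hH : Good m H) {a b c d : ℤ} (h : a * d - b * c = 1)
    (ha : m ∣ a - 1) (hc : m ∣ c) (t : ℤ) :
    pr H (mat12 a b c d h) * pr H (e13 t) = pr H (e13 t) * pr H (mat12 a b c d h) := by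
  have key : mat12 a b c d h * e13 t = e13 ((a-1)*t) * e23 (c*t) * (e13 t * mat12 a b c d h) := by
    apply G3_ext
    simp
    all_goals ring_nf
    try trivial
  rw [← map_mul, key, map_mul, map_mul, pr_one (hH.h13 _ (ha.mul_right t)),
    pr_one (hH.h23 _ (hc.mul_right t)), one_mul, one_mul, map_mul]

theorem comm23 (hH : Good m H) {a b c d : ℤ} (h : a * d - b * c = 1)
    (hb : m ∣ b) (hd : m ∣ d - 1) (t : ℤ) :
    pr H (mat12 a b c d h) * pr H (e23 t) = pr H (e23 t) * pr H (mat12 a b c d h) := by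
  have key : mat12 a b c d h * e23 t = e13 (b*t) * e23 ((d-1)*t) * (e23 t * mat12 a b c d h) := by
    apply G3_ext
    simp
    all_goals ring_nf
    try trivial
  rw [← map_mul, key, map_mul, map_mul, pr_one (hH.h13 _ (hb.mul_right t)),
    pr_one (hH.h23 _ (hd.mul_right t)), one_mul, one_mul, map_mul]

theorem comm31 (hH : Good m H) {a b c d : ℤ} (h : a * d - b * c = 1)
    (ha : m ∣ a - 1) (hb : m ∣ b) (t : ℤ) :
    pr H (mat12 a b c d h) * pr H (e31 t) = pr H (e31 t) * pr H (mat12 a b c d h) := by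
  have key : e31 t * mat12 a b c d h = mat12 a b c d h * e31 t * (e31 ((a-1)*t) * e32 (b*t)) := by
    apply G3_ext
    simp
    all_goals ring_nf
    try trivial
  rw [← map_mul, ← map_mul, key, map_mul _ _ (_ * _), map_mul _ (e31 _), pr_one (hH.h31 _ (ha.mul_right t)),
    pr_one (hH.h32 _ (hb.mul_right t)), mul_one, mul_one]

theorem comm32 (hH : Good m H) {a b c d : ℤ} (h : a * d - b * c = 1)
    (hc : m ∣ c) (hd : m ∣ d - 1) (t : ℤ) :
    pr H (mat12 a b c d h) * pr H (e32 t) = pr H (e32 t) * pr H (mat12 a b c d h) := by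
  have key : e32 t * mat12 a b c d h = mat12 a b c d h * e32 t * (e31 (c*t) * e32 ((d-1)*t)) := by
    apply G3_ext
    simp
    all_goals ring_nf
    try trivial
  rw [← map_mul, ← map_mul, key, map_mul _ _ (_ * _), map_mul _ (e31 _), pr_one (hH.h31 _ (hc.mul_right t)),
    pr_one (hH.h32 _ (hd.mul_right t)), mul_one, mul_one]

theorem e12_eq (t : ℤ) : e12 t = e13 t * e32 1 * e13 (-t) * e32 (-1) := by
  apply G3_ext
  simp

theorem e21_eq (t : ℤ) : e21 t = e23 t * e31 1 * e23 (-t) * e31 (-1) := by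
  apply G3_ext
  simp

/-- `x` is of level `m`. -/
structure Lev (m a b c d : ℤ) : Prop where
  det : a * d - b * c = 1
  ha : m ∣ a - 1
  hb : m ∣ b
  hc : m ∣ c
  hd : m ∣ d - 1

theorem comm12 (hH : Good m H) {a b c d : ℤ} (h : Lev m a b c d) (t : ℤ) :
    Commute (pr H (mat12 a b c d h.det)) (pr H (e12 t)) := by
  have h1 := fun t => show Commute _ _ from comm13 hH h.det h.ha h.hc t
  have h2 := fun t => show Commute _ _ from comm32 hH h.det h.hc h.hd t
  rw [e12_eq, map_mul, map_mul, map_mul]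
  exact (((h1 _).mul_right (h2 _)).mul_right (h1 _)).mul_right (h2 _)

theorem comm21 (hH : Good m H) {a b c d : ℤ} (h : Lev m a b c d) (t : ℤ) :
    Commute (pr H (mat12 a b c d h.det)) (pr H (e21 t)) := by
  have h1 := fun t => show Commute _ _ from comm23 hH h.det h.hb h.hd t
  have h2 := fun t => show Commute _ _ from comm31 hH h.det h.ha h.hb t
  rw [e21_eq, map_mul, map_mul, map_mul]
  exact (((h1 _).mul_right (h2 _)).mul_right (h1 _)).mul_right (h2 _)

theorem eq_of_conj {x y w : G3} (h : y * w = w * x) (hc : Commute (pr H x) (pr H w)) :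
    pr H y = pr H x := by
  have := congrArg (pr H) h
  rw [map_mul, map_mul, ← hc.eq] at this
  exact mul_right_cancel this

theorem pr_mat13 (hH : Good m H) {a b c d : ℤ} (h : Lev m a b c d) :
    pr H (mat13 a b c d h.det) = pr H (mat12 a b c d h.det) := by
  apply eq_of_conj (w := e23 (-1) * e32 1 * e23 (-1))
  · apply G3_ext
    simp
  · rw [map_mul, map_mul]
    have h1 := fun t => show Commute _ _ from comm23 hH h.det h.hb h.hd t
    have h2 := fun t => show Commute _ _ from comm32 hH h.det h.hc h.hd t
    exact ((h1 _).mul_right (h2 _)).mul_right (h1 _)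

theorem pr_mat23 (hH : Good m H) {a b c d : ℤ} (h : Lev m a b c d) :
    pr H (mat23 a b c d h.det) = pr H (mat12 a b c d h.det) := by
  rw [← pr_mat13 hH h]
  apply eq_of_conj (w := e12 (-1) * e21 1 * e12 (-1))
  · apply G3_ext
    simp
  · rw [pr_mat13 hH h, map_mul, map_mul]
    have h1 := fun t => comm12 hH h t
    have h2 := fun t => comm21 hH h t
    exact ((h1 _).mul_right (h2 _)).mul_right (h1 _)

theorem Lev.swap {a b c d : ℤ} (h : Lev m a b c d) : Lev m d (-c) (-b) a :=
  ⟨by linarith [h.det], h.hd, h.hc.neg_right, h.hb.neg_right, h.ha⟩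

theorem pr_swap (hH : Good m H) {a b c d : ℤ} (h : Lev m a b c d) :
    pr H (mat12 d (-c) (-b) a h.swap.det) = pr H (mat12 a b c d h.det) := by
  apply eq_of_conj (w := e12 (-1) * e21 1 * e12 (-1))
  · apply G3_ext
    simp
  · rw [map_mul, map_mul]
    have h1 := fun t => comm12 hH h t
    have h2 := fun t => comm21 hH h t
    exact ((h1 _).mul_right (h2 _)).mul_right (h1 _)

theorem pr_wd (hH : Good m H) {a b c d c' d' : ℤ} (h : a * d - b * c = 1)
    (h' : a * d' - b * c' = 1) (hc : m ∣ c) (hc' : m ∣ c') :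
    pr H (mat12 a b c' d' h') = pr H (mat12 a b c d h) := by
  have key : mat12 a b c' d' h' = e21 (c' * d - c * d') * mat12 a b c d h := by
    apply G3_ext
    simp
    constructor
    · linear_combination (-c') * h + c * h'
    · linear_combination (-d') * h + d * h'
  rw [key, map_mul, pr_one (hH.h21 _ (dvd_sub (hc'.mul_right _) (hc.mul_right _))), one_mul]

open Classical in
/-- The Mennicke symbol. -/
noncomputable def sym (m : ℤ) (H : Subgroup G3) [H.Normal] (a b : ℤ) : G3 ⧸ H :=
  if h : ∃ c d : ℤ, a * d - b * c = 1 ∧ m ∣ c then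
    pr H (mat12 a b h.choose h.choose_spec.choose h.choose_spec.choose_spec.1) else 1

theorem sym_eq (hH : Good m H) {a b c d : ℤ} (h : a * d - b * c = 1) (hc : m ∣ c) :
    pr H (mat12 a b c d h) = sym m H a b := by
  have hex : ∃ c d : ℤ, a * d - b * c = 1 ∧ m ∣ c := ⟨c, d, h, hc⟩
  rw [sym, dif_pos hex]
  exact pr_wd hH _ _ hex.choose_spec.choose_spec.2 hc

structure V (m a b : ℤ) : Prop where
  cop : IsCoprime a b
  ha : m ∣ a - 1
  hb : m ∣ b

theorem V.lev {a b : ℤ} (h : V m a b) : ∃ c d, Lev m a b c d := by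
  have h1 : IsCoprime a m := by
    obtain ⟨k, hk⟩ := h.ha
    exact ⟨1, -k, by linarith⟩
  obtain ⟨u, v, huv⟩ := h.cop.mul_right h1
  refine ⟨-v * m, u, by linarith, h.ha, h.hb, Dvd.intro_left _ rfl, ?_⟩
  have : u - 1 = -(a-1)*u - b * (v * m) := by linarith
  rw [this]
  exact dvd_sub (h.ha.neg_right.mul_right _) (h.hb.mul_right _)

theorem Lev.v {a b c d : ℤ} (h : Lev m a b c d) : V m a b :=
  ⟨⟨d, -c, by linarith [h.det]⟩, h.ha, h.hb⟩

theorem sym_add_b (hH : Good m H) {a b : ℤ} (h : V m a b) (t : ℤ) :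
    sym m H a (b + m * t * a) = sym m H a b := by
  obtain ⟨c, d, hl⟩ := h.lev
  have hdet : a * (d + m * t * c) - (b + m * t * a) * c = 1 := by linarith [hl.det]
  rw [← sym_eq hH hl.det hl.hc, ← sym_eq hH hdet hl.hc]
  have key : mat12 a (b + m * t * a) c (d + m * t * c) hdet = mat12 a b c d hl.det * e12 (m * t) := by
    apply G3_ext
    simp
    constructor <;> ring
  rw [key, map_mul, pr_one (hH.h12 _ (Dvd.intro _ rfl)), mul_one]

theorem sym_add_a (hH : Good m H) {a b : ℤ} (h : V m a b) (t : ℤ) :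
    sym m H (a + t * b) b = sym m H a b := by
  obtain ⟨c, d, hl⟩ := h.lev
  have hdet : (a + t * b) * (d - t * b) - b * (c + t * (d - a) - t * t * b) = 1 := by
    linarith [hl.det]
  have hc : m ∣ c + t * (d - a) - t * t * b := by
    have : d - a = (d - 1) - (a - 1) := by ring
    rw [this]
    exact dvd_sub (dvd_add hl.hc ((dvd_sub hl.hd hl.ha).mul_left _)) (hl.hb.mul_left _)
  rw [← sym_eq hH hl.det hl.hc, ← sym_eq hH hdet hc]
  apply eq_of_conj (w := e21 (-t))
  · apply G3_ext
    simp
    refine ⟨?_, ?_, ?_⟩ <;> ring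
  · exact comm21 hH hl _

theorem sym_mul_b (hH : Good m H) {a b b' : ℤ} (h : V m a b) (h' : V m a b') :
    sym m H a (b * b') = sym m H a b * sym m H a b' := by
  obtain ⟨c, d, hl⟩ := h.lev
  obtain ⟨c', d', hl'⟩ := h'.lev
  have hL : Lev m a (b * b') (- c * c') (d' - d * b' * c') := by
    refine ⟨?_, h.ha, hl.hb.mul_right _, hl.hc.neg_right.mul_right _, ?_⟩
    · linear_combination hl'.det - b' * c' * hl.det
    · have : d' - d * b' * c' - 1 = (d' - 1) - d * b' * c' := by ring
      rw [this]
      exact dvd_sub hl'.hd (hl'.hc.mul_left _)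
  rw [← sym_eq hH hL.det hL.hc, ← sym_eq hH hl.det hl.hc, ← sym_eq hH hl'.det hl'.hc,
    ← pr_mat13 hH hL, ← pr_mat23 hH hl']
  have key : mat13 _ _ _ _ hL.det = e32 (-c') * (mat12 a b c d hl.det * mat23 a b' c' d' hl'.det
      * e12 (-b) * e21 (-c) * e23 (-(d * b'))) := by
    apply G3_ext
    simp
    have := hl.det
    have e1 : -(c * b) + d * a = 1 := by linarith
    simp only [e1]
    ring_nf
    simp
  rw [key]
  simp only [map_mul]
  rw [pr_one (hH.h32 _ hl'.hc.neg_right), pr_one (hH.h12 _ hl.hb.neg_right),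
    pr_one (hH.h21 _ hl.hc.neg_right), pr_one (hH.h23 _ (hl'.hb.mul_left _).neg_right)]
  simp

theorem sym_inv (hH : Good m H) {a b c d : ℤ} (h : Lev m a b c d) :
    sym m H d (-b) = (sym m H a b)⁻¹ := by
  have h2 : d * a - (-b) * (-c) = 1 := by linarith [h.det]
  rw [← sym_eq hH h2 h.hc.neg_right, ← sym_eq hH h.det h.hc, eq_inv_iff_mul_eq_one, ← map_mul]
  convert map_one (pr H)
  apply G3_ext
  have := h.det
  have := h2
  simp [Matrix.one_fin_three]
  refine ⟨⟨?_, ?_⟩, ?_, ?_⟩ <;> linarith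

theorem sym_mul_a (hH : Good m H) {a a' b : ℤ} (h : V m a b) (h' : V m a' b) :
    sym m H (a * a') b = sym m H a b * sym m H a' b := by
  obtain ⟨c, d, hl⟩ := h.lev
  obtain ⟨γ, δ, hl'⟩ := h'.lev
  have hv : V m (a * a') b := by
    refine ⟨h.cop.mul_left h'.cop, ?_, h.hb⟩
    have : a * a' - 1 = (a - 1) * a' + (a' - 1) := by ring
    rw [this]
    exact dvd_add (h.ha.mul_right _) h'.ha
  obtain ⟨C, D, hL⟩ := hv.lev
  have hp : m ∣ c * a' + a * γ := dvd_add (hl.hc.mul_right _) (hl'.hc.mul_left _)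
  have hW : Lev m (d * (a * a') - (c * a' + a * γ) * b) (a * δ - 1) (-(γ * b)) δ := by
    refine ⟨?_, ?_, ?_, (hl'.hc.mul_right _).neg_right, hl'.hd⟩
    · linear_combination a' * δ * hl.det + hl'.det
    · have : d * (a * a') - (c * a' + a * γ) * b - 1 =
          (d - 1) * (a * a') + (a * a' - 1) - (c * a' + a * γ) * b := by ring
      rw [this]
      exact dvd_sub (dvd_add (hl.hd.mul_right _) hL.ha) (hl.hb.mul_left _)
    · have : a * δ - 1 = (a - 1) * δ + (δ - 1) := by ring
      rw [this]
      exact dvd_add (hl.ha.mul_right _) hl'.hd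
  have hW1 : pr H (mat23 _ _ _ _ hW.det) = 1 := by
    rw [pr_mat23 hH hW, ← pr_swap hH hW, sym_eq hH _ hW.swap.hc]
    have e : -(-(γ * b)) = (-γ) * (-b) := by ring
    rw [e, sym_mul_b hH hl'.swap.v, sym_inv hH hl', ← sym_eq hH hl'.swap.det hl'.swap.hc,
      pr_swap hH hl', sym_eq hH _ hl'.hc, mul_inv_cancel]
    have := hl'.swap.v
    exact ⟨⟨a', γ, by linarith [hl'.det]⟩, hl'.hd, hl'.hb.neg_right⟩
  have key : e23 a * (mat12 a b c d hl.det * mat13 a' b γ δ hl'.det) =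
      e21 ((c * a' + a * γ) * D - d * C) * e31 (γ * D) * mat23 _ _ _ _ hW.det *
        mat12 _ _ _ _ hL.det * e23 a := by
    apply G3_ext
    have h1 := hl.det
    have h2 := hl'.det
    have h3 := hL.det
    simp
    refine ⟨?_, ⟨?_, ?_, ?_⟩, ?_, ?_, ?_⟩
    · ring
    · linear_combination (-(c * a' + a * γ)) * h3
    · linear_combination (-d) * h3
    · linear_combination (-d * a) * h3 - h1
    · linear_combination (-γ) * h3
    · ring
    · left; ring
  have key2 := congrArg (pr H) key
  simp only [map_mul] at key2
  rw [hW1, pr_one (hH.h21 _ (dvd_sub (hp.mul_right _) (hL.hc.mul_left _))),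
    pr_one (hH.h31 _ (hl'.hc.mul_right _)), one_mul, one_mul, one_mul, pr_mat13 hH hl',
    (comm23 hH hL.det hL.hb hL.hd a : _), sym_eq hH _ hl.hc, sym_eq hH _ hl'.hc, sym_eq hH _ hL.hc]
    at key2
  exact (mul_left_cancel key2).symm

theorem sym_one (hH : Good m H) {b : ℤ} (hb : m ∣ b) : sym m H 1 b = 1 := by
  have h : (1:ℤ) * 1 - b * 0 = 1 := by ring
  rw [← sym_eq hH h (dvd_zero _)]
  apply pr_one
  have : mat12 1 b 0 1 h = e12 b := rfl
  rw [this]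
  exact hH.h12 _ hb

end Menn

end CongrSL

namespace CongrSL

section Menn2

variable {m : ℤ} {H : Subgroup G3} [H.Normal]

theorem cop_of_dvd_sub_one {m a : ℤ} (h : m ∣ a - 1) : IsCoprime a m := by
  obtain ⟨k, hk⟩ := h
  exact ⟨1, -k, by linarith⟩

theorem V.pow_b {a b : ℤ} (h : V m a b) (k : ℕ) : V m a (b ^ (k + 1)) :=
  ⟨h.cop.pow_right, h.ha, dvd_pow h.hb (by omega)⟩

theorem V.pow_a {a b : ℤ} (h : V m a b) (k : ℕ) : V m (a ^ k) b :=
  ⟨h.cop.pow_left, h.ha.trans (by simpa using sub_dvd_pow_sub_pow a 1 k), h.hb⟩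

theorem sym_pow_b (hH : Good m H) {a b : ℤ} (h : V m a b) (k : ℕ) :
    sym m H a (b ^ (k + 1)) = sym m H a b ^ (k + 1) := by
  induction k with
  | zero => simp
  | succ k ih => rw [pow_succ b, sym_mul_b hH (h.pow_b k) h, ih, ← pow_succ]

theorem sym_pow_a (hH : Good m H) {a b : ℤ} (h : V m a b) (k : ℕ) :
    sym m H (a ^ k) b = sym m H a b ^ k := by
  induction k with
  | zero => simpa using sym_one hH h.hb
  | succ k ih => rw [pow_succ a, sym_mul_a hH (h.pow_a k) h, ih, ← pow_succ]

/-- If `a * m ∣ b - b'` then the symbols agree. -/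
theorem sym_congr_b (hH : Good m H) {a b b' : ℤ} (h : V m a b) (h2 : m ∣ b') (hd : a ∣ b' - b) :
    V m a b' ∧ sym m H a b' = sym m H a b := by
  have hmd : m ∣ b' - b := dvd_sub h2 h.hb
  obtain ⟨t, ht⟩ := (cop_of_dvd_sub_one h.ha).symm.mul_dvd hmd hd
  have e : b' = b + m * t * a := by linarith
  refine ⟨⟨?_, h.ha, h2⟩, ?_⟩
  · rw [e]
    exact IsCoprime.add_mul_left_right h.cop (m * t) |> fun h => by rwa [mul_comm a] at h
  · rw [e, sym_add_b hH h]

theorem sym_congr_a (hH : Good m H) {a a' b : ℤ} (h : V m a b) (hd : b ∣ a' - a) :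
    V m a' b ∧ sym m H a' b = sym m H a b := by
  obtain ⟨t, ht⟩ := hd
  have e : a' = a + t * b := by linarith
  refine ⟨⟨?_, ?_, h.hb⟩, ?_⟩
  · rw [e]
    exact IsCoprime.add_mul_right_left h.cop t
  · have : a' - 1 = (a - 1) + t * b := by linarith
    rw [this]
    exact dvd_add h.ha (h.hb.mul_left _)
  · rw [e, sym_add_a hH h]

theorem sym_unit (hH : Good m H) {a b ε : ℤ} (h : V m a b) (hε : ε * ε = 1) (hd : a ∣ b - ε) :
    sym m H a b = 1 := by
  have h2 : m ∣ ε * (1 - a) := by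
    have : ε * (1 - a) = -ε * (a - 1) := by ring
    rw [this]
    exact h.ha.mul_left _
  obtain ⟨v, e⟩ := sym_congr_b hH h h2 (by
    have : ε * (1 - a) - b = -(b - ε) + a * (- ε) := by ring
    rw [this]
    exact dvd_add hd.neg_right (Dvd.intro _ rfl))
  obtain ⟨v', e'⟩ := sym_congr_a hH v (a' := 1) ⟨ε, by linear_combination (-(1 - a)) * hε⟩
  rw [← e, ← e', sym_one hH h2]

theorem exists_prime_of (N : ℕ) {q s : ℤ} (hq : q ≠ 0) (h : IsCoprime s q) :
    ∃ p : ℕ, N < p ∧ p.Prime ∧ q ∣ (p : ℤ) - s := by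
  obtain ⟨p, hp, hpp, hm⟩ := Nat.forall_exists_prime_gt_and_zmodEq N (q := q.natAbs) (a := s)
    (by simpa using hq) (by
      rcases Int.natAbs_eq q with e | e
      · rwa [← e]
      · rw [e, IsCoprime.neg_right_iff] at h
        exact h)
  refine ⟨p, hp, hpp, ?_⟩
  have := hm.symm.dvd
  rwa [Int.natCast_natAbs, abs_dvd] at this

theorem sym_prime (hH : Good m H) (hm : 0 < m) {p : ℕ} (hp : p.Prime) (hp3 : p % 4 = 3) {b : ℤ}
    (h : V m (-p) b) : sym m H (-p) b = 1 := by
  obtain ⟨b', rfl⟩ := h.hb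
  obtain ⟨h', rfl⟩ : ∃ h', p = 4 * h' + 3 := ⟨p / 4, by omega⟩
  set p := 4 * h' + 3 with hpdef
  have hb' : IsCoprime b' (p : ℤ) := by
    have := h.cop.symm.of_mul_left_right
    rwa [IsCoprime.neg_right_iff] at this
  set s : ℤ := 2 * p + b' * (-2 * (2 * h' + 1)) with hs
  have hs1 : IsCoprime s (p : ℤ) := by
    have : s = b' + p * (2 - b') := by rw [hs, hpdef]; push_cast; ring
    rw [this]
    exact hb'.add_mul_left_left _
  have hs2 : IsCoprime s (2 * h' + 1 : ℤ) := by
    have : s = 2 + (2 * h' + 1) * (4 - 2 * b') := by rw [hs, hpdef]; push_cast; ring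
    rw [this]
    apply IsCoprime.add_mul_left_left
    exact ⟨-h', 1, by ring⟩
  obtain ⟨r, hrm, hr, hrs⟩ := exists_prime_of m.natAbs (q := p * (2 * h' + 1))
    (mul_ne_zero (by simp [hpdef]; omega) (by omega)) (hs1.mul_right hs2)
  have hrp : (p : ℤ) ∣ r - b' := by
    have : (r - b' : ℤ) = (r - s) + p * (2 - b') := by rw [hs, hpdef]; push_cast; ring
    rw [this]
    exact dvd_add ((Dvd.intro _ rfl).trans hrs) (Dvd.intro _ rfl)
  have hrh : (2 * h' + 1 : ℤ) ∣ r - 2 := by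
    have : (r - 2 : ℤ) = (r - s) + (2 * h' + 1) * (4 - 2 * b') := by
      rw [hs, hpdef]; push_cast; ring
    rw [this]
    exact dvd_add ((Dvd.intro_left _ rfl).trans hrs) (Dvd.intro _ rfl)
  obtain ⟨v, e⟩ := sym_congr_b hH h (b' := m * r) (Dvd.intro _ rfl) (by
    rw [neg_dvd, ← mul_sub]
    exact hrp.mul_left _)
  rw [← e]
  have hpow1 : sym m H (-p) (m * r) ^ (2 * h' + 1) = 1 := by
    rw [← sym_pow_b hH v]
    have : Fact p.Prime := ⟨hp⟩
    have hne : ((m * r : ℤ) : ZMod p) ≠ 0 := by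
      rw [Ne, ZMod.intCast_zmod_eq_zero_iff_dvd]
      intro hdvd
      have h1 : IsCoprime (p : ℤ) (m * r) := by
        have := v.cop
        rwa [IsCoprime.neg_left_iff] at this
      have := h1.isUnit_of_dvd' dvd_rfl hdvd
      rw [Int.isUnit_iff] at this
      omega
    have h2 := ZMod.pow_div_two_eq_neg_one_or_one p hne
    have h3 : p / 2 = 2 * h' + 1 := by omega
    rw [h3] at h2
    have hv := v.pow_b (2 * h')
    rcases h2 with h2 | h2
    · refine sym_unit hH hv (ε := 1) (by ring) ?_
      rw [neg_dvd, ← ZMod.intCast_zmod_eq_zero_iff_dvd]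
      push_cast at h2 ⊢
      rw [h2]; ring
    · refine sym_unit hH hv (ε := -1) (by ring) ?_
      rw [neg_dvd, ← ZMod.intCast_zmod_eq_zero_iff_dvd]
      push_cast at h2 ⊢
      rw [h2]; ring
  have hpow2 : sym m H (-p) (m * r) ^ (r - 1) = 1 := by
    rw [← sym_pow_a hH v]
    have : Fact r.Prime := ⟨hr⟩
    have hrr : IsCoprime (-p : ℤ) r := v.cop.of_mul_right_right
    have hfer : (r : ℤ) ∣ (-p : ℤ) ^ (r - 1) - 1 := by
      rw [← ZMod.intCast_zmod_eq_zero_iff_dvd]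
      have hne : ((-p : ℤ) : ZMod r) ≠ 0 := by
        rw [Ne, ZMod.intCast_zmod_eq_zero_iff_dvd]
        intro hdvd
        have := hrr.isUnit_of_dvd' hdvd dvd_rfl
        rw [Int.isUnit_iff] at this
        have := hr.two_le
        omega
      rw [Int.cast_sub, Int.cast_pow, ZMod.pow_card_sub_one_eq_one hne]
      simp
    have hcop : IsCoprime m (r : ℤ) := by
      rw [isCoprime_comm, Int.isCoprime_iff_gcd_eq_one, Int.gcd_eq_natAbs, Int.natAbs_natCast]
      rw [← Nat.coprime_iff_gcd_eq_one, hr.coprime_iff_not_dvd]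
      intro hdvd
      have := Nat.le_of_dvd (by omega) hdvd
      omega
    obtain ⟨_, e2⟩ := sym_congr_a hH (v.pow_a (r - 1)) (a' := 1) (by
      rw [← dvd_neg, neg_sub]
      exact hcop.mul_dvd (v.pow_a (r-1)).ha hfer)
    rw [← e2, sym_one hH v.hb]
  have hg : Nat.gcd (2 * h' + 1) (r - 1) = 1 := by
    have h1 : 1 ≤ r := hr.one_lt.le
    have d1 : ((Nat.gcd (2 * h' + 1) (r - 1) : ℕ) : ℤ) ∣ (r - 1 : ℤ) := by
      have := Int.natCast_dvd_natCast.2 (Nat.gcd_dvd_right (2 * h' + 1) (r - 1))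
      rwa [Nat.cast_sub h1, Nat.cast_one] at this
    have d2 : ((Nat.gcd (2 * h' + 1) (r - 1) : ℕ) : ℤ) ∣ (r - 2 : ℤ) := by
      refine dvd_trans ?_ hrh
      exact_mod_cast (Nat.gcd_dvd_left (2 * h' + 1) (r - 1))
    have d3 := dvd_sub d1 d2
    have e3 : (r - 1 : ℤ) - (r - 2) = 1 := by ring
    rw [e3] at d3
    exact Nat.dvd_one.1 (by exact_mod_cast d3)
  have := pow_gcd_eq_one.2 ⟨hpow1, hpow2⟩
  rwa [hg, pow_one] at this

theorem sym_trivial (hH : Good m H) (hm : 3 ≤ m) {a b : ℤ} (h : V m a b) : sym m H a b = 1 := by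
  obtain ⟨b', rfl⟩ := h.hb
  have ha0 : a ≠ 0 := by
    rintro rfl
    have := Int.le_of_dvd (by norm_num) (by simpa using h.ha.neg_right : m ∣ 1)
    omega
  obtain ⟨r, hr2, hr, hrd⟩ := exists_prime_of 2 ha0 h.cop.symm.of_mul_left_right
  obtain ⟨v, e⟩ := sym_congr_b hH h (b' := m * r) (Dvd.intro _ rfl) (by
    rw [← mul_sub]; exact hrd.mul_left _)
  rw [← e]
  have hrodd : (r : ℤ) % 2 = 1 := by
    rcases hr.eq_two_or_odd with h | h <;> omega
  have hs : ∃ t : ℤ, (-a + t * (m * r)) % 4 = 3 := by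
    by_cases h4 : (4 : ℤ) ∣ m
    · refine ⟨0, ?_⟩
      have := h4.trans h.ha
      omega
    · by_cases h2 : m % 2 = 1
      · have ho : (m * r) % 2 = 1 := by rw [Int.mul_emod, h2, hrodd]; rfl
        refine ⟨(3 + a) * (m * r), ?_⟩
        generalize m * (r : ℤ) = B at ho
        have hB : (4 : ℤ) ∣ B * B - 1 := by
          obtain ⟨w, hw⟩ : ∃ w, B = 2 * w + 1 := ⟨B / 2, by omega⟩
          exact ⟨w * w + w, by rw [hw]; ring⟩
        obtain ⟨w, hw⟩ := hB
        have : -a + (3 + a) * B * B = 3 + 4 * ((3 + a) * w) := by linear_combination (3 + a) * hw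
        rw [this]
        omega
      · obtain ⟨w, hw⟩ : ∃ w, m = 2 * w := ⟨m / 2, by omega⟩
        have hwo : w % 2 = 1 := by omega
        have hao : a % 2 = 1 := by
          have : (2 : ℤ) ∣ a - 1 := (Dvd.intro _ hw.symm).trans h.ha
          omega
        have ho : (w * r) % 2 = 1 := by rw [Int.mul_emod, hwo, hrodd]; rfl
        obtain ⟨u, hu⟩ : ∃ u, w * r = 2 * u + 1 := ⟨(w * r) / 2, by omega⟩
        obtain ⟨x, hx⟩ : ∃ x, a = 2 * x + 1 := ⟨a / 2, by omega⟩
        refine ⟨x, ?_⟩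
        have : -a + x * (m * r) = -1 + 4 * (x * u) := by
          rw [hw, hx]; linear_combination 2 * x * hu
        rw [this]
        omega
  obtain ⟨t, ht⟩ := hs
  have hmr : m * (r : ℤ) ≠ 0 := mul_ne_zero (by omega) (by omega)
  have hc1 : IsCoprime (-a + t * (m * r)) (m * r) := by
    apply IsCoprime.add_mul_right_left
    exact v.cop.neg_left
  have hc2 : IsCoprime (-a + t * (m * r)) 4 := by
    generalize (-a + t * (m * r)) = B at ht
    exact ⟨-1, (B + 1) / 4, by omega⟩
  obtain ⟨p, -, hp, hpd⟩ := exists_prime_of 0 (mul_ne_zero hmr (by norm_num : (4:ℤ) ≠ 0))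
    (hc1.mul_right hc2)
  have hp3 : p % 4 = 3 := by
    have : (4 : ℤ) ∣ _ := (Dvd.intro_left _ rfl).trans hpd
    omega
  obtain ⟨v2, e2⟩ := sym_congr_a hH v (a' := -p) (by
    have : (-p - a : ℤ) = -(p - (-a + t * (m * r))) - m * r * t := by ring
    rw [this]
    exact dvd_sub ((Dvd.intro _ rfl).trans hpd).neg_right (Dvd.intro _ rfl))
  rw [← e2]
  exact sym_prime hH (by omega) hp hp3 v2

theorem mat12_mem (hH : Good m H) (hm : 3 ≤ m) {a b c d : ℤ} (h : Lev m a b c d) :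
    mat12 a b c d h.det ∈ H := by
  have := sym_trivial hH hm h.v
  rw [← sym_eq hH h.det h.hc] at this
  exact (QuotientGroup.eq_one_iff _).1 this

end Menn2

end CongrSL

namespace CongrSL

open Matrix

section Emb

variable {n : ℕ}

theorem coe_mul1 {k : ℕ} (A B : Matrix.SpecialLinearGroup (Fin k) ℤ) : (A * B).1 = A.1 * B.1 := rfl

theorem tv_coe {i j : Fin n} (h : i ≠ j) (t : ℤ) :
    (Matrix.SpecialLinearGroup.transvection h t).1 = 1 + single i j t :=
  Matrix.SpecialLinearGroup.transvection_coe h t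

/-- inclusion matrix -/
def inc (f : Fin 3 → Fin n) : Matrix (Fin n) (Fin 3) ℤ := (1 : Matrix (Fin n) (Fin n) ℤ).submatrix id f

theorem inc_mul {f : Fin 3 → Fin n} (hf : Function.Injective f) : (inc f)ᵀ * inc f = 1 := by
  have : (inc f)ᵀ = (1 : Matrix (Fin n) (Fin n) ℤ).submatrix f id := by
    rw [inc, transpose_submatrix, transpose_one]
  rw [this, inc, ← submatrix_mul _ _ _ _ _ Function.bijective_id, one_mul, submatrix_one f hf]

/-- block embedding `SL_3 → SL_n` -/
def emb (f : Fin 3 → Fin n) (hf : Function.Injective f) : G3 →* Matrix.SpecialLinearGroup (Fin n) ℤ where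
  toFun A := ⟨1 + inc f * ((A.1 - 1) * (inc f)ᵀ), by
    rw [det_one_add_mul_comm, Matrix.mul_assoc, inc_mul hf]
    simp⟩
  map_one' := by
    apply Subtype.ext
    simp
  map_mul' A B := by
    apply Subtype.ext
    change 1 + inc f * ((A.1 * B.1 - 1) * (inc f)ᵀ) =
      (1 + inc f * ((A.1 - 1) * (inc f)ᵀ)) * (1 + inc f * ((B.1 - 1) * (inc f)ᵀ))
    have h := inc_mul hf
    generalize inc f = P at *
    generalize A.1 = X
    generalize B.1 = Y
    have e : P * ((X - 1) * Pᵀ) * (P * ((Y - 1) * Pᵀ)) = P * ((X - 1) * (Y - 1) * Pᵀ) := by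
      calc _ = P * (X - 1) * (Pᵀ * P) * ((Y - 1) * Pᵀ) := by simp only [Matrix.mul_assoc]
        _ = _ := by rw [h]; simp only [Matrix.mul_assoc, Matrix.one_mul]
    rw [add_mul, one_mul, mul_add, mul_one, e, add_assoc, ← Matrix.mul_add, ← Matrix.mul_add,
      ← Matrix.add_mul, ← Matrix.add_mul]
    congr 4
    noncomm_ring

theorem emb_apply (f : Fin 3 → Fin n) (hf : Function.Injective f) (A : G3) (p q : Fin n) :
    (emb f hf A).1 p q = (1 : Matrix _ _ ℤ) p q +
      ∑ a, ∑ b, if p = f a ∧ q = f b then A.1 a b - (1 : Matrix _ _ ℤ) a b else 0 := by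
  change (1 + inc f * ((A.1 - 1) * (inc f)ᵀ) : Matrix (Fin n) (Fin n) ℤ) p q = _
  rw [Matrix.add_apply, Matrix.mul_apply]
  congr 1
  apply Finset.sum_congr rfl
  intro a _
  rw [Matrix.mul_apply, Finset.mul_sum]
  apply Finset.sum_congr rfl
  intro b _
  simp only [inc, submatrix_apply, transpose_apply, one_apply, id, Matrix.sub_apply]
  by_cases h1 : p = f a <;> by_cases h2 : q = f b <;> simp [h1, h2]

theorem emb_mat12 (f : Fin 3 → Fin n) (hf : Function.Injective f) {a b c d : ℤ}
    (h : a * d - b * c = 1) (p q : Fin n) :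
    (emb f hf (mat12 a b c d h)).1 p q = (1 : Matrix _ _ ℤ) p q +
      ((if p = f 0 ∧ q = f 0 then a - 1 else 0) + (if p = f 0 ∧ q = f 1 then b else 0) +
      ((if p = f 1 ∧ q = f 0 then c else 0) + (if p = f 1 ∧ q = f 1 then d - 1 else 0))) := by
  rw [emb_apply]
  simp [Fin.sum_univ_three]

variable {m : ℕ} {H : Subgroup (Matrix.SpecialLinearGroup (Fin n) ℤ)}

/-- `H` contains the elementary matrices of level `m`. -/
def HE (m : ℕ) (H : Subgroup (Matrix.SpecialLinearGroup (Fin n) ℤ)) : Prop :=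
  ∀ (i j : Fin n) (h : i ≠ j) (t : ℤ), (m : ℤ) ∣ t → Matrix.SpecialLinearGroup.transvection h t ∈ H

theorem good_comap (hH : HE m H) (f : Fin 3 → Fin n) (hf : Function.Injective f) :
    Good m (H.comap (emb f hf)) := by
  have key : ∀ (i j : Fin 3) (hij : i ≠ j) (t : ℤ) (E : G3),
      E.1 = Matrix.transvection i j t → (m : ℤ) ∣ t → E ∈ H.comap (emb f hf) := by
    intro i j hij t E hE ht
    have : emb f hf E = Matrix.SpecialLinearGroup.transvection (hf.ne hij) t := by
      apply Matrix.SpecialLinearGroup.ext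
      intro p q
      have h1 := emb_apply f hf E p q
      refine h1.trans ?_
      rw [tv_coe, Matrix.add_apply, single_apply]
      congr 1
      rw [hE]
      have : ∀ a b : Fin 3, (if p = f a ∧ q = f b then
          Matrix.transvection i j t a b - (1 : Matrix _ _ ℤ) a b else 0) =
          if a = i then (if b = j then (if p = f i ∧ q = f j then t else 0) else 0) else 0 := by
        intro a b
        simp only [Matrix.transvection, Matrix.add_apply, single_apply, add_sub_cancel_left]
        by_cases h1 : a = i
        · by_cases h2 : b = j
          · subst h1; subst h2; simp
          · simp [h2, Ne.symm h2]
        · simp [h1, Ne.symm h1]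
      simp only [this]
      simp [eq_comm]
    rw [Subgroup.mem_comap, this]
    exact hH _ _ _ _ ht
  constructor
  · exact fun t => key 0 1 (by decide) t _ (by
      ext i j; fin_cases i <;> fin_cases j <;> simp [Matrix.transvection])
  · exact fun t => key 0 2 (by decide) t _ (by
      ext i j; fin_cases i <;> fin_cases j <;> simp [Matrix.transvection])
  · exact fun t => key 1 2 (by decide) t _ (by
      ext i j; fin_cases i <;> fin_cases j <;> simp [Matrix.transvection])
  · exact fun t => key 1 0 (by decide) t _ (by
      ext i j; fin_cases i <;> fin_cases j <;> simp [Matrix.transvection])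
  · exact fun t => key 2 0 (by decide) t _ (by
      ext i j; fin_cases i <;> fin_cases j <;> simp [Matrix.transvection])
  · exact fun t => key 2 1 (by decide) t _ (by
      ext i j; fin_cases i <;> fin_cases j <;> simp [Matrix.transvection])

theorem emb_mem [H.Normal] (hH : HE m H) (hm : 3 ≤ m) (f : Fin 3 → Fin n)
    (hf : Function.Injective f) {a b c d : ℤ} (h : Lev m a b c d) :
    emb f hf (mat12 a b c d h.det) ∈ H :=
  mat12_mem (good_comap hH f hf) (by exact_mod_cast hm) h

/-- rank one unipotent -/
def R1 (v w : Fin n → ℤ) (h : w ⬝ᵥ v = 0) : Matrix.SpecialLinearGroup (Fin n) ℤ :=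
  ⟨1 + vecMulVec v w, by rw [vecMulVec_eq Unit, det_one_add_replicateCol_mul_replicateRow, h, add_zero]⟩

theorem R1_coe (v w : Fin n → ℤ) (h : w ⬝ᵥ v = 0) : (R1 v w h).1 = 1 + vecMulVec v w := rfl

theorem mem_congr_iff (m : ℕ) (A : Matrix.SpecialLinearGroup (Fin n) ℤ) :
    A ∈ SLCongruence n m ↔ ∀ i j, (m : ℤ) ∣ A.1 i j - (1 : Matrix _ _ ℤ) i j := by
  rw [SLCongruence, MonoidHom.mem_ker]
  refine (Matrix.SpecialLinearGroup.ext_iff _ _).trans ?_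
  apply forall_congr'; intro i
  apply forall_congr'; intro j
  rw [← ZMod.intCast_zmod_eq_zero_iff_dvd, Int.cast_sub, sub_eq_zero]
  have : (((1 : Matrix (Fin n) (Fin n) ℤ) i j : ℤ) : ZMod m) = (1 : Matrix _ _ (ZMod m)) i j := by
    simp only [one_apply]; split_ifs <;> simp
  rw [this]
  rfl

instance congr_normal (m : ℕ) : (SLCongruence n m).Normal := by
  unfold SLCongruence; infer_instance

theorem congr_HE (m : ℕ) : HE m (SLCongruence n m) := by
  intro i j h t ht
  rw [mem_congr_iff]
  intro p q
  rw [tv_coe, Matrix.add_apply, add_sub_cancel_left, single_apply]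
  split_ifs
  · exact ht
  · exact dvd_zero _

theorem col_mem (hH : HE m H) (i : Fin n) (v : Fin n → ℤ) (hv : v i = 0) (hd : ∀ k, (m : ℤ) ∣ v k)
    (h : (Pi.single i 1 : Fin n → ℤ) ⬝ᵥ v = 0) : R1 v (Pi.single i 1) h ∈ H := by
  have key : ∀ T : Finset (Fin n), ∃ g ∈ H, g.1 =
      1 + vecMulVec (fun k => if k ∈ T then v k else 0) (Pi.single i 1) := by
    intro T
    induction T using Finset.induction_on with
    | empty =>
      refine ⟨1, one_mem _, ?_⟩
      ext p q
      simp [vecMulVec_apply]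
    | insert k T hk ih =>
      obtain ⟨g, hg, hge⟩ := ih
      by_cases hki : k = i
      · refine ⟨g, hg, ?_⟩
        rw [hge]
        congr 2
        ext p
        by_cases hp : p = k
        · subst hp; simp [hki, hv]
        · simp [hp]
      · refine ⟨Matrix.SpecialLinearGroup.transvection hki (v k) * g, mul_mem (hH _ _ _ _ (hd k)) hg, ?_⟩
        rw [coe_mul1, tv_coe, hge]
        ext p q
        have hik : ¬ i = k := fun h => hki h.symm
        rw [add_mul, one_mul, Matrix.add_apply, Matrix.add_apply, Matrix.add_apply, add_assoc]
        congr 1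
        by_cases hp : p = k
        · subst hp
          by_cases hq : q = i
          · subst hq
            simp [vecMulVec_apply, hk, hv]
          · have hiq : ¬ i = q := fun h => hq h.symm
            simp [vecMulVec_apply, hk, hv, hq, hiq, one_apply]
        · simp [vecMulVec_apply, hp]
  obtain ⟨g, hg, hge⟩ := key Finset.univ
  have : R1 v (Pi.single i 1) h = g := by
    apply Subtype.ext
    rw [hge, R1_coe]
    simp
  rwa [this]

/-- `M` agrees with the identity outside `S`. -/
def Supp (S : Finset (Fin n)) (M : Matrix.SpecialLinearGroup (Fin n) ℤ) : Prop :=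
  ∀ l, l ∉ S → ∀ j, M.1 l j = (1 : Matrix _ _ ℤ) l j ∧ M.1 j l = (1 : Matrix _ _ ℤ) j l

theorem Supp.mul {S : Finset (Fin n)} {M N : Matrix.SpecialLinearGroup (Fin n) ℤ} (hM : Supp S M)
    (hN : Supp S N) : Supp S (M * N) := by
  intro l hl j
  have e : (M * N).1 = M.1 * N.1 := rfl
  rw [e, Matrix.mul_apply, Matrix.mul_apply]
  constructor
  · simp only [(hM l hl _).1]
    rw [← Matrix.mul_apply, one_mul, (hN l hl j).1]
  · simp only [(hN l hl _).2]
    rw [← Matrix.mul_apply, mul_one, (hM l hl j).2]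

theorem Supp.transv {S : Finset (Fin n)} {i j : Fin n} (h : i ≠ j) (hi : i ∈ S) (hj : j ∈ S) (t : ℤ) :
    Supp S (Matrix.SpecialLinearGroup.transvection h t) := by
  intro l hl k
  have h1 : i ≠ l := fun e => hl (e ▸ hi)
  have h2 : j ≠ l := fun e => hl (e ▸ hj)
  simp only [tv_coe, Matrix.add_apply, single_apply]
  simp [h1, h2]

/-- Step A: row `i` is already standard. -/
theorem stepA (hH : HE m H) (S : Finset (Fin n)) (i : Fin n)
    (IH : ∀ M ∈ SLCongruence n m, Supp (S.erase i) M → M ∈ H)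
    (M : Matrix.SpecialLinearGroup (Fin n) ℤ) (hM : M ∈ SLCongruence n m) (hS : Supp S M)
    (hrow : ∀ j, M.1 i j = (1 : Matrix _ _ ℤ) i j) : M ∈ H := by
  set v : Fin n → ℤ := fun k => -(M.1 k i - (1 : Matrix _ _ ℤ) k i) with hvdef
  have hv : v i = 0 := by simp [hvdef, hrow]
  have hd : ∀ k, (m : ℤ) ∣ v k := fun k => ((mem_congr_iff m M).1 hM k i).neg_right
  have h0 : (Pi.single i 1 : Fin n → ℤ) ⬝ᵥ v = 0 := by simp [hv]
  have hu := col_mem hH i v hv hd h0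
  have hu' := col_mem (congr_HE m) i v hv hd h0
  rw [← Subgroup.mul_mem_cancel_left H hu]
  apply IH _ (mul_mem hu' hM)
  have entry : ∀ p q, (R1 v (Pi.single i 1) h0 * M).1 p q =
      M.1 p q + v p * (1 : Matrix _ _ ℤ) i q := by
    intro p q
    have e : (R1 v (Pi.single i 1) h0 * M).1 = (1 + vecMulVec v (Pi.single i 1)) * M.1 := rfl
    rw [e, add_mul, one_mul, Matrix.add_apply, vecMulVec_mul, vecMulVec_apply]
    congr 2
    simp [hrow]
  intro l hl j
  rw [entry, entry]
  by_cases hli : l = i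
  · subst hli
    constructor
    · rw [hrow, hv, zero_mul, add_zero]
    · simp [hvdef]
  · have hlS : l ∉ S := fun h => hl (Finset.mem_erase.2 ⟨hli, h⟩)
    obtain ⟨h1, h2⟩ := hS l hlS j
    have h3 := (hS l hlS i).1
    constructor
    · have : v l = 0 := by simp [hvdef, h3]
      rw [h1, this, zero_mul, add_zero]
    · have hil : i ≠ l := fun h => hli h.symm
      rw [h2, one_apply_ne hil, mul_zero, add_zero]

end Emb

end CongrSL

namespace CongrSL

open Matrix

section Red

variable {n : ℕ} {m : ℕ} {H : Subgroup (Matrix.SpecialLinearGroup (Fin n) ℤ)}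

theorem mul_tv (M : Matrix.SpecialLinearGroup (Fin n) ℤ) {i j : Fin n} (h : i ≠ j) (t : ℤ)
    (p q : Fin n) : (M * Matrix.SpecialLinearGroup.transvection h t).1 p q =
      M.1 p q + if q = j then M.1 p i * t else 0 := by
  rw [coe_mul1, tv_coe, mul_add, mul_one, Matrix.add_apply]
  congr 1
  split_ifs with hq
  · subst hq; simp
  · rw [Matrix.mul_single_apply_of_ne _ _ _ _ _ hq]

theorem tv_mul (M : Matrix.SpecialLinearGroup (Fin n) ℤ) {i j : Fin n} (h : i ≠ j) (t : ℤ)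
    (p q : Fin n) : (Matrix.SpecialLinearGroup.transvection h t * M).1 p q =
      M.1 p q + if p = i then t * M.1 j q else 0 := by
  rw [coe_mul1, tv_coe, add_mul, one_mul, Matrix.add_apply]
  congr 1
  split_ifs with hq
  · subst hq; simp
  · rw [Matrix.single_mul_apply_of_ne _ _ _ _ _ hq]

theorem tv_neg {i j : Fin n} (h : i ≠ j) (t : ℤ) :
    (Matrix.SpecialLinearGroup.transvection h t)⁻¹ =
      Matrix.SpecialLinearGroup.transvection h (-t) := by
  rw [inv_eq_iff_mul_eq_one]
  apply Subtype.ext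
  rw [coe_mul1, tv_coe, tv_coe]
  exact (Matrix.transvection_mul_transvection_same i j h t (-t)).trans (by simp)

theorem Supp.emb {S : Finset (Fin n)} {i j k : Fin n} (hi : i ∈ S) (hj : j ∈ S)
    (hf : Function.Injective ![i, j, k]) {a b c d : ℤ} (h : a * d - b * c = 1) :
    Supp S (emb ![i, j, k] hf (mat12 a b c d h)) := by
  intro l hl p
  have h1 : l ≠ i := fun e => hl (e ▸ hi)
  have h2 : l ≠ j := fun e => hl (e ▸ hj)
  rw [emb_mat12, emb_mat12]
  simp [h1, h2]

theorem exists_sign {x y : ℤ} (hy : y ≠ 0) (h : y.natAbs ≤ x.natAbs) :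
    ∃ s : ℤ, (x + y * s).natAbs < x.natAbs := by
  rcases le_total 0 x with hx | hx <;> rcases le_total 0 y with h' | h'
  · exact ⟨-1, by omega⟩
  · exact ⟨1, by omega⟩
  · exact ⟨1, by omega⟩
  · exact ⟨-1, by omega⟩

theorem stepB [H.Normal] (hn : 3 ≤ n) (hH : HE m H) (hm : 3 ≤ m) (S : Finset (Fin n)) (i : Fin n)
    (hi : i ∈ S)
    (IH : ∀ M ∈ SLCongruence n m, Supp (S.erase i) M → M ∈ H) (N : ℕ) :
    ∀ (M : Matrix.SpecialLinearGroup (Fin n) ℤ) (_ : M ∈ SLCongruence n m) (_ : Supp S M),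
      (∑ j ∈ Finset.univ.erase i, (M.1 i j).natAbs) = N → M ∈ H := by
  induction N using Nat.strong_induction_on with
  | _ N ihN =>
  intro M hM hS hN
  have hin : ∀ j, j ≠ i → M.1 i j ≠ 0 → j ∈ S := by
    intro j hj h0
    by_contra hjS
    exact h0 (by rw [(hS j hjS i).2, one_apply_ne hj.symm])
  by_cases c1 : ∃ j k, j ≠ i ∧ k ≠ i ∧ k ≠ j ∧ M.1 i k ≠ 0 ∧ (M.1 i k).natAbs ≤ (M.1 i j).natAbs
  · obtain ⟨j, k, hj, hk, hkj, h0, hle⟩ := c1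
    have hkS := hin k hk h0
    have hjS := hin j hj (by intro e; rw [e] at hle; omega)
    obtain ⟨s, hs⟩ := exists_sign h0 hle
    set T := Matrix.SpecialLinearGroup.transvection hkj s with hT
    have hrow : ∀ l, (T⁻¹ * (M * T)).1 i l = M.1 i l + if l = j then M.1 i k * s else 0 := by
      intro l
      rw [hT, tv_neg, tv_mul, mul_tv, if_neg hk.symm, add_zero]
    have key : T⁻¹ * (M * T) ∈ H := by
      refine ihN (∑ l ∈ Finset.univ.erase i, ((T⁻¹ * (M * T)).1 i l).natAbs) ?_ _ ?_ ?_ rfl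
      · rw [← hN]
        apply Finset.sum_lt_sum
        · intro l _
          rw [hrow]
          split_ifs with hl
          · subst hl; exact hs.le
          · simp
        · refine ⟨j, by simp [hj], ?_⟩
          rw [hrow, if_pos rfl]
          exact hs
      · have := (congr_normal (n := n) m).conj_mem M hM T⁻¹
        rwa [inv_inv, mul_assoc] at this
      · rw [hT, tv_neg]
        exact (Supp.transv _ hkS hjS _).mul (hS.mul (Supp.transv _ hkS hjS _))
    have := (inferInstance : H.Normal).conj_mem _ key T
    have e : T * (T⁻¹ * (M * T)) * T⁻¹ = M := by group
    rwa [e] at this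
  · have hM' := (mem_congr_iff m M).1 hM
    have hinv : ∑ l, M.1 i l * (M⁻¹).1 l i = 1 := by
      have : (M * M⁻¹).1 i i = 1 := by rw [mul_inv_cancel]; exact one_apply_eq i
      rwa [coe_mul1, Matrix.mul_apply] at this
    have ha := hM' i i
    rw [one_apply_eq] at ha
    by_cases c2 : ∃ j, j ≠ i ∧ M.1 i j ≠ 0
    · obtain ⟨j, hj, h0⟩ := c2
      have hjS := hin j hj h0
      have hz : ∀ l, l ≠ i ∧ l ≠ j → M.1 i l = 0 := by
        rintro l ⟨hl, hlj⟩
        by_contra hl0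
        rcases le_total (M.1 i l).natAbs (M.1 i j).natAbs with h | h
        · exact c1 ⟨j, l, hj, hl, hlj, hl0, h⟩
        · exact c1 ⟨l, j, hl, hj, hlj.symm, h0, h⟩
      rw [Fintype.sum_eq_add i j hj.symm (by intro l hl; rw [hz l hl, zero_mul])] at hinv
      have hb := hM' i j
      rw [one_apply_ne hj.symm, sub_zero] at hb
      have hV : V m (M.1 i i) (M.1 i j) := ⟨⟨(M⁻¹).1 i i, (M⁻¹).1 j i, by linarith [hinv]⟩, ha, hb⟩
      obtain ⟨c, d, hL⟩ := hV.lev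
      have hL' : Lev m d (-M.1 i j) (-c) (M.1 i i) :=
        ⟨by linarith [hL.det], hL.hd, hL.hb.neg_right, hL.hc.neg_right, hL.ha⟩
      obtain ⟨k, hk⟩ : ∃ k, k ∉ ({i, j} : Finset (Fin n)) := by
        by_contra hcon
        push Not at hcon
        have : Finset.univ ⊆ ({i, j} : Finset (Fin n)) := fun x _ => hcon x
        have h1 := Finset.card_le_card this
        have h2 := Finset.card_le_two (a := i) (b := j)
        rw [Finset.card_univ, Fintype.card_fin] at h1
        omega
      have hki : k ≠ i := by intro h; simp [h] at hk
      have hkj : k ≠ j := by intro h; simp [h] at hk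
      have hf : Function.Injective ![i, j, k] := by
        intro x y hxy
        fin_cases x <;> fin_cases y <;> simp_all
      have hg := emb_mem hH hm ![i, j, k] hf hL'
      have hg' := emb_mem (congr_HE m) hm ![i, j, k] hf hL'
      rw [← Subgroup.mul_mem_cancel_right H hg]
      refine stepA hH S i IH _ (mul_mem hM hg') (hS.mul (Supp.emb hi hjS hf _)) ?_
      intro l
      rw [coe_mul1, Matrix.mul_apply,
        Fintype.sum_eq_add i j hj.symm (by intro l hl; rw [hz l hl, zero_mul]),
        emb_mat12, emb_mat12]
      have hij : i ≠ j := hj.symm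
      by_cases h1 : l = i
      · subst h1
        simp [hj, hij]
        linarith [hL.det]
      · by_cases h2 : l = j
        · subst h2
          simp [hj, hij]
          ring
        · have h3 : i ≠ l := fun h => h1 h.symm
          have h4 : j ≠ l := fun h => h2 h.symm
          simp [h1, h2, h3, h4]
    · push Not at c2
      rw [Fintype.sum_eq_single i (by intro l hl; rw [c2 l hl, zero_mul])] at hinv
      refine stepA hH S i IH M hM hS ?_
      intro l
      by_cases hl : l = i
      · subst hl
        rw [one_apply_eq]
        rcases Int.isUnit_iff.1 (IsUnit.of_mul_eq_one _ hinv) with h | h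
        · exact h
        · rw [h] at ha
          have := Int.le_of_dvd (by norm_num) (ha.neg_right)
          omega
      · rw [c2 l hl, one_apply_ne (fun h => hl h.symm)]

theorem red [H.Normal] (hn : 3 ≤ n) (hH : HE m H) (hm : 3 ≤ m) : SLCongruence n m ≤ H := by
  have key : ∀ S : Finset (Fin n), ∀ M ∈ SLCongruence n m, Supp S M → M ∈ H := by
    intro S
    induction S using Finset.induction_on with
    | empty =>
      intro M _ hS
      have : M = 1 := by
        apply Subtype.ext
        ext p q
        exact (hS p (by simp) q).1
      rw [this]
      exact one_mem _
    | insert i S hi ih =>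
      intro M hM hS
      refine stepB hn hH hm (insert i S) i (by simp) ?_ _ M hM hS rfl
      rw [Finset.erase_insert hi]
      exact ih
  exact fun M hM => key Finset.univ M hM (fun l hl => (hl (Finset.mem_univ l)).elim)

/-- The commutator of congruence subgroups. -/
theorem comm_eq (hn : 3 ≤ n) (q k : ℕ) (hq : 3 ≤ q) (hk : 1 ≤ k) :
    ⁅SLCongruence n (q ^ k), SLCongruence n q⁆ = SLCongruence n (q ^ (k + 1)) := by
  apply le_antisymm
  · rw [Subgroup.commutator_le]
    intro x hx y hy
    rw [mem_congr_iff] at hx hy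
    have e : ∀ (r : ℕ) (x : Matrix.SpecialLinearGroup (Fin n) ℤ),
        (∀ i j, (r : ℤ) ∣ x.1 i j - (1 : Matrix _ _ ℤ) i j) →
        ∃ X : Matrix (Fin n) (Fin n) ℤ, x.1 = 1 + (r : ℤ) • X := by
      intro r x hx
      choose X hX using hx
      refine ⟨Matrix.of X, ?_⟩
      ext i j
      simp only [Matrix.add_apply, Matrix.smul_apply, Matrix.of_apply, smul_eq_mul]
      linarith [hX i j]
    obtain ⟨X, hX⟩ := e _ _ hx
    obtain ⟨Y, hY⟩ := e _ _ hy
    have h1 : (x * y * x⁻¹ * y⁻¹).1 - 1 = ((q ^ (k + 1) : ℕ) : ℤ) • ((X * Y - Y * X) * (x⁻¹ * y⁻¹).1) := by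
      have h2 : (x * y).1 - (y * x).1 = ((q ^ (k + 1) : ℕ) : ℤ) • (X * Y - Y * X) := by
        rw [coe_mul1, coe_mul1, hX, hY]
        simp only [add_mul, mul_add, one_mul, mul_one, Matrix.smul_mul, Matrix.mul_smul, smul_sub,
          smul_smul, Nat.cast_pow]
        rw [pow_succ, mul_comm (q : ℤ)]
        abel
      have h3 : (x * y * x⁻¹ * y⁻¹).1 = (x * y).1 * (x⁻¹ * y⁻¹).1 := by
        rw [← coe_mul1, mul_assoc (x * y)]
      have h4 : (y * x).1 * (x⁻¹ * y⁻¹).1 = 1 := by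
        rw [← coe_mul1]
        have : y * x * (x⁻¹ * y⁻¹) = 1 := by group
        rw [this]
        rfl
      rw [← Matrix.smul_mul, ← h2, sub_mul, h4, h3]
    rw [commutatorElement_def, mem_congr_iff]
    intro i j
    rw [← Matrix.sub_apply, h1]
    exact Dvd.intro _ rfl
  · have : ⁅SLCongruence n (q ^ k), SLCongruence n q⁆.Normal := inferInstance
    apply red hn
    · intro i j hij t ht
      obtain ⟨s, rfl⟩ := ht
      obtain ⟨l, hl⟩ : ∃ k, k ∉ ({i, j} : Finset (Fin n)) := by
        by_contra hcon
        push Not at hcon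
        have : Finset.univ ⊆ ({i, j} : Finset (Fin n)) := fun x _ => hcon x
        have h1 := Finset.card_le_card this
        have h2 := Finset.card_le_two (a := i) (b := j)
        rw [Finset.card_univ, Fintype.card_fin] at h1
        omega
      have hli : i ≠ l := by intro h; simp [h] at hl
      have hlj : l ≠ j := by intro h; simp [h] at hl
      have h1 := congr_HE (n := n) (q ^ k) i l hli ((q ^ k : ℕ) * s) (Dvd.intro _ rfl)
      have h2 := congr_HE (n := n) q l j hlj q dvd_rfl
      have h3 := Subgroup.commutator_mem_commutator h1 h2
      convert h3 using 1
      rw [commutatorElement_def, eq_mul_inv_iff_mul_eq, eq_mul_inv_iff_mul_eq]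
      apply Subtype.ext
      ext a b
      rw [mul_tv, mul_tv, mul_tv, mul_tv, tv_coe, tv_coe]
      simp only [Matrix.add_apply, single_apply, one_apply]
      have hji := hij.symm
      have hil := hli.symm
      have hjl := hlj.symm
      by_cases ha : i = a
      · subst ha
        by_cases hb : j = b
        · subst hb; simp [*]; ring
        · have hb' : ¬ b = j := fun h => hb h.symm
          by_cases hbl : b = l
          · subst hbl; simp [*]
          · have hbl' : ¬ l = b := fun h => hbl h.symm
            simp [*]
      · have ha' : ¬ a = i := fun h => ha h.symm
        by_cases hb : j = b
        · subst hb; simp [*]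
        · have hb' : ¬ b = j := fun h => hb h.symm
          by_cases hbl : b = l
          · subst hbl; simp [*]
          · have hbl' : ¬ l = b := fun h => hbl h.symm
            simp [*]
    · calc 3 ≤ q := hq
        _ = q ^ 1 := (pow_one q).symm
        _ ≤ q ^ (k + 1) := Nat.pow_le_pow_right (by omega) (by omega)

theorem lcs_eq (hn : 3 ≤ n) (q : ℕ) (hq : 3 ≤ q) (k : ℕ) :
    (Subgroup.lowerCentralSeries (⊤ : Subgroup (SLCongruence n q)) k).map (SLCongruence n q).subtype
      = SLCongruence n (q ^ (k + 1)) := by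
  induction k with
  | zero =>
    rw [Subgroup.lowerCentralSeries_zero, ← MonoidHom.range_eq_map, Subgroup.range_subtype, zero_add, pow_one]
  | succ k ih =>
    rw [Subgroup.lowerCentralSeries_succ, Subgroup.map_commutator, ih,
      ← MonoidHom.range_eq_map, Subgroup.range_subtype, comm_eq hn q _ hq (by omega)]

end Red

end CongrSL

namespace CongrSL

open Matrix

section Fin

variable {n : ℕ}

theorem exists_B {r : ℕ} {A : Matrix.SpecialLinearGroup (Fin n) ℤ} (hA : A ∈ SLCongruence n r) :
    ∃ B : Matrix (Fin n) (Fin n) ℤ, A.1 = 1 + (r : ℤ) • B := by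
  rw [mem_congr_iff] at hA
  choose X hX using hA
  refine ⟨Matrix.of X, ?_⟩
  ext i j
  simp only [Matrix.add_apply, Matrix.smul_apply, Matrix.of_apply, smul_eq_mul]
  linarith [hX i j]

theorem mem_of_B {r : ℕ} {A : Matrix.SpecialLinearGroup (Fin n) ℤ}
    {B : Matrix (Fin n) (Fin n) ℤ} (h : A.1 = 1 + (r : ℤ) • B) : A ∈ SLCongruence n r := by
  rw [mem_congr_iff]
  intro i j
  rw [h, Matrix.add_apply, add_sub_cancel_left]
  exact Dvd.intro _ rfl

theorem unique_B {r : ℕ} (hr : r ≠ 0) {B B' : Matrix (Fin n) (Fin n) ℤ}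
    (h : 1 + (r : ℤ) • B = 1 + (r : ℤ) • B') : B = B' := by
  have h1 := add_left_cancel h
  ext i j
  have h2 := congrFun (congrFun h1 i) j
  simp only [Matrix.smul_apply, smul_eq_mul] at h2
  exact mul_left_cancel₀ (by exact_mod_cast hr) h2

/-- the matrix `B` with `A = 1 + r B` -/
noncomputable def Bof {r : ℕ} (A : SLCongruence n r) : Matrix (Fin n) (Fin n) ℤ :=
  (exists_B A.2).choose

theorem Bof_spec {r : ℕ} (A : SLCongruence n r) : A.1.1 = 1 + (r : ℤ) • Bof A :=
  (exists_B A.2).choose_spec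

theorem trace_B {q r : ℕ} (hr : r ≠ 0) (hqr : q ∣ r) {A : Matrix.SpecialLinearGroup (Fin n) ℤ}
    {B : Matrix (Fin n) (Fin n) ℤ} (h : A.1 = 1 + (r : ℤ) • B) :
    (B.map (Int.cast : ℤ → ZMod q)).trace = 0 := by
  have h1 := A.2
  rw [h, Matrix.det_one_add_smul] at h1
  generalize (Polynomial.eval (r : ℤ) _) = c at h1
  have h2 : (r : ℤ) * (B.trace + c * r) = 0 := by linarith
  have h3 : B.trace + c * r = 0 := (mul_eq_zero.1 h2).resolve_left (by exact_mod_cast hr)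
  have h4 : ((B.trace : ℤ) : ZMod q) = 0 := by
    rw [ZMod.intCast_zmod_eq_zero_iff_dvd]
    have : B.trace = - (c * r) := by linarith
    rw [this]
    exact ((Int.natCast_dvd_natCast.2 hqr).mul_left c).neg_right
  rw [← h4, Matrix.trace, Matrix.trace]
  simp

theorem map_add' {q : ℕ} (B B' : Matrix (Fin n) (Fin n) ℤ) :
    (B + B').map (Int.cast : ℤ → ZMod q) = B.map Int.cast + B'.map Int.cast := by
  ext i j; simp

theorem B_mul {q r : ℕ} (hqr : q ∣ r) {A A' : Matrix.SpecialLinearGroup (Fin n) ℤ}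
    {B B' : Matrix (Fin n) (Fin n) ℤ} (h : A.1 = 1 + (r : ℤ) • B) (h' : A'.1 = 1 + (r : ℤ) • B') :
    ∃ C, (A * A').1 = 1 + (r : ℤ) • C ∧
      C.map (Int.cast : ℤ → ZMod q) = B.map Int.cast + B'.map Int.cast := by
  refine ⟨B + B' + (r : ℤ) • (B * B'), ?_, ?_⟩
  · rw [coe_mul1, h, h']
    simp only [add_mul, mul_add, one_mul, mul_one, Matrix.smul_mul, Matrix.mul_smul, smul_add]
    abel
  · rw [map_add', map_add']
    have : (((r : ℤ) • (B * B')).map (Int.cast : ℤ → ZMod q)) = 0 := by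
      ext i j
      simp only [Matrix.map_apply, Matrix.smul_apply, smul_eq_mul, Matrix.zero_apply]
      rw [ZMod.intCast_zmod_eq_zero_iff_dvd]
      exact (Int.natCast_dvd_natCast.2 hqr).mul_right _
    rw [this, add_zero]

/-- the reduction homomorphism -/
noncomputable def phi (n q r : ℕ) (hr : r ≠ 0) (hqr : q ∣ r) :
    SLCongruence n r →* Multiplicative (traceZeroMatrices n q) where
  toFun A := Multiplicative.ofAdd ⟨(Bof A).map (Int.cast : ℤ → ZMod q),
    trace_B hr hqr (Bof_spec A)⟩
  map_one' := by
    have : Bof (1 : SLCongruence n r) = 0 := by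
      apply unique_B hr
      rw [← Bof_spec]
      simp
    apply Multiplicative.toAdd.injective
    apply Subtype.ext
    change (Bof (1 : SLCongruence n r)).map (Int.cast : ℤ → ZMod q) = 0
    rw [this]
    ext i j
    simp
  map_mul' A A' := by
    obtain ⟨C, h1, h2⟩ := B_mul hqr (Bof_spec A) (Bof_spec A')
    have : Bof (A * A') = C := by
      apply unique_B hr
      rw [← Bof_spec, ← h1]
      rfl
    apply Multiplicative.toAdd.injective
    apply Subtype.ext
    change (Bof (A * A')).map (Int.cast : ℤ → ZMod q) =
      (Bof A).map (Int.cast : ℤ → ZMod q) + (Bof A').map (Int.cast : ℤ → ZMod q)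
    rw [this, h2]

theorem phi_eq {q r : ℕ} (hr : r ≠ 0) (hqr : q ∣ r) (A : SLCongruence n r)
    (B : Matrix (Fin n) (Fin n) ℤ) (h : A.1.1 = 1 + (r : ℤ) • B) :
    ((Multiplicative.toAdd (phi n q r hr hqr A) : traceZeroMatrices n q) :
      Matrix (Fin n) (Fin n) (ZMod q)) = B.map (Int.cast : ℤ → ZMod q) := by
  have : Bof A = B := by
    apply unique_B hr
    rw [← Bof_spec, ← h]
  rw [← this]
  rfl

theorem phi_ker {q r : ℕ} (hr : r ≠ 0) (hqr : q ∣ r) (A : SLCongruence n r) :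
    phi n q r hr hqr A = 1 ↔ A.1 ∈ SLCongruence n (r * q) := by
  have e : phi n q r hr hqr A = 1 ↔ (Bof A).map (Int.cast : ℤ → ZMod q) = 0 := by
    rw [← phi_eq hr hqr A _ (Bof_spec A)]
    rw [← Multiplicative.toAdd.injective.eq_iff]
    exact Subtype.ext_iff
  rw [e, mem_congr_iff, ← Matrix.ext_iff]
  apply forall_congr'; intro i
  apply forall_congr'; intro j
  rw [Bof_spec, Matrix.add_apply, add_sub_cancel_left, Matrix.smul_apply, smul_eq_mul,
    Matrix.map_apply, Matrix.zero_apply, ZMod.intCast_zmod_eq_zero_iff_dvd, Nat.cast_mul,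
    mul_dvd_mul_iff_left (by exact_mod_cast hr)]

/-- The matrices over `ℤ/q` in the image of reduction. -/
def img (n q r : ℕ) (hqr : q ∣ r) : AddSubmonoid (Matrix (Fin n) (Fin n) (ZMod q)) where
  carrier := {M | ∃ (A : Matrix.SpecialLinearGroup (Fin n) ℤ) (B : Matrix (Fin n) (Fin n) ℤ),
    A.1 = 1 + (r : ℤ) • B ∧ B.map (Int.cast : ℤ → ZMod q) = M}
  zero_mem' := ⟨1, 0, by rw [smul_zero, add_zero]; rfl, by ext i j; simp⟩
  add_mem' := by
    rintro _ _ ⟨A, B, h, rfl⟩ ⟨A', B', h', rfl⟩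
    obtain ⟨C, h1, h2⟩ := B_mul hqr h h'
    exact ⟨A * A', C, h1, h2⟩

theorem img_R1 {q r : ℕ} (hqr : q ∣ r) (v w : Fin n → ℤ) (h : w ⬝ᵥ v = 0) :
    (vecMulVec v w).map (Int.cast : ℤ → ZMod q) ∈ img n q r hqr := by
  refine ⟨R1 ((r : ℤ) • v) w (by rw [dotProduct_smul, h, smul_zero]), vecMulVec v w, ?_, rfl⟩
  rw [R1_coe, smul_vecMulVec]

theorem img_single {q r : ℕ} (hqr : q ∣ r) {i j : Fin n} (hij : i ≠ j) (x : ZMod q) :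
    single i j x ∈ img n q r hqr := by
  obtain ⟨y, rfl⟩ := ZMod.intCast_surjective x
  convert img_R1 hqr (Pi.single i 1) (Pi.single j y) (by simp [hij]) using 1
  ext a b
  rw [Matrix.map_apply, vecMulVec_apply, single_apply]
  by_cases ha : i = a <;> by_cases hb : j = b
  · subst ha; subst hb; simp
  · subst ha; simp [hb, Pi.single_apply, Ne.symm hb]
  · subst hb; simp [ha, Pi.single_apply, Ne.symm ha]
  · simp [ha, Pi.single_apply, Ne.symm ha]

theorem img_diag {q r : ℕ} (hqr : q ∣ r) {i j : Fin n} (hij : i ≠ j) (x : ZMod q) :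
    single i i x - single j j x ∈ img n q r hqr := by
  obtain ⟨y, hy⟩ := ZMod.intCast_surjective x
  have h1 := img_R1 (q := q) hqr (Pi.single i 1 + Pi.single j 1) (Pi.single i y - Pi.single j y) (by
    simp [dotProduct_add, sub_dotProduct, hij, hij.symm])
  have h2 := img_single hqr hij x
  have h3 := img_single hqr hij.symm (-x)
  convert add_mem (add_mem h1 h2) h3 using 1
  have : (vecMulVec (Pi.single i 1 + Pi.single j 1) (Pi.single i y - Pi.single j y)).map
      (Int.cast : ℤ → ZMod q) = single i i x - single i j x + single j i x - single j j x := by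
    subst hy
    ext a b
    simp only [Matrix.map_apply, vecMulVec_apply, single_apply, Matrix.sub_apply,
      Matrix.add_apply, Pi.add_apply, Pi.sub_apply, Pi.single_apply]
    have hji := hij.symm
    by_cases ha : a = i
    · subst ha
      by_cases hb : b = a
      · subst hb; simp [*]
      · by_cases hb2 : b = j
        · subst hb2; simp [*]
        · simp [*, Ne.symm hb, Ne.symm hb2]
    · by_cases ha2 : a = j
      · subst ha2
        by_cases hb : b = i
        · subst hb; simp [*]
        · by_cases hb2 : b = a
          · subst hb2; simp [*]
          · simp [*, Ne.symm hb, Ne.symm hb2]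
      · simp [*, Ne.symm ha, Ne.symm ha2]
  rw [this, ← neg_one_mul x]
  have h4 : single j i (-1 * x) = - single j i x := by
    ext a b; simp [single_apply]; split_ifs <;> simp
  rw [h4]
  abel

theorem img_all {q r : ℕ} (hn : 3 ≤ n) (hqr : q ∣ r) (M : Matrix (Fin n) (Fin n) (ZMod q))
    (hM : M.trace = 0) : M ∈ img n q r hqr := by
  have : NeZero n := ⟨by omega⟩
  have key : M = ∑ i, ∑ j, (single i j (M i j) - if i = j then single 0 0 (M i i) else 0) := by
    have h1 : ∑ i : Fin n, ∑ j : Fin n, (if i = j then single (0 : Fin n) (0 : Fin n) (M i i) else 0)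
        = 0 := by
      have : ∀ i : Fin n, ∑ j : Fin n, (if i = j then single (0 : Fin n) (0 : Fin n) (M i i) else 0)
        = single 0 0 (M i i) := by intro i; simp
      simp only [this]
      have h := map_sum (Matrix.singleAddMonoidHom (0 : Fin n) (0 : Fin n) (α := ZMod q))
        (fun i => M i i) Finset.univ
      have h' : ∑ i, M i i = 0 := hM
      rw [h', map_zero] at h
      exact h.symm
    simp only [Finset.sum_sub_distrib]
    rw [h1, sub_zero]
    exact Matrix.matrix_eq_sum_single M
  rw [key]
  apply sum_mem
  intro i _
  apply sum_mem
  intro j _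
  by_cases hij : i = j
  · subst hij
    rw [if_pos rfl]
    by_cases h0 : i = 0
    · subst h0
      rw [sub_self]
      exact zero_mem _
    · exact img_diag hqr h0 _
  · rw [if_neg hij, sub_zero]
    exact img_single hqr hij _

theorem phi_surj {q r : ℕ} (hn : 3 ≤ n) (hr : r ≠ 0) (hqr : q ∣ r) :
    Function.Surjective (phi n q r hr hqr) := by
  intro M
  obtain ⟨A, B, h1, h2⟩ := img_all (r := r) hn hqr (Multiplicative.toAdd M).1 (Multiplicative.toAdd M).2
  refine ⟨⟨A, mem_of_B h1⟩, ?_⟩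
  apply Multiplicative.toAdd.injective
  apply Subtype.ext
  rw [phi_eq hr hqr ⟨A, mem_of_B h1⟩ B h1, h2]

theorem mem_lcs (hn : 3 ≤ n) (q : ℕ) (hq : 3 ≤ q) (k : ℕ) (A : SLCongruence n q) :
    A ∈ Subgroup.lowerCentralSeries (⊤ : Subgroup (SLCongruence n q)) k ↔
      A.1 ∈ SLCongruence n (q ^ (k + 1)) := by
  rw [← lcs_eq hn q hq k]
  exact (Subgroup.mem_map_iff_mem (SLCongruence n q).subtype_injective).symm

end Fin

end CongrSL

/-- For `n ≥ 5`, `q ≥ 3`, `k ≥ 1`: every `A ∈ Γ_k(SL_n(qℤ))` can be written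
`A = 1 + q^k·B` with `B` an integer matrix, and `A ↦ (B mod q)` induces an isomorphism
`Γ_k(SL_n(qℤ))/Γ_{k+1}(SL_n(qℤ)) ≅ 𝔰𝔩_n(ℤ/qℤ)` (the additive group of trace-zero
matrices mod `q`). -/
theorem lie_ring_of_congruence_group (n q k : ℕ) (hn : 5 ≤ n) (hq : 3 ≤ q) (hk : 1 ≤ k) :
    (∀ A : SLCongruence n q, A ∈ Subgroup.lowerCentralSeries (⊤ : Subgroup (SLCongruence n q)) (k - 1) →
      ∃ B : Matrix (Fin n) (Fin n) ℤ,
        ((A : Matrix.SpecialLinearGroup (Fin n) ℤ) : Matrix (Fin n) (Fin n) ℤ) =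
          1 + (q : ℤ) ^ k • B) ∧
    ∃ e : (Subgroup.lowerCentralSeries (⊤ : Subgroup (SLCongruence n q)) (k - 1) ⧸
            (Subgroup.lowerCentralSeries (⊤ : Subgroup (SLCongruence n q)) k).subgroupOf
              (Subgroup.lowerCentralSeries (⊤ : Subgroup (SLCongruence n q)) (k - 1))) ≃*
          Multiplicative (traceZeroMatrices n q),
      ∀ (A : SLCongruence n q) (hA : A ∈ Subgroup.lowerCentralSeries (⊤ : Subgroup (SLCongruence n q)) (k - 1))
        (B : Matrix (Fin n) (Fin n) ℤ),
        ((A : Matrix.SpecialLinearGroup (Fin n) ℤ) : Matrix (Fin n) (Fin n) ℤ) =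
            1 + (q : ℤ) ^ k • B →
        ((Multiplicative.toAdd (e (QuotientGroup.mk ⟨A, hA⟩)) :
            traceZeroMatrices n q) : Matrix (Fin n) (Fin n) (ZMod q)) =
          B.map (Int.cast : ℤ → ZMod q) := by
  obtain ⟨k, rfl⟩ : ∃ l, k = l + 1 := ⟨k - 1, by omega⟩
  simp only [Nat.add_sub_cancel]
  have hn3 : 3 ≤ n := by omega
  have hr : q ^ (k + 1) ≠ 0 := pow_ne_zero _ (by omega)
  have hqr : q ∣ q ^ (k + 1) := dvd_pow_self q (by omega)
  have hml := CongrSL.mem_lcs hn3 q hq k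
  have hml' := CongrSL.mem_lcs hn3 q hq (k + 1)
  refine ⟨?_, ?_⟩
  · intro A hA
    obtain ⟨B, hB⟩ := CongrSL.exists_B ((hml A).1 hA)
    refine ⟨B, ?_⟩
    rw [Nat.cast_pow] at hB
    exact hB
  · have hle : ∀ A ∈ SLCongruence n (q ^ (k + 1)), A ∈ SLCongruence n q := by
      intro A hA
      rw [CongrSL.mem_congr_iff] at hA ⊢
      exact fun i j => (Int.natCast_dvd_natCast.2 hqr).trans (hA i j)
    let ι : Subgroup.lowerCentralSeries (⊤ : Subgroup (SLCongruence n q)) k →*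
        SLCongruence n (q ^ (k + 1)) :=
      { toFun := fun A => ⟨A.1.1, (hml A.1).1 A.2⟩
        map_one' := rfl
        map_mul' := fun _ _ => rfl }
    let ψ := (CongrSL.phi n q (q ^ (k + 1)) hr hqr).comp ι
    have hψ : Function.Surjective ψ := by
      intro M
      obtain ⟨A, hA⟩ := CongrSL.phi_surj hn3 hr hqr M
      exact ⟨⟨⟨A.1, hle _ A.2⟩, (hml ⟨A.1, hle _ A.2⟩).2 A.2⟩, hA⟩
    have hker : (Subgroup.lowerCentralSeries (⊤ : Subgroup (SLCongruence n q)) (k + 1)).subgroupOf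
        (Subgroup.lowerCentralSeries (⊤ : Subgroup (SLCongruence n q)) k) = ψ.ker := by
      ext A
      rw [Subgroup.mem_subgroupOf, MonoidHom.mem_ker, hml']
      exact (CongrSL.phi_ker hr hqr (ι A)).symm
    refine ⟨(QuotientGroup.quotientMulEquivOfEq hker).trans
      (QuotientGroup.quotientKerEquivOfSurjective ψ hψ), ?_⟩
    intro A hA B hB
    refine CongrSL.phi_eq hr hqr (ι ⟨A, hA⟩) B ?_
    rw [Nat.cast_pow]
    exact hB
end

section
/- (Dimension property of free groups) Let F be a free group (on an arbitrary set of generators), ℤF its integral group ring and I its augmentation ideal. Then for every k ≥ 1 and every g ∈ F, one has g − 1 ∈ I^k if and only if g ∈ Γ_k(F). In other words, the dimension subgroups D_k(F) = F ∩ (1 + I^k) coincide with the terms of the lower central series of F. -/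
/-- The augmentation ideal `I = ker ε` of the integral group ring `ℤG`, as a
`ℤ`-submodule of `MonoidAlgebra ℤ G` (so that its powers `I^k` make sense for a
possibly noncommutative group ring). -/
noncomputable def augIdeal (G : Type*) [Group G] : Submodule ℤ (MonoidAlgebra ℤ G) :=
  LinearMap.ker (MonoidAlgebra.lift ℤ ℤ G 1).toLinearMap

namespace DimProp

open PowerSeries
open scoped commutatorElement

/-- Three subgroups lemma modulo a normal subgroup. -/
lemma three_subgroups {G : Type*} [Group G] (A B C N : Subgroup G) [N.Normal]
    (h1 : ⁅⁅B, C⁆, A⁆ ≤ N) (h2 : ⁅⁅C, A⁆, B⁆ ≤ N) : ⁅⁅A, B⁆, C⁆ ≤ N := by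
  have key : ∀ H : Subgroup G, H ≤ N ↔ H.map (QuotientGroup.mk' N) = ⊥ := by
    intro H
    rw [Subgroup.map_eq_bot_iff, QuotientGroup.ker_mk']
  rw [key] at h1 h2 ⊢
  simp only [Subgroup.map_commutator] at h1 h2 ⊢
  exact Subgroup.commutator_commutator_eq_bot_of_rotate h1 h2

/-- `[Γ_{p+1}, Γ_{q+1}] ≤ Γ_{p+q+2}`. -/
lemma lcs_comm {G : Type*} [Group G] (p q : ℕ) :
    ⁅(⊤ : Subgroup G).lowerCentralSeries p, (⊤ : Subgroup G).lowerCentralSeries q⁆ ≤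
      (⊤ : Subgroup G).lowerCentralSeries (p + q + 1) := by
  induction q generalizing p with
  | zero => exact le_of_eq rfl
  | succ q ih =>
    rw [Subgroup.commutator_comm]
    change ⁅⁅_, _⁆, _⁆ ≤ _
    apply three_subgroups
    · rw [Subgroup.commutator_comm ⊤]
      have := ih (p + 1)
      rwa [show p + 1 + q + 1 = p + (q + 1) + 1 by ring] at this
    · exact Subgroup.commutator_mono (ih p) le_rfl

lemma comm_mem_lcs {G : Type*} [Group G] {p q : ℕ} (hp : 1 ≤ p) (hq : 1 ≤ q) {g h : G}
    (hg : g ∈ (⊤ : Subgroup G).lowerCentralSeries (p - 1))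
    (hh : h ∈ (⊤ : Subgroup G).lowerCentralSeries (q - 1)) :
    ⁅g, h⁆ ∈ (⊤ : Subgroup G).lowerCentralSeries (p + q - 1) := by
  have := lcs_comm _ _ (Subgroup.commutator_mem_commutator hg hh)
  rwa [show p - 1 + (q - 1) + 1 = p + q - 1 by omega] at this

section Easy

variable {G : Type*} [Group G]

lemma of_sub_one_mem (g : G) : MonoidAlgebra.of ℤ G g - 1 ∈ augIdeal G := by
  simp [augIdeal]

lemma augIdeal_mul_top : augIdeal G * ⊤ ≤ augIdeal G := by
  rw [Submodule.mul_le]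
  intro a ha b _
  simp only [augIdeal, LinearMap.mem_ker, AlgHom.toLinearMap_apply] at ha ⊢
  rw [map_mul, ha, zero_mul]

lemma pow_mul_top (k : ℕ) (hk : 1 ≤ k) : augIdeal G ^ k * ⊤ ≤ augIdeal G ^ k := by
  obtain ⟨k, rfl⟩ : ∃ j, k = j + 1 := ⟨k - 1, by omega⟩
  rw [pow_succ, mul_assoc]
  exact mul_le_mul_right augIdeal_mul_top _

lemma lcs_le_dim (k : ℕ) (g : G) (hg : g ∈ (⊤ : Subgroup G).lowerCentralSeries k) :
    MonoidAlgebra.of ℤ G g - 1 ∈ augIdeal G ^ (k + 1) := by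
  induction k generalizing g with
  | zero => simpa using of_sub_one_mem g
  | succ k ih =>
    have hR : ∀ a ∈ augIdeal G ^ (k + 1 + 1), ∀ b, a * b ∈ augIdeal G ^ (k + 1 + 1) :=
      fun a ha b => pow_mul_top _ (by omega) (Submodule.mul_mem_mul ha Submodule.mem_top)
    change g ∈ ⁅_, _⁆ at hg
    rw [Subgroup.commutator_def] at hg
    induction hg using Subgroup.closure_induction with
    | mem x hx =>
      obtain ⟨a, ha, b, -, rfl⟩ := hx
      have e : MonoidAlgebra.of ℤ G ⁅a, b⁆ - 1 =
          ((MonoidAlgebra.of ℤ G a - 1) * (MonoidAlgebra.of ℤ G b - 1) -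
            (MonoidAlgebra.of ℤ G b - 1) * (MonoidAlgebra.of ℤ G a - 1)) *
            MonoidAlgebra.of ℤ G (a⁻¹ * b⁻¹) := by
        have h2 : MonoidAlgebra.of ℤ G (b * a) * MonoidAlgebra.of ℤ G (a⁻¹ * b⁻¹) = 1 := by
          rw [← map_mul]; simp [MonoidAlgebra.one_def]
        have h1 : MonoidAlgebra.of ℤ G ⁅a, b⁆ =
          MonoidAlgebra.of ℤ G (a * b) * MonoidAlgebra.of ℤ G (a⁻¹ * b⁻¹) := by
          rw [← map_mul]; congr 1; simp [commutatorElement_def, mul_assoc]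
        rw [h1]
        nth_rw 1 [← h2]
        rw [← sub_mul]
        congr 1
        rw [map_mul, map_mul]
        noncomm_ring
      rw [e]
      apply hR
      apply Submodule.sub_mem
      · rw [pow_succ]; exact Submodule.mul_mem_mul (ih a ha) (of_sub_one_mem b)
      · rw [pow_succ']; exact Submodule.mul_mem_mul (of_sub_one_mem b) (ih a ha)
    | one => simp [MonoidAlgebra.one_def]
    | mul x y _ _ hx hy =>
      have : MonoidAlgebra.of ℤ G (x * y) - 1 =
        (MonoidAlgebra.of ℤ G x - 1) * MonoidAlgebra.of ℤ G y + (MonoidAlgebra.of ℤ G y - 1) := by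
        rw [map_mul]; noncomm_ring
      rw [this]
      exact Submodule.add_mem _ (hR _ hx _) hy
    | inv x _ hx =>
      have : MonoidAlgebra.of ℤ G x⁻¹ - 1 =
        -((MonoidAlgebra.of ℤ G x - 1) * MonoidAlgebra.of ℤ G x⁻¹) := by
        rw [sub_mul, ← map_mul]; simp [MonoidAlgebra.one_def]
      rw [this]
      exact Submodule.neg_mem _ (hR _ hx _)

end Easy

section Magnus

variable {α : Type*}

lemma geom_aux {A : Type*} [Ring A] (a : A) :
    (1 + C a * X : A⟦X⟧) * mk (fun n => (-a) ^ n) = 1 ∧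
      mk (fun n => (-a) ^ n) * (1 + C a * X : A⟦X⟧) = 1 := by
  constructor
  · ext n
    rw [add_mul, one_mul, mul_assoc, map_add, coeff_C_mul]
    cases n with
    | zero => simp
    | succ n => rw [coeff_succ_X_mul]; simp [coeff_one, pow_succ']
  · ext n
    rw [mul_add, mul_one, ← mul_assoc, map_add]
    cases n with
    | zero => simp
    | succ n => rw [coeff_succ_mul_X, coeff_mul_C]; simp [coeff_one, pow_succ]

/-- The unit `1 + a X`. -/
noncomputable def magUnit {A : Type*} [Ring A] (a : A) : (A⟦X⟧)ˣ where
  val := 1 + C a * X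
  inv := mk (fun n => (-a) ^ n)
  val_inv := (geom_aux a).1
  inv_val := (geom_aux a).2

/-- The Magnus expansion. -/
noncomputable def mag (α : Type*) : FreeGroup α →* ((FreeAlgebra ℤ α)⟦X⟧)ˣ :=
  FreeGroup.lift fun x => magUnit (FreeAlgebra.ι ℤ x)

/-- `mag g = 1 + s X^n + ⋯`. -/
def Rep (n : ℕ) (s : FreeAlgebra ℤ α) (g : FreeGroup α) : Prop :=
  ∃ a : (FreeAlgebra ℤ α)⟦X⟧, (mag α g : (FreeAlgebra ℤ α)⟦X⟧) = 1 + X ^ n * a ∧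
    constantCoeff a = s

lemma rep_of (x : α) : Rep 1 (FreeAlgebra.ι ℤ x) (FreeGroup.of x) := by
  refine ⟨C (FreeAlgebra.ι ℤ x), ?_, by simp⟩
  simp [mag, magUnit, X_mul]

lemma rep_one (n : ℕ) : Rep n (0 : FreeAlgebra ℤ α) 1 := ⟨0, by simp, by simp⟩

lemma Rep.mul {n : ℕ} (hn : 1 ≤ n) {s t : FreeAlgebra ℤ α} {g h : FreeGroup α}
    (hg : Rep n s g) (hh : Rep n t h) : Rep n (s + t) (g * h) := by
  obtain ⟨a, ha, rfl⟩ := hg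
  obtain ⟨b, hb, rfl⟩ := hh
  refine ⟨a + b + X ^ n * (a * b), ?_, ?_⟩
  · have : X ^ n * a * (X ^ n * b) = X ^ n * (X ^ n * (a * b)) := by
      rw [mul_assoc, ← mul_assoc a, ← X_pow_mul (φ := a), mul_assoc]
    rw [map_mul, Units.val_mul, ha, hb, mul_add, mul_add, add_mul, add_mul, mul_add, this]
    simp; abel
  · simp [show n ≠ 0 by omega]

lemma constCoeff_mag (g : FreeGroup α) :
    constantCoeff (mag α g : (FreeAlgebra ℤ α)⟦X⟧) = 1 := by
  have : ((Units.map (constantCoeff (R := FreeAlgebra ℤ α)).toMonoidHom).comp (mag α)) = 1 := by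
    ext x
    simp [mag, magUnit]
  have := congrArg Units.val (DFunLike.congr_fun this g)
  simpa using this

lemma Rep.inv {n : ℕ} {s : FreeAlgebra ℤ α} {g : FreeGroup α}
    (hg : Rep n s g) : Rep n (-s) g⁻¹ := by
  obtain ⟨a, ha, rfl⟩ := hg
  refine ⟨-(a * (mag α g⁻¹ : (FreeAlgebra ℤ α)⟦X⟧)), ?_, ?_⟩
  · have h : (mag α g : (FreeAlgebra ℤ α)⟦X⟧) * (mag α g⁻¹ : (FreeAlgebra ℤ α)⟦X⟧) = 1 := by
      simp
    have h2 : X ^ n * a = (mag α g : (FreeAlgebra ℤ α)⟦X⟧) - 1 := by rw [ha]; abel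
    rw [mul_neg, ← mul_assoc, h2, sub_mul, h, one_mul]
    abel
  · rw [map_neg, map_mul, constCoeff_mag, mul_one]

lemma Rep.comm {p q : ℕ} {s t : FreeAlgebra ℤ α} {g h : FreeGroup α}
    (hg : Rep p s g) (hh : Rep q t h) : Rep (p + q) (s * t - t * s) ⁅g, h⁆ := by
  obtain ⟨a, ha, rfl⟩ := hg
  obtain ⟨b, hb, rfl⟩ := hh
  refine ⟨(a * b - b * a) * (mag α (g⁻¹ * h⁻¹) : (FreeAlgebra ℤ α)⟦X⟧), ?_, ?_⟩
  · have h1 : (mag α ⁅g, h⁆ : (FreeAlgebra ℤ α)⟦X⟧) =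
        (mag α g : (FreeAlgebra ℤ α)⟦X⟧) * mag α h * mag α (g⁻¹ * h⁻¹) := by
      rw [← Units.val_mul, ← Units.val_mul, ← map_mul, ← map_mul]
      congr 2; simp [commutatorElement_def, mul_assoc]
    have h2 : (1 : (FreeAlgebra ℤ α)⟦X⟧) =
        (mag α h : (FreeAlgebra ℤ α)⟦X⟧) * mag α g * mag α (g⁻¹ * h⁻¹) := by
      rw [← Units.val_mul, ← Units.val_mul, ← map_mul, ← map_mul]
      simp
    have h3 : X ^ p * a * (X ^ q * b) = X ^ (p + q) * (a * b) := by
      rw [mul_assoc, ← mul_assoc a, ← X_pow_mul (φ := a), pow_add]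
      simp only [mul_assoc]
    have h4 : X ^ q * b * (X ^ p * a) = X ^ (p + q) * (b * a) := by
      rw [mul_assoc, ← mul_assoc b, ← X_pow_mul (φ := b), add_comm, pow_add]
      simp only [mul_assoc]
    rw [← mul_assoc, mul_sub, ← h3, ← h4, h1]
    refine Eq.trans ?_ (congrArg (· + _) h2.symm)
    rw [← add_mul, ha, hb]
    congr 1
    noncomm_ring
  · rw [map_mul, constCoeff_mag, mul_one]; simp

lemma Rep.lt {m n : ℕ} (h : m < n) {s : FreeAlgebra ℤ α} {g : FreeGroup α}
    (hg : Rep n s g) : Rep m 0 g := by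
  obtain ⟨a, ha, rfl⟩ := hg
  refine ⟨X ^ (n - m) * a, ?_, ?_⟩
  · rw [ha, ← mul_assoc, ← pow_add, Nat.add_sub_cancel' h.le]
  · simp [show n - m ≠ 0 by omega]

lemma Rep.unique {n : ℕ} {s t : FreeAlgebra ℤ α} {g : FreeGroup α}
    (hg : Rep n s g) (hh : Rep n t g) : s = t := by
  obtain ⟨a, ha, rfl⟩ := hg
  obtain ⟨b, hb, rfl⟩ := hh
  rw [ha] at hb
  rw [X_pow_mul_cancel (add_left_cancel hb)]

/-- The Magnus expansion on the group ring. -/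
noncomputable def magRing (α : Type*) :
    MonoidAlgebra ℤ (FreeGroup α) →ₐ[ℤ] (FreeAlgebra ℤ α)⟦X⟧ :=
  MonoidAlgebra.lift ℤ _ _ ((Units.coeHom _).comp (mag α))

lemma const_magRing (z : MonoidAlgebra ℤ (FreeGroup α)) :
    constantCoeff (magRing α z) =
      algebraMap ℤ (FreeAlgebra ℤ α) (MonoidAlgebra.lift ℤ ℤ (FreeGroup α) 1 z) := by
  induction z using MonoidAlgebra.induction_on with
  | of g =>
    simp [magRing, constCoeff_mag]
    exact one_smul ℤ _
  | add a b ha hb => simp only [map_add, ha, hb]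
  | smul r a ha => simp only [map_zsmul, ha]

lemma magRing_pow (k : ℕ) (z : MonoidAlgebra ℤ (FreeGroup α))
    (hz : z ∈ augIdeal (FreeGroup α) ^ k) : ∃ a, magRing α z = X ^ k * a := by
  induction k generalizing z with
  | zero => exact ⟨magRing α z, by simp⟩
  | succ k ih =>
    rw [pow_succ] at hz
    induction hz using Submodule.mul_induction_on' with
    | mem_mul_mem m hm n hn =>
      obtain ⟨a, ha⟩ := ih m hm
      have hc : constantCoeff (magRing α n) = 0 := by
        rw [const_magRing]
        have : MonoidAlgebra.lift ℤ ℤ (FreeGroup α) 1 n = 0 := hn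
        rw [this, map_zero]
      have hb := eq_X_mul_shift_add_const (magRing α n)
      rw [hc, map_zero, add_zero] at hb
      refine ⟨a * mk fun p => coeff (p + 1) (magRing α n), ?_⟩
      rw [map_mul, ha, hb, pow_succ]
      simp only [mul_assoc]
      rw [← mul_assoc a, ← X_mul (φ := a)]
      simp [mul_assoc]
    | add x _ y _ hx hy =>
      obtain ⟨a, ha⟩ := hx
      obtain ⟨b, hb⟩ := hy
      exact ⟨a + b, by rw [map_add, ha, hb, mul_add]⟩

lemma rep_of_mem {k : ℕ} {g : FreeGroup α}
    (h : MonoidAlgebra.of ℤ (FreeGroup α) g - 1 ∈ augIdeal (FreeGroup α) ^ k) :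
    ∃ s, Rep k s g := by
  obtain ⟨a, ha⟩ := magRing_pow k _ h
  refine ⟨_, a, ?_, rfl⟩
  rw [← ha]
  simp [magRing]
  exact (one_smul ℤ _).symm

end Magnus

section Elim

variable {ι : Type*}

/-- The derivation of the free algebra on `κ × ℕ` shifting the second index. -/
noncomputable def shiftHom (κ : Type*) : FreeAlgebra ℤ (κ × ℕ) →ₐ[ℤ]
    TrivSqZeroExt (FreeAlgebra ℤ (κ × ℕ)) (FreeAlgebra ℤ (κ × ℕ)) :=
  FreeAlgebra.lift ℤ fun i => TrivSqZeroExt.inl (FreeAlgebra.ι ℤ i) +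
    TrivSqZeroExt.inr (FreeAlgebra.ι ℤ (i.1, i.2 + 1))

lemma shiftHom_fst (κ : Type*) (b : FreeAlgebra ℤ (κ × ℕ)) : (shiftHom κ b).fst = b := by
  induction b using FreeAlgebra.induction with
  | grade0 r => rw [AlgHom.commutes]; simp
  | grade1 i => simp [shiftHom]
  | mul a b ha hb => rw [map_mul, TrivSqZeroExt.fst_mul, ha, hb]
  | add a b ha hb => rw [map_add, TrivSqZeroExt.fst_add, ha, hb]

/-- The shift derivation. -/
noncomputable def shiftD (κ : Type*) : FreeAlgebra ℤ (κ × ℕ) →ₗ[ℤ] FreeAlgebra ℤ (κ × ℕ) :=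
  (TrivSqZeroExt.sndHom (FreeAlgebra ℤ (κ × ℕ)) (FreeAlgebra ℤ (κ × ℕ))).toAddMonoidHom.toIntLinearMap.comp
    (shiftHom κ).toLinearMap

lemma shiftD_apply (κ : Type*) (b : FreeAlgebra ℤ (κ × ℕ)) : shiftD κ b = (shiftHom κ b).snd := rfl

lemma shiftD_mul (κ : Type*) (a b : FreeAlgebra ℤ (κ × ℕ)) :
    shiftD κ (a * b) = a * shiftD κ b + shiftD κ a * b := by
  simp [shiftD_apply, shiftHom_fst]

lemma shiftD_ι (κ : Type*) (i : κ × ℕ) :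
    shiftD κ (FreeAlgebra.ι ℤ i) = FreeAlgebra.ι ℤ (i.1, i.2 + 1) := by
  simp [shiftD_apply, shiftHom]

/-- Iterated brackets with `a`. -/
def adIter {A : Type*} [Ring A] (a b : A) : ℕ → A
  | 0 => b
  | j + 1 => a * adIter a b j - adIter a b j * a

lemma map_adIter {A B : Type*} [Ring A] [Ring B] (f : A →+* B) (a b : A) (j : ℕ) :
    f (adIter a b j) = adIter (f a) (f b) j := by
  induction j with
  | zero => rfl
  | succ j ih => simp [adIter, ih]

/-- Lazard elimination: the elements `ad(x)^j y`, `y ≠ x`, are free. -/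
lemma elim_free (x : ι) : Function.Injective (FreeAlgebra.lift ℤ
    (fun i : {y : ι // y ≠ x} × ℕ =>
      adIter (FreeAlgebra.ι ℤ x) (FreeAlgebra.ι ℤ i.1.1) i.2)) := by
  classical
  set κ := {y : ι // y ≠ x}
  set B := FreeAlgebra ℤ (κ × ℕ)
  let act : FreeAlgebra ℤ ι →ₐ[ℤ] Module.End ℤ B := FreeAlgebra.lift ℤ fun y =>
    if h : y = x then shiftD κ else LinearMap.mulLeft ℤ (FreeAlgebra.ι ℤ ((⟨y, h⟩, 0) : κ × ℕ))
  have hx : act (FreeAlgebra.ι ℤ x) = shiftD κ := by simp [act]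
  have hy : ∀ (y : κ) (j : ℕ), act (adIter (FreeAlgebra.ι ℤ x) (FreeAlgebra.ι ℤ y.1) j) =
      LinearMap.mulLeft ℤ (FreeAlgebra.ι ℤ ((y, j) : κ × ℕ)) := by
    intro y j
    induction j with
    | zero => simp [adIter, act, y.2]
    | succ j ih =>
      rw [adIter, map_sub, map_mul, map_mul, ih, hx]
      refine LinearMap.ext fun b => ?_
      have h := shiftD_mul κ (FreeAlgebra.ι ℤ (y, j)) b
      rw [shiftD_ι] at h
      exact sub_eq_of_eq_add (h.trans (add_comm _ _))
  have hcomp : act.comp (FreeAlgebra.lift ℤ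
    (fun i : {y : ι // y ≠ x} × ℕ =>
      adIter (FreeAlgebra.ι ℤ x) (FreeAlgebra.ι ℤ i.1.1) i.2)) = Algebra.lmul ℤ B := by
    apply FreeAlgebra.hom_ext
    funext i
    simp only [Function.comp_apply, AlgHom.comp_apply, FreeAlgebra.lift_ι_apply]
    exact hy i.1 i.2
  intro u v huv
  have h1 := DFunLike.congr_fun hcomp u
  have h2 := DFunLike.congr_fun hcomp v
  simp only [AlgHom.comp_apply] at h1 h2
  rw [huv, h2] at h1
  have h3 : v * 1 = u * 1 := DFunLike.congr_fun h1 (1 : B)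
  rw [mul_one, mul_one] at h3
  exact h3.symm

lemma elim_free' {A : Type*} [Ring A] (t : ι → A) (ht : Function.Injective (FreeAlgebra.lift ℤ t))
    (x : ι) : Function.Injective (FreeAlgebra.lift ℤ
      (fun i : {y : ι // y ≠ x} × ℕ => adIter (t x) (t i.1.1) i.2)) := by
  have : FreeAlgebra.lift ℤ (fun i : {y : ι // y ≠ x} × ℕ => adIter (t x) (t i.1.1) i.2) =
      (FreeAlgebra.lift ℤ t).comp (FreeAlgebra.lift ℤ
    (fun i : {y : ι // y ≠ x} × ℕ =>
      adIter (FreeAlgebra.ι ℤ x) (FreeAlgebra.ι ℤ i.1.1) i.2)) := by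
    apply FreeAlgebra.hom_ext
    funext i
    simp only [Function.comp_apply, AlgHom.comp_apply, FreeAlgebra.lift_ι_apply]
    have := map_adIter (FreeAlgebra.lift ℤ t).toRingHom (FreeAlgebra.ι ℤ x)
      (FreeAlgebra.ι ℤ i.1.1) i.2
    simpa using this.symm
  rw [this]
  exact ht.comp (elim_free x)

lemma indep {A : Type*} [Ring A] (t : ι → A) (ht : Function.Injective (FreeAlgebra.lift ℤ t))
    (x : ι) (e : ℤ) (s : A) (hs : s ∈ AddSubgroup.closure (t '' {y | y ≠ x}))
    (h : s + e • t x = 0) : e = 0 := by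
  classical
  have key : ∀ s ∈ AddSubgroup.closure (t '' {y | y ≠ x}), ∃ u : FreeAlgebra ℤ ι,
      FreeAlgebra.lift ℤ t u = s ∧
      FreeAlgebra.lift ℤ (fun i => if i = x then (1 : ℤ) else 0) u = 0 := by
    intro s hs
    induction hs using AddSubgroup.closure_induction with
    | mem s hs =>
      obtain ⟨y, hy, rfl⟩ := hs
      exact ⟨FreeAlgebra.ι ℤ y, by simp, by simpa using hy⟩
    | zero => exact ⟨0, by simp, by simp⟩
    | add a b _ _ ha hb =>
      obtain ⟨u, hu, hu'⟩ := ha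
      obtain ⟨v, hv, hv'⟩ := hb
      exact ⟨u + v, by rw [map_add, hu, hv], by rw [map_add, hu', hv', add_zero]⟩
    | neg a _ ha =>
      obtain ⟨u, hu, hu'⟩ := ha
      exact ⟨-u, by rw [map_neg, hu], by rw [map_neg, hu', neg_zero]⟩
  obtain ⟨u, hu, hu'⟩ := key s hs
  have h0 : u + e • FreeAlgebra.ι ℤ x = 0 := by
    apply ht
    rw [map_add, map_zsmul, hu, FreeAlgebra.lift_ι_apply, map_zero, h]
  have := congrArg (FreeAlgebra.lift ℤ (fun i => if i = x then (1 : ℤ) else 0)) h0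
  rw [map_add, map_zsmul, hu'] at this
  simpa using this

end Elim

section Main

/-- Iterated commutators with `a`. -/
def commIter {G : Type*} [Group G] (a b : G) : ℕ → G
  | 0 => b
  | j + 1 => ⁅a, commIter a b j⁆

lemma normalizes {G : Type*} [Group G] (N : Subgroup G) [N.Normal] {κ : Type*} (x : G) (c : κ → G)
    (J : κ → ℕ) (hJ : ∀ y j, J y ≤ j → commIter x (c y) j ∈ N) :
    ∀ h, h ∈ Subgroup.closure (Set.range fun i : κ × ℕ => commIter x (c i.1) i.2) ⊔ N ↔
      x * h * x⁻¹ ∈ Subgroup.closure (Set.range fun i : κ × ℕ => commIter x (c i.1) i.2) ⊔ N := by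
  set M := Subgroup.closure (Set.range fun i : κ × ℕ => commIter x (c i.1) i.2) ⊔ N with hM
  have hN : N ≤ M := le_sup_right
  have hc : ∀ y j, commIter x (c y) j ∈ M := fun y j =>
    (le_sup_left : _ ≤ M) (Subgroup.subset_closure ⟨(y, j), rfl⟩)
  have gen : ∀ z : G, (∀ y j, z * commIter x (c y) j * z⁻¹ ∈ M) → ∀ h ∈ M, z * h * z⁻¹ ∈ M := by
    intro z hz
    have : M ≤ M.comap (MulAut.conj z).toMonoidHom := by
      conv_lhs => rw [hM]
      refine sup_le ?_ ?_
      · rw [Subgroup.closure_le]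
        rintro _ ⟨i, rfl⟩
        exact hz i.1 i.2
      · intro n hn
        exact hN (Subgroup.Normal.conj_mem inferInstance n hn z)
    exact fun h hh => this hh
  have h1 := gen x (by
    intro y j
    have : x * commIter x (c y) j * x⁻¹ = commIter x (c y) (j + 1) * commIter x (c y) j := by
      simp [commIter, commutatorElement_def]
    rw [this]
    exact M.mul_mem (hc _ _) (hc _ _))
  have h2 := gen x⁻¹ (by
    intro y
    have : ∀ d j, J y ≤ j + d → x⁻¹ * commIter x (c y) j * x⁻¹⁻¹ ∈ M := by
      intro d
      induction d with
      | zero =>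
        intro j hj
        exact hN (Subgroup.Normal.conj_mem inferInstance _ (hJ y j hj) _)
      | succ d ih =>
        intro j hj
        have e : x⁻¹ * commIter x (c y) j * x⁻¹⁻¹ =
            (x⁻¹ * commIter x (c y) (j + 1) * x⁻¹⁻¹)⁻¹ * commIter x (c y) j := by
          simp [commIter, commutatorElement_def, mul_assoc]
        rw [e]
        exact M.mul_mem (M.inv_mem (ih (j + 1) (by omega))) (hc _ _)
    intro j
    exact this (J y) j (by omega))
  intro h
  refine ⟨h1 h, fun hh => ?_⟩
  have := h2 _ hh
  simpa [mul_assoc] using this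

lemma decomp {G : Type*} [Group G] (M : Subgroup G) (x : G) (hx : ∀ h, h ∈ M ↔ x * h * x⁻¹ ∈ M)
    (S : Set G) (hS : ∀ s ∈ S, s = x ∨ s ∈ M) (g : G) (hg : g ∈ Subgroup.closure S) :
    ∃ a ∈ M, ∃ e : ℤ, g = a * x ^ e := by
  have hn : ∀ e : ℤ, ∀ h ∈ M, x ^ e * h * (x ^ e)⁻¹ ∈ M := by
    intro e h hh
    have h1 : x ∈ Subgroup.normalizer (M : Set G) := Subgroup.mem_normalizer_iff.2 hx
    have h2 := Subgroup.zpow_mem _ h1 e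
    exact (Subgroup.mem_normalizer_iff.1 h2 h).1 hh
  induction hg using Subgroup.closure_induction with
  | mem s hs =>
    rcases hS s hs with rfl | h
    · exact ⟨1, M.one_mem, 1, by simp⟩
    · exact ⟨s, h, 0, by simp⟩
  | one => exact ⟨1, M.one_mem, 0, by simp⟩
  | mul u v _ _ hu hv =>
    obtain ⟨a, ha, e, rfl⟩ := hu
    obtain ⟨b, hb, f, rfl⟩ := hv
    exact ⟨a * (x ^ e * b * (x ^ e)⁻¹), M.mul_mem ha (hn e b hb), e + f, by
      rw [zpow_add]; group⟩
  | inv u _ hu =>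
    obtain ⟨a, ha, e, rfl⟩ := hu
    exact ⟨x ^ (-e) * a⁻¹ * (x ^ (-e))⁻¹, hn _ _ (M.inv_mem ha), -e, by group⟩

lemma Rep.zpow {α : Type*} {n : ℕ} (hn : 1 ≤ n) {s : FreeAlgebra ℤ α} {g : FreeGroup α}
    (hg : Rep n s g) (e : ℤ) : Rep n (e • s) (g ^ e) := by
  induction e with
  | zero => simpa using rep_one n
  | succ i ih => rw [add_smul, one_smul, zpow_add_one]; exact ih.mul hn hg
  | pred i ih => rw [sub_smul, one_smul, zpow_sub_one, sub_eq_add_neg]; exact ih.mul hn hg.inv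

lemma rep_closure {α : Type*} {n : ℕ} (hn : 1 ≤ n) (V : AddSubgroup (FreeAlgebra ℤ α))
    (S : Set (FreeGroup α)) (hS : ∀ g ∈ S, ∃ s ∈ V, Rep n s g) (g : FreeGroup α)
    (hg : g ∈ Subgroup.closure S) : ∃ s ∈ V, Rep n s g := by
  induction hg using Subgroup.closure_induction with
  | mem g hg => exact hS g hg
  | one => exact ⟨0, V.zero_mem, rep_one n⟩
  | mul a b _ _ ha hb =>
    obtain ⟨s, hs, hs'⟩ := ha
    obtain ⟨t, ht, ht'⟩ := hb
    exact ⟨s + t, V.add_mem hs ht, hs'.mul hn ht'⟩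
  | inv a _ ha =>
    obtain ⟨s, hs, hs'⟩ := ha
    exact ⟨-s, V.neg_mem hs, hs'.inv⟩

lemma sup_eq_closure {G : Type*} [Group G] (S : Set G) (N : Subgroup G) :
    Subgroup.closure S ⊔ N = Subgroup.closure (S ∪ N) := by
  rw [Subgroup.closure_union, Subgroup.closure_eq]

/-- The induction (Hall collection through Lazard elimination). -/
lemma main_induction {α : Type*} (k : ℕ) (d : ℕ) : ∀ (m : ℕ), 1 ≤ m → k ≤ m + d → ∀ (r : ℕ),
    ∀ (ι : Type _) (c : ι → FreeGroup α) (w : ι → ℕ) (t : ι → FreeAlgebra ℤ α),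
    (∀ i, m ≤ w i) → (∀ n, {i | w i ≤ n}.Finite) → {i | w i = m}.ncard = r →
    (∀ i, c i ∈ (⊤ : Subgroup (FreeGroup α)).lowerCentralSeries (w i - 1)) →
    (∀ i, Rep (w i) (t i) (c i)) → Function.Injective (FreeAlgebra.lift ℤ t) →
    ∀ g ∈ Subgroup.closure (Set.range c) ⊔
      (⊤ : Subgroup (FreeGroup α)).lowerCentralSeries (k - 1),
    (∃ s, Rep k s g) → g ∈ (⊤ : Subgroup (FreeGroup α)).lowerCentralSeries (k - 1) := by
  induction d with
  | zero =>
    intro m hm hk r ι c w t hw _ _ hΓ _ _ g hg _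
    refine (show _ ⊔ _ ≤ (⊤ : Subgroup (FreeGroup α)).lowerCentralSeries (k - 1) from
        sup_le ?_ le_rfl) hg
    rw [Subgroup.closure_le]
    rintro _ ⟨i, rfl⟩
    exact Subgroup.lowerCentralSeries_antitone _ (by have := hw i; omega) (hΓ i)
  | succ d ihd =>
    intro m hm hk r
    induction r with
    | zero =>
      intro ι c w t hw hfin hcard hΓ hR hfree
      have hem : {i | w i = m} = ∅ := by
        have hfm : {i | w i = m}.Finite := (hfin m).subset fun i (hi : w i = m) => hi.le
        rwa [Set.ncard_eq_zero hfm] at hcard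
      refine ihd (m + 1) (by omega) (by omega) _ ι c w t (fun i => ?_) hfin rfl hΓ hR hfree
      have h1 := hw i
      have h2 : w i ≠ m := fun h => by
        have : i ∈ {i | w i = m} := h
        rw [hem] at this
        exact this
      omega
    | succ r ihr =>
      intro ι c w t hw hfin hcard hΓ hR hfree g hg hrep
      by_cases hkm : k ≤ m
      · refine (show _ ⊔ _ ≤ (⊤ : Subgroup (FreeGroup α)).lowerCentralSeries (k - 1) from
        sup_le ?_ le_rfl) hg
        rw [Subgroup.closure_le]
        rintro _ ⟨i, rfl⟩
        exact Subgroup.lowerCentralSeries_antitone _ (by have := hw i; omega) (hΓ i)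
      push Not at hkm
      have hfm : {i | w i = m}.Finite := (hfin m).subset fun i (hi : w i = m) => hi.le
      obtain ⟨x, hx⟩ : {i | w i = m}.Nonempty := by
        apply Set.nonempty_of_ncard_ne_zero; omega
      change w x = m at hx
      let κ := {y : ι // y ≠ x}
      let c' : κ × ℕ → FreeGroup α := fun i => commIter (c x) (c i.1.1) i.2
      let w' : κ × ℕ → ℕ := fun i => w i.1.1 + i.2 * m
      let t' : κ × ℕ → FreeAlgebra ℤ α := fun i => adIter (t x) (t i.1.1) i.2
      have hw' : ∀ i, m ≤ w' i := fun i => (hw i.1.1).trans (Nat.le_add_right _ _)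
      have hΓ' : ∀ i, c' i ∈ (⊤ : Subgroup (FreeGroup α)).lowerCentralSeries (w' i - 1) := by
        rintro ⟨y, j⟩
        induction j with
        | zero => simpa [c', w', commIter] using hΓ y.1
        | succ j ih =>
          have h := comm_mem_lcs (hm.trans (hw x)) (hm.trans (hw' (y, j))) (hΓ x) ih
          have e : w x + w' (y, j) = w' (y, j + 1) := by simp only [w', hx]; ring
          rw [e] at h
          exact h
      have hR' : ∀ i, Rep (w' i) (t' i) (c' i) := by
        rintro ⟨y, j⟩
        induction j with
        | zero => simpa [c', w', t', adIter, commIter] using hR y.1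
        | succ j ih =>
          have h := (hR x).comm ih
          have e : w x + w' (y, j) = w' (y, j + 1) := by simp only [w', hx]; ring
          rw [e] at h
          exact h
      have hfree' : Function.Injective (FreeAlgebra.lift ℤ t') := elim_free' t hfree x
      have hfin' : ∀ n, {i | w' i ≤ n}.Finite := by
        intro n
        have h1 : ((fun y : κ => y.1) ⁻¹' {i | w i ≤ n}).Finite :=
          (hfin n).preimage Subtype.val_injective.injOn
        refine (h1.prod (Set.finite_Iic n)).subset ?_
        rintro ⟨y, j⟩ h
        change w y.1 + j * m ≤ n at h
        have : j * 1 ≤ j * m := Nat.mul_le_mul_left j hm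
        exact ⟨show w y.1 ≤ n by omega, show j ≤ n by omega⟩
      have hcard' : {i | w' i = m}.ncard = r := by
        have e : (fun i : κ × ℕ => i.1.1) '' {i | w' i = m} = {i | w i = m} \ {x} := by
          ext y
          constructor
          · rintro ⟨⟨y, j⟩, h, rfl⟩
            change w y.1 + j * m = m at h
            exact ⟨show w y.1 = m by have := hw y.1; omega, y.2⟩
          · rintro ⟨h, hy⟩
            exact ⟨(⟨y, hy⟩, 0), by simpa [w'] using h, rfl⟩
        have hj : ∀ i : κ × ℕ, w' i = m → i.2 = 0 := by
          rintro ⟨y, j⟩ h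
          change w y.1 + j * m = m at h
          have := hw y.1
          have h0 : j * m = 0 := by omega
          rcases Nat.mul_eq_zero.1 h0 with h | h
          · exact h
          · omega
        have hinj : Set.InjOn (fun i : κ × ℕ => i.1.1) {i | w' i = m} := by
          rintro i hi j hj' hij
          exact Prod.ext (Subtype.ext hij) ((hj i hi).trans (hj j hj').symm)
        have hx2 : x ∈ {i | w i = m} := hx
        rw [← Set.InjOn.ncard_image hinj, e, Set.ncard_sdiff_singleton_of_mem hx2, hcard]
        rfl
      refine ihr (κ × ℕ) c' w' t' hw' hfin' hcard' hΓ' hR' hfree' g ?_ hrep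
      have hnorm := normalizes ((⊤ : Subgroup (FreeGroup α)).lowerCentralSeries (k - 1)) (c x)
        (fun y : κ => c y.1) (fun _ => k) (by
          intro y j hj
          refine Subgroup.lowerCentralSeries_antitone _ ?_ (hΓ' (y, j))
          have : j * 1 ≤ j * m := Nat.mul_le_mul_left j hm
          change k - 1 ≤ w y.1 + j * m - 1
          omega)
      change ∀ h, h ∈ Subgroup.closure (Set.range c') ⊔ _ ↔
        _ ∈ Subgroup.closure (Set.range c') ⊔ _ at hnorm
      rw [sup_eq_closure] at hg
      obtain ⟨a, ha, e, rfl⟩ := decomp _ (c x) hnorm _ (by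
        rintro s (⟨y, rfl⟩ | hs)
        · by_cases hy : y = x
          · left; rw [hy]
          · right
            exact Subgroup.mem_sup_left (Subgroup.subset_closure ⟨(⟨y, hy⟩, 0), rfl⟩)
        · right
          exact Subgroup.mem_sup_right hs) g hg
      have ha' := ha
      rw [sup_eq_closure] at ha'
      obtain ⟨s, hs, hsa⟩ := rep_closure hm (AddSubgroup.closure (t '' {y | y ≠ x})) _ (by
        rintro _ (⟨⟨y, j⟩, rfl⟩ | hs)
        · rcases (hw' (y, j)).eq_or_lt with h | h
          · have hj : j = 0 := by
              have h1 : m = w y.1 + j * m := h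
              have := hw y.1
              have h0 : j * m = 0 := by omega
              rcases Nat.mul_eq_zero.1 h0 with h | h
              · exact h
              · omega
            subst hj
            refine ⟨t y.1, AddSubgroup.subset_closure ⟨y.1, y.2, rfl⟩, ?_⟩
            have := hR' (y, 0)
            rw [← h] at this
            exact this
          · exact ⟨0, AddSubgroup.zero_mem _, (hR' (y, j)).lt h⟩
        · obtain ⟨s, hs⟩ := rep_of_mem (lcs_le_dim _ _ hs)
          exact ⟨0, AddSubgroup.zero_mem _, hs.lt (by omega)⟩) a ha'
      have hx' := hR x
      rw [hx] at hx'
      have h1 := hsa.mul hm (hx'.zpow hm e)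
      obtain ⟨s', hs'⟩ := hrep
      have h2 := h1.unique (hs'.lt hkm)
      have he := indep t hfree x e s hs h2
      rw [he, zpow_zero, mul_one]
      exact ha

end Main

end DimProp

/-- **Dimension property of free groups.** For a free group `F`, every `k ≥ 1` and `g ∈ F`:
`g - 1 ∈ I^k` if and only if `g ∈ Γ_k(F)`; i.e. the dimension subgroups of `F` coincide with
the lower central series. -/
theorem freeGroup_dimension_property {α : Type*} (k : ℕ) (hk : 1 ≤ k) (g : FreeGroup α) :
    MonoidAlgebra.of ℤ (FreeGroup α) g - 1 ∈ (augIdeal (FreeGroup α)) ^ k ↔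
      g ∈ Subgroup.lowerCentralSeries (⊤ : Subgroup (FreeGroup α)) (k - 1) := by
  classical
  constructor
  · intro h
    have hsupp : ∀ g : FreeGroup α, ∃ S : Finset α, g ∈ Subgroup.closure
        (Set.range fun i : S => FreeGroup.of (i : α)) := by
      intro g
      induction g using FreeGroup.induction_on with
      | C1 => exact ⟨∅, Subgroup.one_mem _⟩
      | of x => exact ⟨{x}, Subgroup.subset_closure ⟨⟨x, by simp⟩, rfl⟩⟩
      | inv_of x _ =>
        exact ⟨{x}, Subgroup.inv_mem _ (Subgroup.subset_closure ⟨⟨x, by simp⟩, rfl⟩)⟩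
      | mul a b ha hb =>
        obtain ⟨S, hS⟩ := ha
        obtain ⟨T, hT⟩ := hb
        refine ⟨S ∪ T, Subgroup.mul_mem _ (Subgroup.closure_mono ?_ hS)
          (Subgroup.closure_mono ?_ hT)⟩
        · rintro _ ⟨i, rfl⟩
          exact ⟨⟨i, Finset.mem_union_left _ i.2⟩, rfl⟩
        · rintro _ ⟨i, rfl⟩
          exact ⟨⟨i, Finset.mem_union_right _ i.2⟩, rfl⟩
    obtain ⟨S, hS⟩ := hsupp g
    refine DimProp.main_induction k k 1 le_rfl (by omega) _ S (fun i => FreeGroup.of (i : α))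
      (fun _ => 1) (fun i => FreeAlgebra.ι ℤ (i : α)) (fun _ => le_rfl)
      (fun n => Set.toFinite _) rfl (fun i => by simp) (fun i => DimProp.rep_of _) ?_ g
      (Subgroup.mem_sup_left hS) (DimProp.rep_of_mem h)
    have hl : Function.LeftInverse
        (FreeAlgebra.lift ℤ (fun a : α => if h : a ∈ S then FreeAlgebra.ι ℤ (⟨a, h⟩ : S) else 0))
        (FreeAlgebra.lift ℤ (fun i : S => FreeAlgebra.ι ℤ (i : α))) := by
      intro u
      have : (FreeAlgebra.lift ℤ
          (fun a : α => if h : a ∈ S then FreeAlgebra.ι ℤ (⟨a, h⟩ : S) else 0)).comp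
        (FreeAlgebra.lift ℤ (fun i : S => FreeAlgebra.ι ℤ (i : α))) = AlgHom.id ℤ _ := by
        apply FreeAlgebra.hom_ext
        funext i
        simp
      exact DFunLike.congr_fun this u
    exact hl.injective
  · intro h
    have := DimProp.lcs_le_dim _ _ h
    rwa [Nat.sub_add_cancel hk] at this
end

section
/- (Bryant's criterion) Let n ≥ 1 and k ≥ 2 be integers, and let f be a ℤ-linear combination of monomials X_{i_1}·X_{i_2}·⋯·X_{i_k} of length exactly k in the free associative algebra ℤ⟨X_1, …, X_n⟩ (the free algebra over ℤ on n generators). Let E ⊆ M_k(ℤ) be the additive subgroup generated by the cyclic matrix units e_{1,2}, e_{2,3}, …, e_{k−1,k}, e_{k,1}. Suppose that for every family C_1, …, C_n of elements of E, the trace of f(C_1, …, C_n) (the image of f under the algebra homomorphism sending X_i to C_i) is zero. Then f lies in the additive subgroup of the free algebra generated by all commutators u·v − v·u. -/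
namespace BryantAux

open Finset
open scoped Fin.CommRing

/-- The monomial of a word. -/
noncomputable def mono {n k : ℕ} (w : Fin k → Fin n) : FreeAlgebra ℤ (Fin n) :=
  (List.ofFn fun i => FreeAlgebra.ι ℤ (w i)).prod

/-- The matrix family attached to a word. -/
def mat {n m : ℕ} (v : Fin (m + 1) → Fin n) (i : Fin n) :
    Matrix (Fin (m + 1)) (Fin (m + 1)) ℤ :=
  fun a b => if b = a + 1 ∧ i = v a then 1 else 0

/-- The subgroup generated by commutators. -/
def comm (n : ℕ) : AddSubgroup (FreeAlgebra ℤ (Fin n)) :=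
  AddSubgroup.closure
      {x : FreeAlgebra ℤ (Fin n) | ∃ u v : FreeAlgebra ℤ (Fin n), x = u * v - v * u}

lemma mat_mem {n m : ℕ} (v : Fin (m + 1) → Fin n) (i : Fin n) :
    mat v i ∈ AddSubgroup.closure
          {M : Matrix (Fin (m + 1)) (Fin (m + 1)) ℤ |
            ∃ a : Fin (m + 1), M = Matrix.single a (finRotate (m + 1) a) 1} := by
  have : mat v i = ∑ a : Fin (m + 1),
      if i = v a then Matrix.single a (finRotate (m + 1) a) (1 : ℤ) else 0 := by
    ext a b
    rw [Matrix.sum_apply, Finset.sum_eq_single a]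
    · by_cases h : i = v a <;> by_cases h' : b = a + 1 <;>
        simp [mat, h, h', Matrix.single_apply, finRotate_apply, eq_comm]
    · intro c _ hc
      split_ifs
      · simp [Matrix.single_apply, hc]
      · rfl
    · simp
  rw [this]
  refine AddSubgroup.sum_mem _ fun a _ => ?_
  split_ifs
  · exact AddSubgroup.subset_closure ⟨a, rfl⟩
  · exact AddSubgroup.zero_mem _

lemma prod_apply {n m : ℕ} (v : Fin (m + 1) → Fin n) (l : List (Fin n)) :
    ∀ a c : Fin (m + 1), (l.map (mat v)).prod a c =
      if c = a + ((l.length : ℕ) : Fin (m + 1)) ∧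
        ∀ (j : ℕ) (h : j < l.length), l[j] = v (a + (j : Fin (m + 1))) then 1 else 0 := by
  induction l with
  | nil => intro a c; simp [Matrix.one_apply, eq_comm]
  | cons i l ih =>
    intro a c
    rw [List.map_cons, List.prod_cons, Matrix.mul_apply, Finset.sum_eq_single (a + 1)]
    · rw [ih]
      have key : (c = a + (((i :: l).length : ℕ) : Fin (m + 1)) ∧
        ∀ (j : ℕ) (h : j < (i :: l).length), (i :: l)[j] = v (a + (j : Fin (m + 1)))) ↔
        (i = v a ∧ (c = a + 1 + ((l.length : ℕ) : Fin (m + 1)) ∧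
        ∀ (j : ℕ) (h : j < l.length), l[j] = v (a + 1 + (j : Fin (m + 1))))) := by
        have e : ∀ j : ℕ, a + ((j + 1 : ℕ) : Fin (m + 1)) = a + 1 + (j : Fin (m + 1)) := by
          intro j; push_cast; abel
        constructor
        · rintro ⟨h1, h2⟩
          refine ⟨(h2 0 (by simp)).trans (by simp), by rw [h1, ← e]; rfl, fun j h => ?_⟩
          rw [← e]
          exact h2 (j + 1) (by simpa using h)
        · rintro ⟨h0, h1, h2⟩
          refine ⟨by rw [h1, ← e]; rfl, fun j h => ?_⟩
          cases j with
          | zero => simpa using h0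
          | succ j => rw [e]; simpa using h2 j (by simpa using h)
      rw [if_congr key rfl rfl]
      by_cases h : i = v a
      · simp only [mat, h, and_self, if_true, one_mul, true_and]
      · simp only [mat, h, and_false, if_false, zero_mul, false_and]
    · intro b _ hb
      simp [mat, hb]
    · simp

lemma trace_mono {n m : ℕ} (v w : Fin (m + 1) → Fin n) :
    Matrix.trace (FreeAlgebra.lift ℤ (mat v) (mono w)) =
      ∑ a : Fin (m + 1), if ∀ j, w j = v (a + j) then (1 : ℤ) else 0 := by
  have : FreeAlgebra.lift ℤ (mat v) (mono w) = ((List.ofFn w).map (mat v)).prod := by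
    rw [mono, map_list_prod, List.map_ofFn, List.map_ofFn]
    congr 2
    ext1 i
    simp
  rw [this, Matrix.trace]
  refine Finset.sum_congr rfl fun a _ => ?_
  rw [Matrix.diag_apply, prod_apply]
  refine if_congr ?_ rfl rfl
  simp only [List.length_ofFn, List.getElem_ofFn]
  constructor
  · rintro ⟨_, h⟩ j
    simpa using h j j.2
  · intro h
    refine ⟨by simp, fun j hj => ?_⟩
    rw [h]
    congr 2
    ext
    simp [Fin.val_natCast, Nat.mod_eq_of_lt hj]

lemma mono_rot_one {n m : ℕ} (w : Fin (m + 1) → Fin n) :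
    mono w - mono (fun j => w (j + 1)) ∈ comm n := by
  refine AddSubgroup.subset_closure ⟨FreeAlgebra.ι ℤ (w 0),
    (List.ofFn fun i : Fin m => FreeAlgebra.ι ℤ (w i.succ)).prod, ?_⟩
  unfold mono
  rw [List.ofFn_succ, List.ofFn_succ' (f := fun i => FreeAlgebra.ι ℤ (w (i + 1)))]
  simp

lemma mono_rot {n m : ℕ} (w : Fin (m + 1) → Fin n) (s : ℕ) :
    mono w - mono (fun j => w (j + (s : Fin (m + 1)))) ∈ comm n := by
  induction s with
  | zero => simp [AddSubgroup.zero_mem]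
  | succ s ih =>
    have := AddSubgroup.add_mem _ ih (mono_rot_one (fun j => w (j + (s : Fin (m + 1)))))
    rw [sub_add_sub_cancel] at this
    convert this using 5
    push_cast; abel

/-- Words up to rotation. -/
def rotSetoid (n m : ℕ) : Setoid (Fin (m + 1) → Fin n) where
  r w v := ∃ t, ∀ j, w j = v (j + t)
  iseqv :=
    { refl := fun w => ⟨0, by simp⟩
      symm := by
        rintro w v ⟨t, h⟩
        exact ⟨-t, fun j => by rw [h]; simp⟩
      trans := by
        rintro w v u ⟨t, h⟩ ⟨s, h'⟩
        exact ⟨t + s, fun j => by rw [h, h', add_assoc]⟩ }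

lemma mono_rel {n m : ℕ} {w v : Fin (m + 1) → Fin n} (h : rotSetoid n m w v) :
    mono v - mono w ∈ comm n := by
  obtain ⟨t, h⟩ := h
  have := mono_rot v t.val
  convert this using 3
  ext1 j
  rw [h]; simp

open Classical in
lemma main {n m : ℕ} (c : (Fin (m + 1) → Fin n) → ℤ)
    (h : ∀ v : Fin (m + 1) → Fin n, ∑ w, c w *
      (∑ a : Fin (m + 1), if ∀ j, w j = v (a + j) then (1 : ℤ) else 0) = 0) :
    ∑ w, c w • mono w ∈ comm n := by
  let r : (Fin (m + 1) → Fin n) → (Fin (m + 1) → Fin n) :=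
    fun w => (Quotient.mk (rotSetoid n m) w).out
  have hr : ∀ w, rotSetoid n m (r w) w := fun w => Quotient.mk_out (s := rotSetoid n m) w
  have hr' : ∀ w v, rotSetoid n m w v → r w = r v := fun w v hwv => by
    simp only [r]
    rw [Quotient.sound (s := rotSetoid n m) hwv]
  have horb : ∀ v, ∑ w with rotSetoid n m w v, c w = 0 := by
    intro v
    set N : ℤ := ∑ a : Fin (m + 1), if ∀ j, v j = v (a + j) then (1 : ℤ) else 0 with hN
    have hpos : 0 < N := by
      refine Finset.sum_pos' (fun a _ => by split_ifs <;> simp) ⟨0, Finset.mem_univ _, ?_⟩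
      simp
    have hcount : ∀ w, (∑ a : Fin (m + 1), if ∀ j, w j = v (a + j) then (1 : ℤ) else 0) =
        if rotSetoid n m w v then N else 0 := by
      intro w
      split_ifs with hw
      · obtain ⟨t, ht⟩ := hw
        refine Fintype.sum_equiv (Equiv.subRight t) _ _ fun a => ?_
        refine if_congr ?_ rfl rfl
        simp only [Equiv.subRight_apply]
        constructor
        · intro H j
          have h1 := H (j - t)
          rw [ht, sub_add_cancel] at h1
          rw [h1]; congr 1; abel
        · intro H j
          rw [ht, H]; congr 1; abel
      · refine Finset.sum_eq_zero fun a _ => if_neg fun H => hw ⟨a, fun j => ?_⟩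
        rw [H, add_comm]
    have h1 := h v
    simp only [hcount, mul_ite, mul_zero] at h1
    rw [← Finset.sum_filter, ← Finset.sum_mul] at h1
    exact (mul_eq_zero.mp h1).resolve_right hpos.ne'
  have h0 : ∑ w, c w • mono (r w) = 0 := by
    rw [← Finset.sum_fiberwise Finset.univ r (fun w => c w • mono (r w))]
    refine Finset.sum_eq_zero fun v _ => ?_
    by_cases hv : ∃ u, r u = v
    · obtain ⟨u, hu⟩ := hv
      have e : ∀ w, r w = v ↔ rotSetoid n m w v := by
        intro w
        constructor
        · intro hw
          rw [← hw]
          exact (rotSetoid n m).symm (hr w)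
        · intro hw
          rw [hr' w v hw, ← hu]
          exact hr' _ _ (hr u)
      have : ∑ w with r w = v, c w • mono (r w) = (∑ w with r w = v, c w) • mono v := by
        rw [Finset.sum_smul]
        refine Finset.sum_congr rfl fun w hw => ?_
        rw [(Finset.mem_filter.mp hw).2]
      rw [this, Finset.filter_congr (fun w _ => e w), horb, zero_smul]
    · refine Finset.sum_eq_zero fun w hw => (hv ⟨w, (Finset.mem_filter.mp hw).2⟩).elim
  rw [← sub_zero (∑ w, c w • mono w), ← h0, ← Finset.sum_sub_distrib]
  refine AddSubgroup.sum_mem _ fun w _ => ?_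
  rw [← smul_sub]
  exact AddSubgroup.zsmul_mem _ (mono_rel (hr w)) _

end BryantAux

/-- **Bryant's criterion.** Let `f ∈ ℤ⟨X_1,…,X_n⟩` be a `ℤ`-linear combination of
monomials of length exactly `k` (`k ≥ 2`).  Let `E ⊆ M_k(ℤ)` be the additive subgroup
generated by the cyclic matrix units `e_{1,2}, …, e_{k-1,k}, e_{k,1}`.  If
`tr (f(C_1,…,C_n)) = 0` for all `C_1,…,C_n ∈ E`, then `f` lies in the additive subgroup
generated by commutators `uv - vu`. -/
theorem bryant_criterion (n k : ℕ) (hn : 1 ≤ n) (hk : 2 ≤ k)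
    (f : FreeAlgebra ℤ (Fin n))
    (hf : f ∈ Submodule.span ℤ
      {x : FreeAlgebra ℤ (Fin n) | ∃ w : Fin k → Fin n,
        x = (List.ofFn fun i => FreeAlgebra.ι ℤ (w i)).prod})
    (htr : ∀ C : Fin n → Matrix (Fin k) (Fin k) ℤ,
      (∀ i, C i ∈ AddSubgroup.closure
          {M : Matrix (Fin k) (Fin k) ℤ |
            ∃ a : Fin k, M = Matrix.single a (finRotate k a) 1}) →
      Matrix.trace (FreeAlgebra.lift ℤ C f) = 0) :
    f ∈ AddSubgroup.closure
      {x : FreeAlgebra ℤ (Fin n) | ∃ u v : FreeAlgebra ℤ (Fin n), x = u * v - v * u} := by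
  obtain ⟨m, rfl⟩ : ∃ m, k = m + 1 := ⟨k - 1, by omega⟩
  have hset : {x : FreeAlgebra ℤ (Fin n) | ∃ w : Fin (m + 1) → Fin n,
        x = (List.ofFn fun i => FreeAlgebra.ι ℤ (w i)).prod} =
      Set.range (BryantAux.mono (n := n) (k := m + 1)) := by
    ext x
    simp only [Set.mem_ofPred_eq, Set.mem_range, BryantAux.mono, eq_comm]
  rw [hset, Submodule.mem_span_range_iff_exists_fun] at hf
  obtain ⟨c, rfl⟩ := hf
  refine BryantAux.main c fun v => ?_
  have h := htr (BryantAux.mat v) (BryantAux.mat_mem v)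
  rw [map_sum, Matrix.trace_sum] at h
  refine Eq.trans ?_ h
  refine Finset.sum_congr rfl fun w _ => ?_
  rw [map_zsmul, Matrix.trace_smul, BryantAux.trace_mono, smul_eq_mul]
end
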